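/- arXiv:1601.02169 — 4 statements merged into one kernel-verified Lean document; each statement's English description precedes it below -/
import Mathlib

section
/- Let R be a ring and M a left R-module with finite Gorenstein projective dimension, i.e. there exists an integer d ≥ 0 and an exact sequence 0 → G_d → ⋯ → G_1 → G_0 → M → 0 of left R-modules with each G_i Gorenstein projective. Then M has a special Gorenstein projective precover: there exists a short exact sequence 0 → A → T → M → 0 of left R-modules with T Gorenstein projective and Ext¹_R(G', A) = 0 for every Gorenstein projective left R-module G'. -/
/-!
Common definitions: Gorenstein projective/flat modules, Ext-vanishing via projective
resolutions, Gorenstein projective dimension, flat and cotorsion modules over an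
arbitrary (possibly noncommutative) ring, tensor product of a right module with a
left module, coherence and perfectness conditions.
-/

universe u v

noncomputable section

open Function

namespace GorensteinPrecover

section Tensor

variable (R : Type u) [Ring R]

/-- The subgroup of `I ⊗ₗ[ℤ] F` by which one quotients to obtain the tensor product
`I ⊗[R] F` of a right `R`-module `I` with a left `R`-module `F`. -/
def tensorRel (I : Type v) [AddCommGroup I] [Module Rᵐᵒᵖ I]
    (F : Type v) [AddCommGroup F] [Module R F] :
    AddSubgroup (TensorProduct ℤ I F) :=
  AddSubgroup.closure
    {z | ∃ (r : R) (x : I) (y : F),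
      z = (MulOpposite.op r • x) ⊗ₜ[ℤ] y - x ⊗ₜ[ℤ] (r • y)}

/-- The tensor product `I ⊗[R] F` (an abelian group) of a right `R`-module `I` with a
left `R`-module `F` over a possibly noncommutative ring `R`. -/
def RTensor (I : Type v) [AddCommGroup I] [Module Rᵐᵒᵖ I]
    (F : Type v) [AddCommGroup F] [Module R F] : Type v :=
  TensorProduct ℤ I F ⧸ tensorRel R I F

instance (I : Type v) [AddCommGroup I] [Module Rᵐᵒᵖ I]
    (F : Type v) [AddCommGroup F] [Module R F] : AddCommGroup (RTensor R I F) :=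
  QuotientAddGroup.Quotient.addCommGroup _

/-- Functoriality of `I ⊗[R] -` in the left module variable. -/
def rtMap (I : Type v) [AddCommGroup I] [Module Rᵐᵒᵖ I]
    {F F' : Type v} [AddCommGroup F] [Module R F] [AddCommGroup F'] [Module R F']
    (g : F →ₗ[R] F') : RTensor R I F →+ RTensor R I F' :=
  QuotientAddGroup.map _ _
    (TensorProduct.map (LinearMap.id) (g.toAddMonoidHom.toIntLinearMap)).toAddMonoidHom
    (by
      refine (AddSubgroup.closure_le _).2 ?_
      rintro _ ⟨r, x, y, rfl⟩
      refine AddSubgroup.mem_comap.2 (AddSubgroup.subset_closure ⟨r, x, g y, ?_⟩)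
      simp [TensorProduct.map_tmul, map_smul])

/-- Functoriality of `- ⊗[R] F` in the right module variable. -/
def rtMapRight {I I' : Type v} [AddCommGroup I] [Module Rᵐᵒᵖ I]
    [AddCommGroup I'] [Module Rᵐᵒᵖ I']
    (F : Type v) [AddCommGroup F] [Module R F]
    (f : I →ₗ[Rᵐᵒᵖ] I') : RTensor R I F →+ RTensor R I' F :=
  QuotientAddGroup.map _ _
    (TensorProduct.map (f.toAddMonoidHom.toIntLinearMap) (LinearMap.id)).toAddMonoidHom
    (by
      refine (AddSubgroup.closure_le _).2 ?_
      rintro _ ⟨r, x, y, rfl⟩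
      refine AddSubgroup.mem_comap.2 (AddSubgroup.subset_closure ⟨r, f x, y, ?_⟩)
      simp [TensorProduct.map_tmul, map_smul])

end Tensor

section Defs

variable (R : Type u) [Ring R]

/-- A left `R`-module `M` is *Gorenstein projective* if there is an exact complex of
projective modules `⋯ → P₁ → P₀ → P₋₁ → ⋯` which stays exact after applying
`Hom(-, Q)` for every projective module `Q`, with `M ≅ ker (P₀ → P₋₁)`. -/
def IsGorensteinProjective (M : ModuleCat.{v} R) : Prop :=
  ∃ (P : ℤ → ModuleCat.{v} R) (d : ∀ i : ℤ, P (i + 1) →ₗ[R] P i),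
    (∀ i, Module.Projective R (P i)) ∧
    (∀ i, Function.Exact (d (i + 1)) (d i)) ∧
    (∀ Q : ModuleCat.{v} R, Module.Projective R Q →
      ∀ i : ℤ, Function.Exact
        (fun f : P i →ₗ[R] Q => f.comp (d i))
        (fun f : P (i + 1) →ₗ[R] Q => f.comp (d (i + 1)))) ∧
    Nonempty (M ≃ₗ[R] LinearMap.ker (d (-1)))

/-- A left `R`-module `M` is *flat* if tensoring with it preserves injectivity of maps
of right `R`-modules. -/
def IsFlatMod (M : ModuleCat.{v} R) : Prop :=
  ∀ (I I' : ModuleCat.{v} Rᵐᵒᵖ) (f : I →ₗ[Rᵐᵒᵖ] I'), Function.Injective f →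
    Function.Injective (rtMapRight R (M : Type v) f)

/-- A left `R`-module `M` is *Gorenstein flat* if there is an exact complex of flat
modules `⋯ → F₁ → F₀ → F₋₁ → ⋯` which stays exact after applying `I ⊗[R] -` for every
injective right `R`-module `I`, with `M ≅ ker (F₀ → F₋₁)`. -/
def IsGorensteinFlat (M : ModuleCat.{v} R) : Prop :=
  ∃ (F : ℤ → ModuleCat.{v} R) (d : ∀ i : ℤ, F (i + 1) →ₗ[R] F i),
    (∀ i, IsFlatMod R (F i)) ∧
    (∀ i, Function.Exact (d (i + 1)) (d i)) ∧
    (∀ I : ModuleCat.{v} Rᵐᵒᵖ, Module.Injective Rᵐᵒᵖ I →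
      ∀ i : ℤ, Function.Exact
        (rtMap R (I : Type v) (d (i + 1))) (rtMap R (I : Type v) (d i))) ∧
    Nonempty (M ≃ₗ[R] LinearMap.ker (d (-1)))

/-- A projective resolution `⋯ → P₁ → P₀ → M → 0` of a left `R`-module `M`. -/
structure ProjRes (M : ModuleCat.{v} R) where
  P : ℕ → ModuleCat.{v} R
  d : ∀ i : ℕ, P (i + 1) →ₗ[R] P i
  π : P 0 →ₗ[R] M
  projective : ∀ i, Module.Projective R (P i)
  surj : Function.Surjective π
  exact0 : Function.Exact (d 0) π
  exact : ∀ i, Function.Exact (d (i + 1)) (d i)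

/-- `ExtVanish R X Y m` says that `Ext^{m+1}_R(X, Y) = 0`, expressed by the exactness
of `Hom(P_m, Y) → Hom(P_{m+1}, Y) → Hom(P_{m+2}, Y)` for every projective resolution
`P` of `X`. -/
def ExtVanish (X Y : ModuleCat.{v} R) (m : ℕ) : Prop :=
  ∀ res : ProjRes R X,
    Function.Exact
      (fun f : res.P m →ₗ[R] Y => f.comp (res.d m))
      (fun f : res.P (m + 1) →ₗ[R] Y => f.comp (res.d (m + 1)))

/-- `Ext¹_R(X, Y) = 0`. -/
def Ext1Zero (X Y : ModuleCat.{v} R) : Prop := ExtVanish R X Y 0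

/-- `Y` lies in the right orthogonal class `GP^⊥` of the Gorenstein projective
modules: `Ext¹(G, Y) = 0` for every Gorenstein projective `G`. -/
def InGPOrth (Y : ModuleCat.{v} R) : Prop :=
  ∀ G : ModuleCat.{v} R, IsGorensteinProjective R G → Ext1Zero R G Y

/-- The Gorenstein projective dimension of `M` is at most `n`: there is an exact
sequence `0 → G_n → ⋯ → G_0 → M → 0` with all `G_i` Gorenstein projective (encoded by
an `ℕ`-indexed resolution vanishing in degrees `> n`). -/
def GorProjDimLE (M : ModuleCat.{v} R) (n : ℕ) : Prop :=
  ∃ (G : ℕ → ModuleCat.{v} R) (d : ∀ i : ℕ, G (i + 1) →ₗ[R] G i) (π : G 0 →ₗ[R] M),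
    (∀ i, IsGorensteinProjective R (G i)) ∧
    Function.Surjective π ∧
    Function.Exact (d 0) π ∧
    (∀ i, Function.Exact (d (i + 1)) (d i)) ∧
    (∀ i, n < i → Subsingleton (G i : Type v))

/-- The projective dimension of `M` is at most `n`: there is an exact sequence
`0 → P_n → ⋯ → P_0 → M → 0` with all `P_i` projective. -/
def ProjDimLE (M : ModuleCat.{v} R) (n : ℕ) : Prop :=
  ∃ (P : ℕ → ModuleCat.{v} R) (d : ∀ i : ℕ, P (i + 1) →ₗ[R] P i) (π : P 0 →ₗ[R] M),
    (∀ i, Module.Projective R (P i)) ∧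
    Function.Surjective π ∧
    Function.Exact (d 0) π ∧
    (∀ i, Function.Exact (d (i + 1)) (d i)) ∧
    (∀ i, n < i → Subsingleton (P i : Type v))

/-- A left `R`-module `C` is *cotorsion* if `Ext¹(K, C) = 0` for every flat `K`. -/
def IsCotorsion (C : ModuleCat.{v} R) : Prop :=
  ∀ K : ModuleCat.{v} R, IsFlatMod R K → Ext1Zero R K C

/-- The ring `R` is *left GF-closed* if the class of Gorenstein flat left `R`-modules
is closed under extensions. -/
def GFClosed : Prop :=
  ∀ (A B C : ModuleCat.{v} R) (f : A →ₗ[R] B) (g : B →ₗ[R] C),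
    Function.Injective f → Function.Surjective g → Function.Exact f g →
    IsGorensteinFlat R A → IsGorensteinFlat R C → IsGorensteinFlat R B

/-- The ring `R` is *right coherent* if every direct product of flat left `R`-modules
is flat. -/
def RightCoherent : Prop :=
  ∀ (ι : Type v) (M : ι → ModuleCat.{v} R), (∀ i, IsFlatMod R (M i)) →
    IsFlatMod R (ModuleCat.of R (∀ i, (M i : Type v)))

/-- The ring `R` is *left `n`-perfect* if every flat left `R`-module has projective
dimension at most `n`. -/
def LeftNPerfect (n : ℕ) : Prop :=
  ∀ F : ModuleCat.{v} R, IsFlatMod R F → ProjDimLE R F n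

/-- The ring `R` is *left perfect* if every flat left `R`-module is projective. -/
def LeftPerfect : Prop :=
  ∀ F : ModuleCat.{v} R, IsFlatMod R F → Module.Projective R F

end Defs

end GorensteinPrecover

end

namespace GorensteinPrecover

section Helpers

variable {R : Type u} [Ring R]

/-- Corestriction along an injective map. -/
theorem exists_lift_of_injective {X Y Z : Type v} [AddCommGroup X] [Module R X]
    [AddCommGroup Y] [Module R Y] [AddCommGroup Z] [Module R Z]
    (j : X →ₗ[R] Y) (hj : Function.Injective j) (f : Z →ₗ[R] Y)
    (h : ∀ z, ∃ x, j x = f z) : ∃ f' : Z →ₗ[R] X, ∀ z, j (f' z) = f z := by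
  choose g hg using h
  refine ⟨{ toFun := g, map_add' := ?_, map_smul' := ?_ }, hg⟩
  · intro a b
    apply hj
    simp [hg]
  · intro r a
    apply hj
    simp [hg]

/-- Factorisation through a surjective map. -/
theorem exists_desc_of_surjective {X Y Z : Type v} [AddCommGroup X] [Module R X]
    [AddCommGroup Y] [Module R Y] [AddCommGroup Z] [Module R Z]
    (p : Y →ₗ[R] X) (hp : Function.Surjective p) (f : Y →ₗ[R] Z)
    (h : ∀ y, p y = 0 → f y = 0) : ∃ f' : X →ₗ[R] Z, ∀ y, f' (p y) = f y := by
  choose g hg using hp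
  have key : ∀ y y', p y = p y' → f y = f y' := by
    intro y y' e
    have := h (y - y') (by simp [e])
    rw [map_sub] at this
    exact sub_eq_zero.1 this
  refine ⟨{ toFun := fun x => f (g x), map_add' := ?_, map_smul' := ?_ }, ?_⟩
  · intro a b
    rw [← map_add]
    apply key
    simp [hg]
  · intro r a
    rw [← map_smul]
    apply key
    simp [hg]
  · intro y
    exact key _ _ (hg _)

theorem exists_proj_lift {P X Y : Type v} [AddCommGroup P] [Module R P]
    [AddCommGroup X] [Module R X] [AddCommGroup Y] [Module R Y]
    (hP : Module.Projective R P) (p : X →ₗ[R] Y) (hp : Function.Surjective p)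
    (f : P →ₗ[R] Y) : ∃ g : P →ₗ[R] X, ∀ x, p (g x) = f x := by
  obtain ⟨g, hg⟩ := Module.projective_lifting_property p f hp
  exact ⟨g, fun x => LinearMap.congr_fun hg x⟩

/-- `SES j p`: short exact sequence. -/
structure SES {X Y Z : ModuleCat.{v} R} (j : X →ₗ[R] Y) (p : Y →ₗ[R] Z) : Prop where
  inj : Function.Injective j
  surj : Function.Surjective p
  zero : ∀ x, p (j x) = 0
  ex : ∀ y, p y = 0 → ∃ x, j x = y

/-- All maps to `Q` extend along `j`. -/
def Extends {X Y : ModuleCat.{v} R} (j : X →ₗ[R] Y) (Q : ModuleCat.{v} R) : Prop :=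
  ∀ f : X →ₗ[R] Q, ∃ g : Y →ₗ[R] Q, ∀ x, g (j x) = f x

/-- A short exact sequence `0 → X → P → Y → 0` with projective middle term which is
`Hom(-, Proj)`-exact. -/
def StepRel (X Y : ModuleCat.{v} R) : Prop :=
  ∃ (P : ModuleCat.{v} R) (j : X →ₗ[R] P) (p : P →ₗ[R] Y), Module.Projective R P ∧
    SES j p ∧ ∀ Q : ModuleCat.{v} R, Module.Projective R Q → Extends j Q

/-- A class of modules closed under steps in both directions. -/
def IsStep (S : ModuleCat.{v} R → Prop) : Prop :=
  ∀ M, S M → (∃ M', S M' ∧ StepRel M' M) ∧ (∃ M', S M' ∧ StepRel M M')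

theorem exists_int_seq {α : Type*} (r : α → α → Prop) (hl : ∀ a, ∃ b, r b a)
    (hr : ∀ a, ∃ b, r a b) (a : α) : ∃ f : ℤ → α, f 0 = a ∧ ∀ i, r (f (i + 1)) (f i) := by
  choose l hl using hl
  choose q hq using hr
  let f : ℤ → α := fun i => match i with
    | Int.ofNat n => l^[n] a
    | Int.negSucc n => q^[n + 1] a
  refine ⟨f, rfl, ?_⟩
  rintro (n | n)
  · change r (l^[n + 1] a) (l^[n] a)
    rw [Function.iterate_succ_apply']
    exact hl _
  · cases n with
    | zero => exact hq a
    | succ n =>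
      change r (q^[n + 1] a) (q^[n + 1 + 1] a)
      rw [Function.iterate_succ_apply' q (n + 1)]
      exact hq _

theorem gp_of_isStep {S : ModuleCat.{v} R → Prop} (hS : IsStep S) {M : ModuleCat.{v} R}
    (hM : S M) : IsGorensteinProjective R M := by
  obtain ⟨f, hf0, hf⟩ := exists_int_seq (α := {M : ModuleCat.{v} R // S M})
    (fun X Y => StepRel X.1 Y.1)
    (fun a => by obtain ⟨b, hb, h⟩ := (hS a.1 a.2).1; exact ⟨⟨b, hb⟩, h⟩)
    (fun a => by obtain ⟨b, hb, h⟩ := (hS a.1 a.2).2; exact ⟨⟨b, hb⟩, h⟩) ⟨M, hM⟩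
  obtain ⟨G, hG1, hG⟩ : ∃ G : ℤ → ModuleCat.{v} R, G (-1 + 1 + 1) = M ∧
      ∀ i, StepRel (G (i + 1)) (G i) := by
    refine ⟨fun i => (f (i - 1)).1, ?_, ?_⟩
    · change (f 0).1 = M
      rw [hf0]
    · intro i
      have e : i + 1 - 1 = (i - 1) + 1 := by ring
      simp only [e]
      exact hf (i - 1)
  subst hG1
  choose P j p hP hses hext using hG
  refine ⟨P, fun i => (j i).comp (p (i + 1)), hP, ?_, ?_, ?_⟩
  · intro i y
    constructor
    · intro h
      have h1 : p (i + 1) y = 0 := (hses i).inj (by simpa using h)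
      obtain ⟨x, rfl⟩ := (hses (i + 1)).ex y h1
      obtain ⟨z, rfl⟩ := (hses (i + 1 + 1)).surj x
      exact ⟨z, rfl⟩
    · rintro ⟨z, rfl⟩
      simp [(hses (i + 1)).zero]
  · intro Q hQ i f
    constructor
    · intro h
      have h1 : ∀ y, p (i + 1) y = 0 → f y = 0 := by
        intro y hy
        obtain ⟨x, rfl⟩ := (hses (i + 1)).ex y hy
        obtain ⟨z, rfl⟩ := (hses (i + 1 + 1)).surj x
        exact LinearMap.congr_fun h z
      obtain ⟨g, hg⟩ := exists_desc_of_surjective (p (i + 1)) (hses (i + 1)).surj f h1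
      obtain ⟨k, hk⟩ := hext i Q hQ g
      refine ⟨k, ?_⟩
      ext y
      simp [hk, hg]
    · rintro ⟨k, rfl⟩
      ext y
      simp [(hses (i + 1)).zero]
  · have hk : ∀ x, j (-1 + 1) x ∈ LinearMap.ker ((j (-1)).comp (p (-1 + 1))) := by
      intro x
      rw [LinearMap.mem_ker, LinearMap.comp_apply, (hses (-1 + 1)).zero, map_zero]
    refine ⟨LinearEquiv.ofBijective ((j (-1 + 1)).codRestrict _ hk) ⟨?_, ?_⟩⟩
    · intro a b h
      exact (hses (-1 + 1)).inj (congrArg Subtype.val h)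
    · rintro ⟨y, hy⟩
      have h1 : p (-1 + 1) y = 0 := (hses (-1)).inj (by simpa using hy)
      obtain ⟨x, hx⟩ := (hses (-1 + 1)).ex y h1
      exact ⟨x, Subtype.ext hx⟩

theorem StepRel.congr {X Y X' Y' : ModuleCat.{v} R} (h : StepRel X Y)
    (e : X' ≃ₗ[R] X) (e' : Y ≃ₗ[R] Y') : StepRel X' Y' := by
  obtain ⟨P, j, p, hP, hs, hx⟩ := h
  refine ⟨P, j.comp e.toLinearMap, e'.toLinearMap.comp p, hP, ⟨?_, ?_, ?_, ?_⟩, ?_⟩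
  · exact hs.inj.comp e.injective
  · exact e'.surjective.comp hs.surj
  · intro x
    simp [hs.zero]
  · intro y hy
    obtain ⟨x, hx⟩ := hs.ex y (by simpa using hy)
    exact ⟨e.symm x, by simpa using hx⟩
  · intro Q hQ f
    obtain ⟨g, hg⟩ := hx Q hQ (f.comp e.symm.toLinearMap)
    exact ⟨g, fun x => by simp [hg]⟩

theorem gp_mem_isStep {M : ModuleCat.{v} R} (hM : IsGorensteinProjective R M) :
    ∃ S : ModuleCat.{v} R → Prop, IsStep S ∧ S M := by
  obtain ⟨P, d, hP, hex, hhom, he⟩ := hM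
  have key : ∀ i, StepRel (ModuleCat.of R (LinearMap.ker (d (i + 1))))
      (ModuleCat.of R (LinearMap.ker (d i))) := by
    intro i
    have hk : ∀ i x, d (i + 1) x ∈ LinearMap.ker (d i) := by
      intro i x
      exact (hex i _).2 ⟨x, rfl⟩
    refine ⟨P (i + 1 + 1), (LinearMap.ker (d (i + 1))).subtype,
      (d (i + 1)).codRestrict _ (hk i), hP _, ⟨?_, ?_, ?_, ?_⟩, ?_⟩
    · exact Subtype.val_injective
    · rintro ⟨y, hy⟩
      obtain ⟨x, hx⟩ := (hex i y).1 hy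
      exact ⟨x, Subtype.ext hx⟩
    · rintro ⟨x, hx⟩
      exact Subtype.ext hx
    · intro y hy
      exact ⟨⟨y, congrArg Subtype.val hy⟩, rfl⟩
    · intro Q hQ f
      have h0 : ((f : LinearMap.ker (d (i + 1)) →ₗ[R] Q).comp
          ((d (i + 1 + 1)).codRestrict _ (hk (i + 1)))).comp (d (i + 1 + 1 + 1)) = 0 := by
        ext x
        have : (d (i + 1 + 1)).codRestrict _ (hk (i + 1)) (d (i + 1 + 1 + 1) x) = 0 :=
          Subtype.ext ((hex (i + 1 + 1) _).2 ⟨x, rfl⟩)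
        simp only [LinearMap.comp_apply, this, map_zero, LinearMap.zero_apply]
      obtain ⟨g, hg⟩ := (hhom Q hQ (i + 1 + 1) _).1 h0
      refine ⟨g, ?_⟩
      rintro ⟨x, hx⟩
      obtain ⟨z, rfl⟩ := (hex (i + 1) x).1 hx
      exact LinearMap.congr_fun hg z
  refine ⟨fun M => ∃ i, Nonempty (M ≃ₗ[R] LinearMap.ker (d i)), ?_, ⟨-1, he⟩⟩
  rintro N ⟨i, ⟨e⟩⟩
  constructor
  · exact ⟨ModuleCat.of R (LinearMap.ker (d (i + 1))), ⟨i + 1, ⟨LinearEquiv.refl R _⟩⟩,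
      (key i).congr (LinearEquiv.refl R _) e.symm⟩
  · obtain ⟨k, rfl⟩ : ∃ k, i = k + 1 := ⟨i - 1, by ring⟩
    exact ⟨ModuleCat.of R (LinearMap.ker (d k)), ⟨k, ⟨LinearEquiv.refl R _⟩⟩,
      (key k).congr e (LinearEquiv.refl R _)⟩

theorem gp_isStep : IsStep (IsGorensteinProjective (R := R) : ModuleCat.{v} R → Prop) := by
  intro M hM
  obtain ⟨S, hS, hSM⟩ := gp_mem_isStep hM
  obtain ⟨⟨X, hX, hX'⟩, ⟨Y, hY, hY'⟩⟩ := hS M hSM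
  exact ⟨⟨X, gp_of_isStep hS hX, hX'⟩, ⟨Y, gp_of_isStep hS hY, hY'⟩⟩

theorem gp_congr {M N : ModuleCat.{v} R} (hM : IsGorensteinProjective R M)
    (e : N ≃ₗ[R] M) : IsGorensteinProjective R N := by
  obtain ⟨P, d, h1, h2, h3, ⟨e'⟩⟩ := hM
  exact ⟨P, d, h1, h2, h3, ⟨e.trans e'⟩⟩

/-- If maps to `Q` extend along one projective presentation of `C`, they extend along any
monomorphism with cokernel `C`. -/
theorem extends_of_ses {K P C A B : ModuleCat.{v} R} {j : K →ₗ[R] P} {p : P →ₗ[R] C}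
    (hP : Module.Projective R P) (hs : SES j p) {i : A →ₗ[R] B} {q : B →ₗ[R] C}
    (ht : SES i q) {Q : ModuleCat.{v} R} (hx : Extends j Q) : Extends i Q := by
  intro f
  obtain ⟨l, hl⟩ := exists_proj_lift hP q ht.surj p
  obtain ⟨k, hk⟩ := exists_lift_of_injective i ht.inj (l.comp j)
    (fun z => ht.ex _ (by simp [hl, hs.zero]))
  obtain ⟨h, hh⟩ := hx (f.comp k)
  have hsurj : Function.Surjective (i.coprod l) := by
    intro b
    obtain ⟨y, hy⟩ := hs.surj (q b)
    obtain ⟨a, ha⟩ := ht.ex (b - l y) (by simp [hl, hy])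
    exact ⟨(a, y), by simp [ha]⟩
  obtain ⟨g, hg⟩ := exists_desc_of_surjective (i.coprod l) hsurj (f.coprod h) (by
    rintro ⟨a, y⟩ hay
    simp only [LinearMap.coprod_apply] at hay ⊢
    have hy : p y = 0 := by
      have := congrArg q hay
      simpa [ht.zero, hl] using this
    obtain ⟨x, rfl⟩ := hs.ex y hy
    have hkx := hk x
    simp only [LinearMap.comp_apply] at hkx
    rw [← hkx, ← map_add] at hay
    have h0 : a + k x = 0 := ht.inj (by simpa using hay)
    rw [hh, LinearMap.comp_apply, ← map_add, h0, map_zero])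
  refine ⟨g, fun x => ?_⟩
  have := hg (x, 0)
  simpa using this

/-- Extension along a `3 × 3` diagram. -/
theorem extends_three {A B C X Z : ModuleCat.{v} R} {i : A →ₗ[R] B} {q : B →ₗ[R] C}
    (ht : SES i q) {jA : A →ₗ[R] X} {jC : C →ₗ[R] Z} (u : B →ₗ[R] X)
    (hu : ∀ a, u (i a) = jA a) {Q : ModuleCat.{v} R} (hA : Extends jA Q) (hC : Extends jC Q)
    (f : B →ₗ[R] Q) : ∃ (g : X →ₗ[R] Q) (h : Z →ₗ[R] Q), ∀ b,
      g (u b) + h (jC (q b)) = f b := by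
  obtain ⟨g, hg⟩ := hA (f.comp i)
  obtain ⟨k, hk⟩ := exists_desc_of_surjective q ht.surj (f - g.comp u) (by
    intro b hb
    obtain ⟨a, rfl⟩ := ht.ex b hb
    simp [hu, hg])
  obtain ⟨h, hh⟩ := hC k
  refine ⟨g, h, fun b => ?_⟩
  rw [hh, hk]
  simp

/-- Gorenstein projective modules are closed under extensions. -/
theorem gp_ext {A B C : ModuleCat.{v} R} {i : A →ₗ[R] B} {q : B →ₗ[R] C} (ht : SES i q)
    (hA : IsGorensteinProjective R A) (hC : IsGorensteinProjective R C) :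
    IsGorensteinProjective R B := by
  refine gp_of_isStep (S := fun B => ∃ (A C : ModuleCat.{v} R) (i : A →ₗ[R] B)
    (q : B →ₗ[R] C), SES i q ∧ IsGorensteinProjective R A ∧ IsGorensteinProjective R C) ?_
    ⟨A, C, i, q, ht, hA, hC⟩
  clear ht hA hC i q A B C
  rintro B ⟨A, C, i, q, ht, hA, hC⟩
  obtain ⟨⟨A', hA', PA, jA, pA, hPA, hsA, hxA⟩, ⟨A2, hA2, QA, kA, rA, hQA, htA, hyA⟩⟩ :=
    gp_isStep A hA
  obtain ⟨⟨C', hC', PC, jC, pC, hPC, hsC, hxC⟩, ⟨C2, hC2, QC, kC, rC, hQC, htC, hyC⟩⟩ :=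
    gp_isStep C hC
  constructor
  · obtain ⟨l, hl⟩ := exists_proj_lift hPC q ht.surj pC
    let φ : PA × PC →ₗ[R] B := (i.comp pA).coprod l
    have hφ : ∀ x y, φ (x, y) = i (pA x) + l y := fun x y => by simp [φ]
    have hφs : Function.Surjective φ := by
      intro b
      obtain ⟨y, hy⟩ := hsC.surj (q b)
      obtain ⟨a, ha⟩ := ht.ex (b - l y) (by simp [hl, hy])
      obtain ⟨x, rfl⟩ := hsA.surj a
      exact ⟨(x, y), by simp [hφ, ha]⟩
    let K : ModuleCat.{v} R := ModuleCat.of R (LinearMap.ker φ)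
    let ι : K →ₗ[R] ModuleCat.of R (PA × PC) := (LinearMap.ker φ).subtype
    have hι : Function.Injective ι := Subtype.val_injective
    have hιφ : ∀ x, φ (ι x) = 0 := fun x => x.2
    have hιex : ∀ y, φ y = 0 → ∃ x, ι x = y := fun y hy => ⟨⟨y, hy⟩, rfl⟩
    obtain ⟨s, hs⟩ := exists_lift_of_injective ι hι
      ((LinearMap.inl R PA PC).comp jA) (fun z => hιex _ (by
        simp [hφ, hsA.zero]))
    obtain ⟨t, ht'⟩ := exists_lift_of_injective jC hsC.inj
      ((LinearMap.snd R PA PC).comp ι) (fun z => hsC.ex _ (by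
        have h := hιφ z
        obtain ⟨⟨x, y⟩, h'⟩ : ∃ w : PA × PC, ι z = w := ⟨_, rfl⟩
        have := congrArg q h
        rw [h', hφ] at this
        simpa [ht.zero, hl, h'] using this))
    have hst : SES s t := by
      refine ⟨?_, ?_, ?_, ?_⟩
      · intro a b hab
        apply hsA.inj
        have h1 := hs a
        have h2 := hs b
        rw [hab, h2] at h1
        exact (congrArg Prod.fst h1).symm
      · intro c
        obtain ⟨a, ha⟩ := ht.ex (l (jC c)) (by simp [hl, hsC.zero])
        obtain ⟨x, rfl⟩ := hsA.surj a
        obtain ⟨z, hz⟩ := hιex (-x, jC c) (by simp [hφ, ha])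
        refine ⟨z, hsC.inj ?_⟩
        rw [ht']
        simp [hz]
      · intro a
        apply hsC.inj
        rw [ht', LinearMap.comp_apply, hs]
        simp
      · intro z hz
        have h2 := ht' z
        rw [hz] at h2
        have h := hιφ z
        obtain ⟨⟨x, y⟩, h'⟩ : ∃ w : PA × PC, ι z = w := ⟨_, rfl⟩
        have hy : y = 0 := by simpa [h'] using h2.symm
        subst hy
        rw [h', hφ] at h
        have hx : pA x = 0 := ht.inj (by simpa using h)
        obtain ⟨a, rfl⟩ := hsA.ex x hx
        refine ⟨a, hι ?_⟩
        rw [hs, h']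
        rfl
    refine ⟨K, ⟨A', C', s, t, hst, hA', hC'⟩, ModuleCat.of R (PA × PC), ι, φ, ?_,
      ⟨hι, hφs, hιφ, hιex⟩, ?_⟩
    · exact inferInstanceAs (Module.Projective R (PA × PC))
    · intro Q hQ f
      obtain ⟨g, h, hgh⟩ := extends_three hst (jA := jA) (jC := jC)
        ((LinearMap.fst R PA PC).comp ι) (fun a => by
          rw [LinearMap.comp_apply, hs]
          simp) (hxA Q hQ) (hxC Q hQ) f
      refine ⟨g.coprod h, fun x => ?_⟩
      rw [← hgh, ht']
      simp
  · obtain ⟨⟨_, _, PC, jC, pC, hPC, hsC, hxC⟩, _⟩ := gp_isStep C hC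
    obtain ⟨u, hu⟩ := extends_of_ses hPC hsC ht (hxC QA hQA) kA
    let φ : B →ₗ[R] QA × QC := u.prod (kC.comp q)
    have hφ : ∀ b, φ b = (u b, kC (q b)) := fun b => rfl
    have hφi : Function.Injective φ := by
      rw [injective_iff_map_eq_zero]
      intro b hb
      rw [hφ] at hb
      have h1 : q b = 0 := htC.inj (by simpa using congrArg Prod.snd hb)
      obtain ⟨a, rfl⟩ := ht.ex b h1
      have h2 : a = 0 := htA.inj (by simpa [hu] using congrArg Prod.fst hb)
      simp [h2]
    let W : ModuleCat.{v} R := ModuleCat.of R ((QA × QC) ⧸ LinearMap.range φ)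
    let ψ : QA × QC →ₗ[R] W := (LinearMap.range φ).mkQ
    have hψs : Function.Surjective ψ := Submodule.mkQ_surjective _
    have hψ : ∀ y, ψ y = 0 ↔ ∃ b, φ b = y := fun y => Submodule.Quotient.mk_eq_zero _
    obtain ⟨s, hs⟩ := exists_desc_of_surjective rA htA.surj
      (ψ.comp (LinearMap.inl R QA QC)) (fun y hy => by
        obtain ⟨a, rfl⟩ := htA.ex y hy
        exact (hψ _).2 ⟨i a, by simp [hφ, hu, ht.zero]⟩)
    obtain ⟨t, ht'⟩ := exists_desc_of_surjective ψ hψs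
      (rC.comp (LinearMap.snd R QA QC)) (fun y hy => by
        obtain ⟨b, rfl⟩ := (hψ _).1 hy
        simp [hφ, htC.zero])
    have hst : SES s t := by
      refine ⟨?_, ?_, ?_, ?_⟩
      · rw [injective_iff_map_eq_zero]
        intro x hx
        obtain ⟨x, rfl⟩ := htA.surj x
        rw [hs] at hx
        obtain ⟨b, hb⟩ := (hψ _).1 hx
        rw [hφ] at hb
        have h1 : q b = 0 := htC.inj (by simpa using congrArg Prod.snd hb)
        obtain ⟨a, rfl⟩ := ht.ex b h1
        have h2 : kA a = x := by simpa [hu] using congrArg Prod.fst hb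
        rw [← h2, htA.zero]
      · intro c
        obtain ⟨y, rfl⟩ := htC.surj c
        exact ⟨ψ (0, y), by rw [ht']; simp⟩
      · intro x
        obtain ⟨x, rfl⟩ := htA.surj x
        rw [hs, LinearMap.comp_apply, ht']
        simp
      · intro w hw
        obtain ⟨⟨x, y⟩, rfl⟩ := hψs w
        rw [ht'] at hw
        obtain ⟨c, rfl⟩ := htC.ex y (by simpa using hw)
        obtain ⟨b, rfl⟩ := ht.surj c
        refine ⟨rA (x - u b), ?_⟩
        rw [hs, LinearMap.comp_apply, ← sub_eq_zero, ← map_sub]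
        exact (hψ _).2 ⟨-b, by simp [hφ]⟩
    refine ⟨W, ⟨A2, C2, s, t, hst, hA2, hC2⟩, ModuleCat.of R (QA × QC), φ, ψ, ?_,
      ⟨hφi, hψs, fun b => (hψ _).2 ⟨b, rfl⟩, fun y hy => (hψ _).1 hy⟩, ?_⟩
    · exact inferInstanceAs (Module.Projective R (QA × QC))
    · intro Q hQ f
      obtain ⟨g, h, hgh⟩ := extends_three ht (jA := kA) (jC := kC) u hu
        (hyA Q hQ) (hyC Q hQ) f
      exact ⟨g.coprod h, fun x => by rw [← hgh]; simp [hφ]⟩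

/-- Working form of `Ext¹(G, Y) = 0` for all Gorenstein projective `G`. -/
def Orth (Y : ModuleCat.{v} R) : Prop :=
  ∀ (G A B : ModuleCat.{v} R) (i : A →ₗ[R] B) (q : B →ₗ[R] G),
    IsGorensteinProjective R G → SES i q → Extends i Y

theorem Orth.of_projective {Q : ModuleCat.{v} R} (hQ : Module.Projective R Q) : Orth Q := by
  intro G A B i q hG ht
  obtain ⟨⟨_, _, PC, jC, pC, hPC, hsC, hxC⟩, _⟩ := gp_isStep G hG
  exact extends_of_ses hPC hsC ht (hxC Q hQ)

theorem Orth.lift {A Q W : ModuleCat.{v} R} {i : A →ₗ[R] Q} {q : Q →ₗ[R] W} (ht : SES i q)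
    (hA : Orth A) {K : ModuleCat.{v} R} (hK : IsGorensteinProjective R K) (f : K →ₗ[R] W) :
    ∃ g : K →ₗ[R] Q, ∀ x, q (g x) = f x := by
  obtain ⟨⟨_, _, P, j, p, hP, hs, _⟩, _⟩ := gp_isStep K hK
  obtain ⟨l, hl⟩ := exists_proj_lift hP q ht.surj (f.comp p)
  obtain ⟨k, hk⟩ := exists_lift_of_injective i ht.inj (l.comp j)
    (fun z => ht.ex _ (by simp [hl, hs.zero]))
  obtain ⟨h, hh⟩ := hA _ _ _ j p hK hs k
  obtain ⟨g, hg⟩ := exists_desc_of_surjective p hs.surj (l - i.comp h) (by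
    intro y hy
    obtain ⟨x, rfl⟩ := hs.ex y hy
    simp [hh, hk])
  refine ⟨g, fun x => ?_⟩
  obtain ⟨y, rfl⟩ := hs.surj x
  rw [hg]
  simp [hl, ht.zero]

theorem Orth.quot {A Q W : ModuleCat.{v} R} {i : A →ₗ[R] Q} {q : Q →ₗ[R] W} (ht : SES i q)
    (hA : Orth A) (hQ : Orth Q) : Orth W := by
  intro G X Y a b hG hab
  obtain ⟨⟨K, hK, P, j, p, hP, hs, _⟩, _⟩ := gp_isStep G hG
  refine extends_of_ses hP hs hab ?_
  intro f
  obtain ⟨g, hg⟩ := Orth.lift ht hA hK f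
  obtain ⟨h, hh⟩ := hQ _ _ _ j p hG hs g
  exact ⟨q.comp h, fun x => by simp [hh, hg]⟩

theorem Orth.ext1Zero {Y : ModuleCat.{v} R} (hY : Orth Y) {G : ModuleCat.{v} R}
    (hG : IsGorensteinProjective R G) : Ext1Zero R G Y := by
  intro res f
  constructor
  · intro h
    have hs : SES (X := ModuleCat.of R (LinearMap.ker res.π)) (LinearMap.ker res.π).subtype
        res.π := ⟨Subtype.val_injective, res.surj, fun x => x.2, fun y hy => ⟨⟨y, hy⟩, rfl⟩⟩
    obtain ⟨c, hc⟩ := exists_lift_of_injective (LinearMap.ker res.π).subtype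
      Subtype.val_injective (res.d 0) (fun z => ⟨⟨_, (res.exact0 _).2 ⟨z, rfl⟩⟩, rfl⟩)
    have hcs : Function.Surjective c := by
      rintro ⟨y, hy⟩
      obtain ⟨x, hx⟩ := (res.exact0 y).1 hy
      exact ⟨x, Subtype.ext ((hc x).trans hx)⟩
    obtain ⟨g, hg⟩ := exists_desc_of_surjective c hcs f (by
      intro y hy
      have h0 : res.d 0 y = 0 := by rw [← hc, hy]; simp
      obtain ⟨x, rfl⟩ := (res.exact 0 y).1 h0
      exact LinearMap.congr_fun h x)
    obtain ⟨k, hk⟩ := hY _ _ _ _ _ hG hs g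
    refine ⟨k, ?_⟩
    ext y
    have h1 := hk (c y)
    rw [hg, hc] at h1
    exact h1
  · rintro ⟨k, rfl⟩
    ext y
    have h0 : res.d 0 (res.d (0 + 1) y) = 0 := (res.exact 0 _).2 ⟨y, rfl⟩
    simp only [LinearMap.comp_apply, h0, map_zero, LinearMap.zero_apply]

theorem main_induction (n : ℕ) : ∀ M : ModuleCat.{v} R, GorProjDimLE R M n →
    ∃ (A T : ModuleCat.{v} R) (ι : A →ₗ[R] T) (π : T →ₗ[R] M), SES ι π ∧
      IsGorensteinProjective R T ∧ Orth A := by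
  induction n with
  | zero =>
    rintro M ⟨G, d, π, hG, hπ, hex0, hex, hsub⟩
    refine ⟨ModuleCat.of R PUnit, G 0, 0, π, ⟨?_, hπ, ?_, ?_⟩, hG 0, ?_⟩
    · intro a b _
      rfl
    · intro x
      simp
    · intro y hy
      obtain ⟨x, rfl⟩ := (hex0 y).1 hy
      have := hsub (0 + 1) (by omega)
      have hx : x = 0 := Subsingleton.elim _ _
      exact ⟨0, by simp [hx]⟩
    · intro G A B i q _ _ f
      exact ⟨0, fun x => rfl⟩
  | succ n ih =>
    rintro M ⟨G, d, π, hG, hπ, hex0, hex, hsub⟩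
    let K : ModuleCat.{v} R := ModuleCat.of R (LinearMap.ker π)
    let κ : K →ₗ[R] G 0 := (LinearMap.ker π).subtype
    have hκ : Function.Injective κ := Subtype.val_injective
    have hκ0 : ∀ x, π (κ x) = 0 := fun x => x.2
    have hκex : ∀ y, π y = 0 → ∃ x, κ x = y := fun y hy => ⟨⟨y, hy⟩, rfl⟩
    obtain ⟨c, hc⟩ := exists_lift_of_injective κ hκ (d 0)
      (fun z => hκex _ ((hex0 _).2 ⟨z, rfl⟩))
    have hK : GorProjDimLE R K n := by
      refine ⟨fun i => G (i + 1), fun i => d (i + 1), c, fun i => hG _, ?_, ?_,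
        fun i => hex (i + 1), fun i hi => hsub (i + 1) (by omega)⟩
      · intro y
        obtain ⟨x, hx⟩ := (hex0 (κ y)).1 (hκ0 y)
        exact ⟨x, hκ ((hc x).trans hx)⟩
      · intro y
        rw [← hex 0 y, ← hc]
        constructor
        · intro h
          rw [h, map_zero]
        · intro h
          exact hκ (by rw [h, map_zero])
    obtain ⟨A, T, ι, ρ, hs, hT, hA⟩ := ih K hK
    obtain ⟨_, ⟨T2, hT2, Q, j, p, hQ, ht, _⟩⟩ := gp_isStep T hT
    let φ : T →ₗ[R] G 0 × Q := (κ.comp ρ).prod j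
    have hφ : ∀ x, φ x = (κ (ρ x), j x) := fun x => rfl
    let D : ModuleCat.{v} R := ModuleCat.of R ((G 0 × Q) ⧸ LinearMap.range φ)
    let ψ : G 0 × Q →ₗ[R] D := (LinearMap.range φ).mkQ
    have hψs : Function.Surjective ψ := Submodule.mkQ_surjective _
    have hψ : ∀ y, ψ y = 0 ↔ ∃ b, φ b = y := fun y => Submodule.Quotient.mk_eq_zero _
    let W : ModuleCat.{v} R := ModuleCat.of R (Q ⧸ LinearMap.range (j.comp ι))
    let ω : Q →ₗ[R] W := (LinearMap.range (j.comp ι)).mkQ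
    have hωs : Function.Surjective ω := Submodule.mkQ_surjective _
    have hω : ∀ y, ω y = 0 ↔ ∃ b, j (ι b) = y := fun y => Submodule.Quotient.mk_eq_zero _
    have hW : Orth W := by
      refine Orth.quot (i := j.comp ι) (q := ω) ⟨?_, hωs, ?_, ?_⟩ hA (Orth.of_projective hQ)
      · exact ht.inj.comp hs.inj
      · exact fun x => (hω _).2 ⟨x, rfl⟩
      · exact fun y hy => (hω _).1 hy
    have hD : IsGorensteinProjective R D := by
      obtain ⟨t, ht'⟩ := exists_desc_of_surjective ψ hψs (p.comp (LinearMap.snd R (G 0) Q))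
        (fun y hy => by
          obtain ⟨b, rfl⟩ := (hψ _).1 hy
          simp [hφ, ht.zero])
      refine gp_ext (i := ψ.comp (LinearMap.inl R (G 0) Q)) (q := t) ⟨?_, ?_, ?_, ?_⟩
        (hG 0) hT2
      · rw [injective_iff_map_eq_zero]
        intro x hx
        obtain ⟨b, hb⟩ := (hψ _).1 hx
        rw [hφ] at hb
        have h1 : b = 0 := ht.inj (by simpa using congrArg Prod.snd hb)
        subst h1
        simpa using (congrArg Prod.fst hb).symm
      · intro y
        obtain ⟨z, rfl⟩ := ht.surj y
        exact ⟨ψ (0, z), by rw [ht']; simp⟩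
      · intro x
        rw [LinearMap.comp_apply, ht']
        simp
      · intro w hw
        obtain ⟨⟨x, y⟩, rfl⟩ := hψs w
        rw [ht'] at hw
        obtain ⟨b, rfl⟩ := ht.ex y (by simpa using hw)
        refine ⟨x - κ (ρ b), ?_⟩
        rw [LinearMap.comp_apply, ← sub_eq_zero, ← map_sub]
        exact (hψ _).2 ⟨-b, by simp [hφ]⟩
    obtain ⟨m, hm⟩ := exists_desc_of_surjective ψ hψs (π.comp (LinearMap.fst R (G 0) Q))
      (fun y hy => by
        obtain ⟨b, rfl⟩ := (hψ _).1 hy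
        simp [hφ, hκ0])
    obtain ⟨e, he⟩ := exists_desc_of_surjective ω hωs (ψ.comp (LinearMap.inr R (G 0) Q))
      (fun y hy => by
        obtain ⟨b, rfl⟩ := (hω _).1 hy
        exact (hψ _).2 ⟨ι b, by simp [hφ, hs.zero]⟩)
    refine ⟨W, D, e, m, ⟨?_, ?_, ?_, ?_⟩, hD, hW⟩
    · rw [injective_iff_map_eq_zero]
      intro x hx
      obtain ⟨y, rfl⟩ := hωs x
      rw [he] at hx
      obtain ⟨b, hb⟩ := (hψ _).1 hx
      rw [hφ] at hb
      have h1 : ρ b = 0 := hκ (by simpa using congrArg Prod.fst hb)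
      obtain ⟨a, rfl⟩ := hs.ex b h1
      exact (hω _).2 ⟨a, by simpa using congrArg Prod.snd hb⟩
    · intro y
      obtain ⟨x, rfl⟩ := hπ y
      exact ⟨ψ (x, 0), by rw [hm]; simp⟩
    · intro x
      obtain ⟨y, rfl⟩ := hωs x
      rw [he, LinearMap.comp_apply, hm]
      simp
    · intro w hw
      obtain ⟨⟨x, y⟩, rfl⟩ := hψs w
      rw [hm] at hw
      obtain ⟨k, rfl⟩ := hκex x (by simpa using hw)
      obtain ⟨b, rfl⟩ := hs.surj k
      refine ⟨ω (y - j b), ?_⟩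
      rw [he, LinearMap.comp_apply, ← sub_eq_zero, ← map_sub]
      exact (hψ _).2 ⟨-b, by simp [hφ]⟩

end Helpers

/-- Every left module of finite Gorenstein projective dimension has a
special Gorenstein projective precover: there is a short exact sequence
`0 → A → T → M → 0` with `T` Gorenstein projective and `Ext¹(G', A) = 0` for every
Gorenstein projective `G'`. -/
theorem special_gp_precover_of_finite_gpd
    (R : Type u) [Ring R] (M : ModuleCat.{v} R)
    (hM : ∃ d : ℕ, GorProjDimLE R M d) :
    ∃ (A T : ModuleCat.{v} R) (ι : A →ₗ[R] T) (π : T →ₗ[R] M),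
      Function.Injective ι ∧ Function.Surjective π ∧ Function.Exact ι π ∧
      IsGorensteinProjective R T ∧
      (∀ G' : ModuleCat.{v} R, IsGorensteinProjective R G' → Ext1Zero R G' A) := by
  obtain ⟨d, hd⟩ := hM
  obtain ⟨A, T, ι, π, hs, hT, hA⟩ := main_induction d M hd
  refine ⟨A, T, ι, π, hs.inj, hs.surj, ?_, hT, fun G' hG' => hA.ext1Zero hG'⟩
  intro y
  constructor
  · intro hy
    exact hs.ex y hy
  · rintro ⟨x, rfl⟩
    exact hs.zero x

end GorensteinPrecover
end

section
/- Let R be a left GF-closed and left n-perfect ring. The following are equivalent: (1) Gpd_R(G) ≤ n for every Gorenstein flat left R-module G; (2) Gpd_R(G) < ∞ for every Gorenstein flat left R-module G; (3) Ext^i_R(G, F) = 0 for every Gorenstein flat left R-module G, every left R-module F that is both flat and cotorsion, and all i ≥ 1. -/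
/-!
Common definitions: Gorenstein projective/flat modules, Ext-vanishing via projective
resolutions, Gorenstein projective dimension, flat and cotorsion modules over an
arbitrary (possibly noncommutative) ring, tensor product of a right module with a
left module, coherence and perfectness conditions.
-/

universe u v

namespace GorensteinPrecover

noncomputable section

open Function

section Core

variable {X : Type*} {K : Type*} [AddCommGroup K]

open Classical in
/-- Truncation: zero on `Y`. -/
def offSet (Y : Set X) (h : X → K) : X → K := fun x => if x ∈ Y then 0 else h x

lemma offSet_mem {Y : Set X} (h : X → K) {x : X} (hx : x ∈ Y) : offSet Y h x = 0 := by
  simp [offSet, hx]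

lemma offSet_not_mem {Y : Set X} (h : X → K) {x : X} (hx : x ∉ Y) : offSet Y h x = h x := by
  simp [offSet, hx]

/-- `T h x` depends only on the values of `h` on `supp x`. -/
def Local (T : (X → K) →+ (X → K)) (supp : X → Finset X) : Prop :=
  ∀ x (h h' : X → K), (∀ y ∈ supp x, h y = h' y) → T h x = T h' x

def StableSet (supp : X → Finset X) (Y : Set X) : Prop :=
  ∀ x ∈ Y, ∀ y ∈ supp x, y ∈ Y

def AProp (T : (X → K) →+ (X → K)) (Y : Set X) : Prop :=
  ∀ S : Finset X, (∀ x ∈ S, x ∈ Y) → ∃ S' : Finset X, (∀ x ∈ S', x ∈ Y) ∧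
    ∀ h : X → K, (∀ x ∈ S', T h x = 0) → ∃ g : X → K, ∀ x ∈ S, T g x = h x

def RelProp (T : (X → K) →+ (X → K)) (Y : Set X) : Prop :=
  ∀ S : Finset X, ∃ S' : Finset X, ∀ h : X → K, (∀ x ∈ Y, h x = 0) →
    (∀ x ∈ S', T h x = 0) → ∃ g : X → K, (∀ x ∈ Y, g x = 0) ∧ ∀ x ∈ S, T g x = h x

variable {T : (X → K) →+ (X → K)} {supp : X → Finset X}

lemma Local.zero_of_stable (hT : Local T supp) {Y : Set X} (hY : StableSet supp Y) {h : X → K}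
    (hh : ∀ x ∈ Y, h x = 0) : ∀ x ∈ Y, T h x = 0 := by
  intro x hx
  rw [hT x h 0 (fun y hy => hh y (hY x hx y hy))]
  simp

open Classical in
lemma relProp_of (hT : Local T supp) (hTT : ∀ h, T (T h) = 0) (hX : AProp T Set.univ) {Y : Set X}
    (hY : StableSet supp Y) (hA : AProp T Y) : RelProp T Y := by
  intro S
  let S1 : Finset X := (S.biUnion supp).filter (· ∈ Y)
  obtain ⟨S1', hS1', h1⟩ := hA S1 (by intro x hx; exact (Finset.mem_filter.1 hx).2)
  obtain ⟨S', -, h2⟩ := hX (S ∪ S1') (by simp)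
  refine ⟨S', fun h hh0 hh1 => ?_⟩
  obtain ⟨g, hg⟩ := h2 h hh1
  obtain ⟨e, he⟩ := h1 g (by
    intro x hx
    rw [hg x (by simp [hx])]
    exact hh0 x (hS1' x hx))
  refine ⟨offSet Y (g - T e), fun x hx => offSet_mem _ hx, fun x hx => ?_⟩
  by_cases hxY : x ∈ Y
  · rw [hh0 x hxY]
    exact hT.zero_of_stable hY (fun x hx => offSet_mem _ hx) x hxY
  · rw [hT x _ (g - T e), map_sub, hTT, sub_zero, hg x (by simp [hx])]
    intro y hy
    by_cases hyY : y ∈ Y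
    · rw [offSet_mem _ hyY, Pi.sub_apply, he y, sub_self]
      simp only [S1, Finset.mem_filter, Finset.mem_biUnion]
      exact ⟨⟨x, hx, hy⟩, hyY⟩
    · rw [offSet_not_mem _ hyY]

open Classical in
lemma core_extend (hT : Local T supp) (hTT : ∀ h, T (T h) = 0) (hX : AProp T Set.univ)
    {f : X → K} (hf : T f = 0) {Y : Set X}
    (hY : StableSet supp Y) (hA : AProp T Y) {g : X → K} (hg : ∀ x ∈ Y, T g x = f x) (x₀ : X) :
    ∃ (Y' : Set X) (g' : X → K), Y ⊆ Y' ∧ x₀ ∈ Y' ∧ StableSet supp Y' ∧ AProp T Y' ∧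
      (∀ x ∈ Y', T g' x = f x) ∧ ∀ x ∈ Y, g' x = g x := by
  have hR := relProp_of hT hTT hX hY hA
  choose R' hR' using hR
  obtain ⟨S, hS0, hSs⟩ : ∃ S : ℕ → Finset X, S 0 = {x₀} ∧
      ∀ k, S (k+1) = S k ∪ (S k).biUnion supp ∪ R' (S k) :=
    ⟨fun k => Nat.rec {x₀} (fun _ s => s ∪ s.biUnion supp ∪ R' s) k, rfl, fun k => rfl⟩
  have hSm : Monotone S := monotone_nat_of_le_succ (fun k => by
    rw [hSs]; intro x hx; simp [hx])
  have hSsupp : ∀ k x, x ∈ S k → ∀ y ∈ supp x, y ∈ S (k+1) := by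
    intro k x hx y hy
    rw [hSs]
    simp only [Finset.mem_union, Finset.mem_biUnion]
    exact Or.inl (Or.inr ⟨x, hx, hy⟩)
  have hSR : ∀ k x, x ∈ R' (S k) → x ∈ S (k+1) := by
    intro k x hx
    rw [hSs]; simp [hx]
  let Y' : Set X := Y ∪ {x | ∃ k, x ∈ S k}
  have hf0 : ∀ x ∈ Y, (f - T g) x = 0 := fun x hx => by simp [hg x hx]
  have hf1 : T (f - T g) = 0 := by rw [map_sub, hf, hTT, sub_zero]
  have hY' : StableSet supp Y' := by
    rintro x (hx | ⟨k, hk⟩) y hy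
    · exact Or.inl (hY x hx y hy)
    · exact Or.inr ⟨k+1, hSsupp k x hk y hy⟩
  have step : ∀ k (a : X → K), (∀ x ∈ Y, a x = 0) → (∀ x ∈ S (k+1), T a x = (f - T g) x) →
      ∃ b : X → K, (∀ x ∈ Y, b x = 0) ∧ (∀ x ∈ S (k+2), T b x = (f - T g) x) ∧
        ∀ x ∈ S k, b x = a x := by
    intro k a ha0 ha1
    obtain ⟨c, hc0, hc1⟩ := hR' (S (k+2)) (f - T g) hf0 (by simp [hf1])
    obtain ⟨e, he0, he1⟩ := hR' (S k) (c - a) (fun x hx => by simp [hc0 x hx, ha0 x hx]) (by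
      intro x hx
      have h1 := hSR k x hx
      rw [map_sub, Pi.sub_apply, hc1 x (hSm (Nat.le_succ (k+1)) h1), ha1 x h1, sub_self])
    refine ⟨c - T e, ?_, ?_, ?_⟩
    · intro x hx
      rw [Pi.sub_apply, hc0 x hx, hT.zero_of_stable hY he0 x hx, sub_zero]
    · intro x hx
      rw [map_sub, hTT, sub_zero, hc1 x hx]
    · intro x hx
      rw [Pi.sub_apply, he1 x hx]; simp
  obtain ⟨a0, ha00, ha01⟩ := hR' (S 1) (f - T g) hf0 (by simp [hf1])
  choose! nxt hn0 hn1 hn2 using step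
  obtain ⟨a, haz, has⟩ : ∃ a : ℕ → X → K, a 0 = a0 ∧ ∀ k, a (k+1) = nxt k (a k) :=
    ⟨fun k => Nat.rec a0 (fun k b => nxt k b) k, rfl, fun k => rfl⟩
  have haP : ∀ k, (∀ x ∈ Y, a k x = 0) ∧ (∀ x ∈ S (k+1), T (a k) x = (f - T g) x) := by
    intro k
    induction k with
    | zero => rw [haz]; exact ⟨ha00, ha01⟩
    | succ k ih =>
      rw [has]
      exact ⟨hn0 k _ ih.1 ih.2, hn1 k _ ih.1 ih.2⟩
  have haeq : ∀ k x, x ∈ S k → a (k+1) x = a k x := by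
    intro k x hx
    rw [has]; exact hn2 k _ (haP k).1 (haP k).2 x hx
  have haeq2 : ∀ k l, k ≤ l → ∀ x ∈ S k, a l x = a k x := by
    intro k l hkl x hx
    induction l, hkl using Nat.le_induction with
    | base => rfl
    | succ l hl ih => rw [haeq l x (hSm hl hx), ih]
  let ainf : X → K := fun x => if h : ∃ k, x ∈ S k then a (Nat.find h) x else 0
  have hainf : ∀ k, ∀ x ∈ S k, ainf x = a k x := by
    intro k x hx
    have h : ∃ k, x ∈ S k := ⟨k, hx⟩
    simp only [ainf, h, dif_pos]
    exact (haeq2 _ _ (Nat.find_min' h hx) x (Nat.find_spec h)).symm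
  have hainf0 : ∀ x ∈ Y, ainf x = 0 := by
    intro x hx
    by_cases h : ∃ k, x ∈ S k
    · obtain ⟨k, hk⟩ := h
      rw [hainf k x hk, (haP k).1 x hx]
    · simp [ainf, h]
  have hTainf : ∀ k, ∀ x ∈ S k, T ainf x = (f - T g) x := by
    intro k x hx
    rw [hT x ainf (a (k+1)) (fun y hy => hainf _ _ (hSsupp k x hx y hy))]
    exact (haP (k+1)).2 x (hSm (by omega) hx)
  refine ⟨Y', g + ainf, Set.subset_union_left, Or.inr ⟨0, by simp [hS0]⟩, hY', ?_, ?_, ?_⟩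
  · intro Q hQ
    have : ∃ k, ∀ x ∈ Q, x ∉ Y → x ∈ S k := by
      have : ∀ x ∈ Q, ∃ k, x ∉ Y → x ∈ S k := by
        intro x hx
        by_cases h : x ∈ Y
        · exact ⟨0, fun h' => absurd h h'⟩
        · rcases hQ x hx with h' | ⟨k, hk⟩
          · exact absurd h' h
          · exact ⟨k, fun _ => hk⟩
      choose! kk hkk using this
      exact ⟨Q.sup kk, fun x hx hxY => hSm (Finset.le_sup hx) (hkk x hx hxY)⟩
    obtain ⟨k, hk⟩ := this
    let TY : Finset X := (Q ∪ (S (k+1)).biUnion supp).filter (· ∈ Y)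
    obtain ⟨TY', hTY', h1⟩ := hA TY (by intro x hx; exact (Finset.mem_filter.1 hx).2)
    refine ⟨TY' ∪ S (k+1), ?_, ?_⟩
    · intro x hx
      rcases Finset.mem_union.1 hx with hx | hx
      · exact Or.inl (hTY' x hx)
      · exact Or.inr ⟨_, hx⟩
    · intro h hh
      obtain ⟨g1, hg1⟩ := h1 h (fun x hx => hh x (by simp [hx]))
      obtain ⟨g2, hg20, hg21⟩ := hR' (S k) (offSet Y (h - T g1)) (fun x hx => offSet_mem _ hx) (by
        intro x hx
        have hx' := hSR k x hx
        by_cases hxY : x ∈ Y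
        · exact hT.zero_of_stable hY (fun x hx => offSet_mem _ hx) x hxY
        · rw [hT x _ (h - T g1), map_sub, hTT, sub_zero, hh x (by simp [hx'])]
          intro y hy
          by_cases hyY : y ∈ Y
          · rw [offSet_mem _ hyY, Pi.sub_apply, hg1 y, sub_self]
            simp only [TY, Finset.mem_filter, Finset.mem_biUnion, Finset.mem_union]
            exact ⟨Or.inr ⟨x, hx', hy⟩, hyY⟩
          · rw [offSet_not_mem _ hyY])
      refine ⟨g1 + g2, fun x hx => ?_⟩
      rw [map_add, Pi.add_apply]
      by_cases hxY : x ∈ Y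
      · rw [hT.zero_of_stable hY hg20 x hxY, add_zero]
        exact hg1 x (by simp [TY, hx, hxY])
      · rw [hg21 x (hk x hx hxY), offSet_not_mem _ hxY]
        simp
  · rintro x (hx | ⟨k, hk⟩)
    · rw [map_add, Pi.add_apply, hg x hx, hT.zero_of_stable hY hainf0 x hx, add_zero]
    · rw [map_add, Pi.add_apply, hTainf k x hk]; simp
  · intro x hx
    simp [hainf0 x hx]

open Classical in
theorem core_exact (hT : Local T supp) (hTT : ∀ h, T (T h) = 0) (hX : AProp T Set.univ)
    {f : X → K} (hf : T f = 0) : ∃ g, T g = f := by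
  let Pr : Type _ := {p : Set X × (X → K) // StableSet supp p.1 ∧ AProp T p.1 ∧
    ∀ x ∈ p.1, T p.2 x = f x}
  let r : Pr → Pr → Prop := fun p q => p.1.1 ⊆ q.1.1 ∧ ∀ x ∈ p.1.1, q.1.2 x = p.1.2 x
  obtain ⟨m, hm⟩ := exists_maximal_of_chains_bounded (r := r) (by
    intro c hc
    let Y : Set X := {x | ∃ p ∈ c, x ∈ p.1.1}
    let g : X → K := fun x => if h : ∃ p ∈ c, x ∈ p.1.1 then h.choose.1.2 x else 0
    have htot : ∀ {p q}, p ∈ c → q ∈ c → r p q ∨ r q p := by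
      intro p q hp hq
      by_cases h : p = q
      · subst h; exact Or.inl ⟨subset_rfl, fun _ _ => rfl⟩
      · exact hc hp hq h
    have hgp : ∀ p ∈ c, ∀ x ∈ p.1.1, g x = p.1.2 x := by
      intro p hp x hx
      have h : ∃ p ∈ c, x ∈ p.1.1 := ⟨p, hp, hx⟩
      simp only [g, dif_pos h]
      have hs := h.choose_spec
      rcases htot hs.1 hp with h' | h'
      · exact (h'.2 x hs.2).symm
      · exact h'.2 x hx
    have hY : StableSet supp Y := by
      rintro x ⟨p, hp, hx⟩ y hy
      exact ⟨p, hp, p.2.1 x hx y hy⟩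
    have hA : AProp T Y := by
      intro S hS
      have : S = ∅ ∨ ∃ p ∈ c, ∀ x ∈ S, x ∈ p.1.1 := by
        induction S using Finset.induction_on with
        | empty => exact Or.inl rfl
        | insert x S hx ih =>
          right
          obtain ⟨p, hp, hxp⟩ := hS x (by simp)
          rcases ih (fun y hy => hS y (by simp [hy])) with rfl | ⟨q, hq, hqS⟩
          · exact ⟨p, hp, by simpa using hxp⟩
          · rcases htot hp hq with h' | h'
            · refine ⟨q, hq, fun y hy => ?_⟩
              rcases Finset.mem_insert.1 hy with rfl | hy
              · exact h'.1 hxp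
              · exact hqS y hy
            · refine ⟨p, hp, fun y hy => ?_⟩
              rcases Finset.mem_insert.1 hy with rfl | hy
              · exact hxp
              · exact h'.1 (hqS y hy)
      rcases this with rfl | ⟨p, hp, hpS⟩
      · exact ⟨∅, by simp, fun h _ => ⟨0, by simp⟩⟩
      · obtain ⟨S', hS', h⟩ := p.2.2.1 S hpS
        exact ⟨S', fun x hx => ⟨p, hp, hS' x hx⟩, h⟩
    refine ⟨⟨(Y, g), hY, hA, ?_⟩, ?_⟩
    · rintro x ⟨p, hp, hx⟩
      rw [← p.2.2.2 x hx]
      exact hT x _ _ (fun y hy => hgp p hp y (p.2.1 x hx y hy))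
    · intro p hp
      exact ⟨fun x hx => ⟨p, hp, hx⟩, hgp p hp⟩) (by
    intro a b c hab hbc
    exact ⟨hab.1.trans hbc.1, fun x hx => (hbc.2 x (hab.1 hx)).trans (hab.2 x hx)⟩)
  refine ⟨m.1.2, funext fun x => m.2.2.2 x ?_⟩
  obtain ⟨Y', g', h1, h2, h3, h4, h5, h6⟩ :=
    core_extend hT hTT hX hf m.2.1 m.2.2.1 m.2.2.2 x
  exact (hm ⟨(Y', g'), h3, h4, h5⟩ ⟨h1, h6⟩).1 h2

end Core

section RT

variable {R : Type u} [Ring R]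
variable {I I' I'' : Type v} [AddCommGroup I] [Module Rᵐᵒᵖ I] [AddCommGroup I'] [Module Rᵐᵒᵖ I']
  [AddCommGroup I''] [Module Rᵐᵒᵖ I'']
variable {M M' M'' : Type v} [AddCommGroup M] [Module R M] [AddCommGroup M'] [Module R M']
  [AddCommGroup M''] [Module R M'']

def rtq (R : Type u) [Ring R] (I : Type v) [AddCommGroup I] [Module Rᵐᵒᵖ I]
    (M : Type v) [AddCommGroup M] [Module R M] : TensorProduct ℤ I M →+ RTensor R I M :=
  QuotientAddGroup.mk' (tensorRel R I M)

/-- Pure tensors. -/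
def rtmk (R : Type u) [Ring R] {I : Type v} [AddCommGroup I] [Module Rᵐᵒᵖ I]
    {M : Type v} [AddCommGroup M] [Module R M] (x : I) (m : M) : RTensor R I M :=
  rtq R I M (x ⊗ₜ[ℤ] m)

lemma rt_ind {p : RTensor R I M → Prop} (h0 : p 0) (hmk : ∀ x m, p (rtmk R x m))
    (hadd : ∀ a b, p a → p b → p (a + b)) (t : RTensor R I M) : p t := by
  obtain ⟨w, rfl⟩ : ∃ w, rtq R I M w = t := QuotientAddGroup.mk'_surjective (tensorRel R I M) t
  induction w using TensorProduct.induction_on with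
  | zero => rw [map_zero]; exact h0
  | tmul x m => exact hmk x m
  | add a b ha hb => rw [map_add]; exact hadd _ _ ha hb

lemma rtmk_smul (r : R) (x : I) (m : M) :
    rtmk R (MulOpposite.op r • x) m = rtmk R x (r • m) := by
  rw [← sub_eq_zero]
  unfold rtmk
  rw [← map_sub]
  exact (QuotientAddGroup.eq_zero_iff _).2 (AddSubgroup.subset_closure ⟨r, x, m, rfl⟩)

lemma rtmk_add_left (x x' : I) (m : M) : rtmk R (x + x') m = rtmk R x m + rtmk R x' m := by
  unfold rtmk; rw [TensorProduct.add_tmul, map_add]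

lemma rtmk_add_right (x : I) (m m' : M) : rtmk R x (m + m') = rtmk R x m + rtmk R x m' := by
  unfold rtmk; rw [TensorProduct.tmul_add, map_add]

lemma rtmk_zero_left (m : M) : rtmk R (0 : I) m = 0 := by
  unfold rtmk; rw [TensorProduct.zero_tmul, map_zero]

lemma rtmk_zero_right (x : I) : rtmk R x (0 : M) = 0 := by
  unfold rtmk; rw [TensorProduct.tmul_zero, map_zero]

/-- Universal property of `RTensor`. -/
def rtLift {A : Type*} [AddCommGroup A] (b : I →+ M →+ A)
    (hb : ∀ (r : R) x m, b (MulOpposite.op r • x) m = b x (r • m)) : RTensor R I M →+ A :=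
  QuotientAddGroup.lift (tensorRel R I M)
    (TensorProduct.liftAddHom b (fun n x m => by simp [map_zsmul])) (by
      refine (AddSubgroup.closure_le _).2 ?_
      rintro _ ⟨r, x, y, rfl⟩
      simp [AddMonoidHom.mem_ker, hb])

@[simp] lemma rtLift_mk {A : Type*} [AddCommGroup A] (b : I →+ M →+ A)
    (hb : ∀ (r : R) x m, b (MulOpposite.op r • x) m = b x (r • m)) (x : I) (m : M) :
    rtLift b hb (rtmk R x m) = b x m := by
  rfl

@[simp] lemma rtMap_mk (g : M →ₗ[R] M') (x : I) (m : M) :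
    rtMap R I g (rtmk R x m) = rtmk R x (g m) := rfl

@[simp] lemma rtMapRight_mk (f : I →ₗ[Rᵐᵒᵖ] I') (x : I) (m : M) :
    rtMapRight R M f (rtmk R x m) = rtmk R (f x) m := rfl

lemma rt_hom_ext {A : Type*} [AddCommGroup A] {f g : RTensor R I M →+ A}
    (h : ∀ x m, f (rtmk R x m) = g (rtmk R x m)) : f = g := by
  ext t
  induction t using rt_ind with
  | h0 => simp
  | hmk x m => exact h x m
  | hadd a b ha hb => simp [ha, hb]

lemma rtMap_comp (g : M →ₗ[R] M') (g' : M' →ₗ[R] M'') (t : RTensor R I M) :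
    rtMap R I g' (rtMap R I g t) = rtMap R I (g'.comp g) t := by
  have : (rtMap R I g').comp (rtMap R I g) = rtMap R I (g'.comp g) := rt_hom_ext (by simp)
  exact DFunLike.congr_fun this t

lemma rtMap_id (t : RTensor R I M) : rtMap R I (LinearMap.id : M →ₗ[R] M) t = t := by
  have : rtMap R I (LinearMap.id : M →ₗ[R] M) = AddMonoidHom.id _ := rt_hom_ext (by simp)
  exact DFunLike.congr_fun this t

lemma rtMap_zero (t : RTensor R I M) : rtMap R I (0 : M →ₗ[R] M') t = 0 := by
  have : rtMap R I (0 : M →ₗ[R] M') = 0 := rt_hom_ext (by simp [rtmk_zero_right])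
  exact DFunLike.congr_fun this t

lemma rtMap_add (g g' : M →ₗ[R] M') (t : RTensor R I M) :
    rtMap R I (g + g') t = rtMap R I g t + rtMap R I g' t := by
  have : rtMap R I (g + g') = rtMap R I g + rtMap R I g' :=
    rt_hom_ext (by simp [rtmk_add_right])
  exact DFunLike.congr_fun this t

lemma rtMap_comm (g : M →ₗ[R] M') (f : I →ₗ[Rᵐᵒᵖ] I') (t : RTensor R I M) :
    rtMapRight R M' f (rtMap R I g t) = rtMap R I' g (rtMapRight R M f t) := by
  have : (rtMapRight R M' f).comp (rtMap R I g) = (rtMap R I' g).comp (rtMapRight R M f) :=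
    rt_hom_ext (by simp)
  exact DFunLike.congr_fun this t

/-- Contraction against a functional `q : M → R`. -/
def contr (q : M →ₗ[R] R) : RTensor R I M →+ I :=
  rtLift
    { toFun := fun x =>
        { toFun := fun m => MulOpposite.op (q m) • x
          map_zero' := by simp
          map_add' := fun a b => by simp [add_smul] }
      map_zero' := by ext; simp
      map_add' := fun a b => by ext; simp }
    (fun r x m => by simp [smul_smul])

@[simp] lemma contr_mk (q : M →ₗ[R] R) (x : I) (m : M) :
    contr q (rtmk R x m) = MulOpposite.op (q m) • x := rfl

lemma contr_right (q : M →ₗ[R] R) (f : I →ₗ[Rᵐᵒᵖ] I') (t : RTensor R I M) :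
    contr q (rtMapRight R M f t) = f (contr q t) := by
  have : (contr q).comp (rtMapRight R M f) = (f.toAddMonoidHom).comp (contr q) :=
    rt_hom_ext (by simp)
  exact DFunLike.congr_fun this t

/-- Dual basis expansion in `N ⊗ P`, `P` projective. -/
lemma eq_zero_of_contr [hP : Module.Projective R M] (t : RTensor R I M)
    (h : ∀ q : M →ₗ[R] R, contr q t = 0) : t = 0 := by
  classical
  obtain ⟨s, hs⟩ := hP.out
  have key : ∀ t : RTensor R I M, ∃ S : Finset M, ∀ S', S ⊆ S' →
      t = ∑ x ∈ S', rtmk R (contr ((Finsupp.lapply x).comp s) t) x := by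
    intro t
    induction t using rt_ind with
    | h0 => exact ⟨∅, fun S' _ => by simp [rtmk_zero_left]⟩
    | hmk x m =>
      refine ⟨(s m).support, fun S' hS' => ?_⟩
      have h1 : m = ∑ y ∈ S', s m y • y := by
        conv_lhs => rw [← hs m]
        rw [Finsupp.linearCombination_apply, Finsupp.sum_of_support_subset _ hS' _ (by simp)]
        rfl
      simp only [contr_mk, rtmk_smul]
      conv_lhs => rw [h1]
      have : ∀ (S : Finset M) (F : M → M), rtmk R x (∑ y ∈ S, F y) = ∑ y ∈ S, rtmk R x (F y) := by
        intro S F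
        induction S using Finset.induction_on with
        | empty => simp [rtmk_zero_right]
        | insert a S ha ih => simp [Finset.sum_insert ha, rtmk_add_right, ih]
      rw [this]
      rfl
    | hadd a b ha hb =>
      obtain ⟨Sa, ha⟩ := ha
      obtain ⟨Sb, hb⟩ := hb
      refine ⟨Sa ∪ Sb, fun S' hS' => ?_⟩
      simp only [map_add, rtmk_add_left, Finset.sum_add_distrib]
      rw [← ha S' (Finset.subset_union_left.trans hS'),
        ← hb S' (Finset.subset_union_right.trans hS')]
  obtain ⟨S, hS⟩ := key t
  rw [hS S subset_rfl]
  simp [h, rtmk_zero_left]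

lemma isFlat_of_projective (P : ModuleCat.{v} R) [Module.Projective R P] : IsFlatMod R P := by
  intro I I' f hf
  rw [injective_iff_map_eq_zero]
  intro t ht
  apply eq_zero_of_contr
  intro q
  apply hf
  rw [map_zero, ← contr_right, ht, map_zero]

lemma isFlat_of_equiv {M M' : ModuleCat.{v} R} (e : M ≃ₗ[R] M') (h : IsFlatMod R M) :
    IsFlatMod R M' := by
  intro I I' f hf
  rw [injective_iff_map_eq_zero]
  intro t ht
  have h1 : rtMapRight R M f (rtMap R I e.symm.toLinearMap t) = 0 := by
    rw [rtMap_comm, ht, map_zero]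
  have h2 := (injective_iff_map_eq_zero _).1 (h I I' f hf) _ h1
  have h3 := congrArg (rtMap R I e.toLinearMap) h2
  rw [rtMap_comp, map_zero] at h3
  have h4 : e.toLinearMap.comp e.symm.toLinearMap = LinearMap.id := by ext; simp
  rwa [h4, rtMap_id] at h3

lemma rtMap_surj {g : M →ₗ[R] M'} (hg : Surjective g) : Surjective (rtMap R I g) := by
  intro t
  induction t using rt_ind with
  | h0 => exact ⟨0, map_zero _⟩
  | hmk x m =>
    obtain ⟨m, rfl⟩ := hg m
    exact ⟨rtmk R x m, rfl⟩
  | hadd a b ha hb =>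
    obtain ⟨a, rfl⟩ := ha
    obtain ⟨b, rfl⟩ := hb
    exact ⟨a + b, map_add _ _ _⟩

/-- Right exactness. -/
lemma rt_right_exact {f : M →ₗ[R] M'} {g : M' →ₗ[R] M''} (hfg : Exact f g) (hg : Surjective g) :
    Exact (rtMap R I f) (rtMap R I g) := by
  intro t
  constructor
  · intro ht
    -- inverse map from the tensor product to the cokernel
    let Q := RTensor R I M' ⧸ (rtMap R I f).range
    let q : RTensor R I M' →+ Q := QuotientAddGroup.mk' _
    have hq : ∀ x m m', g m = g m' → q (rtmk R x m) = q (rtmk R x m') := by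
      intro x m m' hmm
      obtain ⟨l, hl⟩ := (hfg (m - m')).1 (by rw [map_sub, hmm, sub_self])
      have : rtmk R x m = rtmk R x m' + rtMap R I f (rtmk R x l) := by
        rw [rtMap_mk, hl, ← rtmk_add_right]; simp
      rw [this, map_add]
      have h0 : q (rtMap R I f (rtmk R x l)) = 0 :=
        (QuotientAddGroup.eq_zero_iff _).2 ⟨_, rfl⟩
      rw [h0, add_zero]
    choose sec hsec using hg
    let back : RTensor R I M'' →+ Q := rtLift
      { toFun := fun x =>
          { toFun := fun m => q (rtmk R x (sec m))
            map_zero' := by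
              rw [hq x (sec 0) 0 (by rw [hsec, map_zero]), rtmk_zero_right, map_zero]
            map_add' := fun a b => by
              rw [hq x _ (sec a + sec b) (by simp [hsec]), rtmk_add_right, map_add] }
        map_zero' := by ext; simp [rtmk_zero_left]
        map_add' := fun a b => by ext; simp [rtmk_add_left] }
      (fun r x m => by
        simp only [AddMonoidHom.coe_mk, ZeroHom.coe_mk]
        rw [rtmk_smul, hq x _ (sec (r • m)) (by simp [hsec])])
    have hb : back.comp (rtMap R I g) = q := rt_hom_ext (by
      intro x m
      simp only [AddMonoidHom.comp_apply, rtMap_mk, back, rtLift_mk, AddMonoidHom.coe_mk,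
        ZeroHom.coe_mk]
      exact hq _ _ _ (by rw [hsec]))
    have h1 : q t = 0 := by rw [← hb, AddMonoidHom.comp_apply, ht, map_zero]
    exact (QuotientAddGroup.eq_zero_iff _).1 h1
  · rintro ⟨w, rfl⟩
    rw [rtMap_comp, hfg.linearMap_comp_eq_zero, rtMap_zero]

end RT

section Characters

/-- The circle group `ℚ/ℤ`. -/
abbrev QZ : Type := AddCircle (1 : ℚ)

lemma char_extend {A B : Type*} [AddCommGroup A] [AddCommGroup B] (f : A →+ B)
    (hf : Injective f) (θ : A →+ QZ) : ∃ Θ : B →+ QZ, ∀ a, Θ (f a) = θ a := by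
  obtain ⟨Θ, hΘ⟩ := CharacterModule.dual_surjective_of_injective (R := ℤ)
    (f.toIntLinearMap) hf θ
  exact ⟨Θ, fun a => DFunLike.congr_fun hΘ a⟩

lemma eq_zero_of_char {A : Type*} [AddCommGroup A] (a : A) (h : ∀ θ : A →+ QZ, θ a = 0) : a = 0 :=
  CharacterModule.eq_zero_of_character_apply h

lemma mem_of_char {A : Type*} [AddCommGroup A] (B : AddSubgroup A) (a : A)
    (h : ∀ θ : A →+ QZ, (∀ b ∈ B, θ b = 0) → θ a = 0) : a ∈ B := by
  rw [← QuotientAddGroup.eq_zero_iff]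
  apply eq_zero_of_char
  intro θ
  exact h (θ.comp (QuotientAddGroup.mk' B)) (fun b hb => by
    have : QuotientAddGroup.mk' B b = 0 := (QuotientAddGroup.eq_zero_iff _).2 hb
    rw [AddMonoidHom.comp_apply, this, map_zero])

/-- Families of characters of `K`, as a right module. -/
def CZ (R : Type u) [Ring R] (Z K : Type v) [AddCommGroup K] [Module R K] : Type v :=
  Z → (K →+ QZ)

variable {R : Type u} [Ring R] {Z : Type v}
variable {K A B C M M' : Type v} [AddCommGroup K] [Module R K] [AddCommGroup A] [Module R A]
  [AddCommGroup B] [Module R B] [AddCommGroup C] [Module R C] [AddCommGroup M] [Module R M]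
  [AddCommGroup M'] [Module R M']

instance : AddCommGroup (CZ R Z K) := inferInstanceAs (AddCommGroup (Z → (K →+ QZ)))

instance : Module Rᵐᵒᵖ (CZ R Z K) where
  smul r χ := fun z => (χ z).comp (DistribSMul.toAddMonoidHom K r.unop)
  one_smul χ := by
    funext z; apply AddMonoidHom.ext; intro k
    change χ z ((1 : R) • k) = _
    rw [one_smul]
  mul_smul r s χ := by
    funext z; apply AddMonoidHom.ext; intro k
    change χ z ((s.unop * r.unop) • k) = χ z (s.unop • (r.unop • k))
    rw [mul_smul]
  smul_zero r := by
    funext z; apply AddMonoidHom.ext; intro k; rfl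
  zero_smul χ := by
    funext z; apply AddMonoidHom.ext; intro k
    change χ z ((0 : R) • k) = 0
    rw [zero_smul, map_zero]
  smul_add r χ χ' := by
    funext z; apply AddMonoidHom.ext; intro k; rfl
  add_smul r s χ := by
    funext z; apply AddMonoidHom.ext; intro k
    change χ z ((r.unop + s.unop) • k) = χ z (r.unop • k) + χ z (s.unop • k)
    rw [add_smul, map_add]

lemma CZ_smul (r : Rᵐᵒᵖ) (χ : CZ R Z K) (z : Z) (k : K) : (r • χ) z k = χ z (r.unop • k) := rfl
lemma CZ_add (χ χ' : CZ R Z K) (z : Z) (k : K) : (χ + χ') z k = χ z k + χ' z k := rfl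
lemma CZ_sub (χ χ' : CZ R Z K) (z : Z) (k : K) : (χ - χ') z k = χ z k - χ' z k := rfl
lemma CZ_zero (z : Z) (k : K) : (0 : CZ R Z K) z k = 0 := rfl
lemma CZ_ext {χ χ' : CZ R Z K} (h : ∀ z k, χ z k = χ' z k) : χ = χ' := by
  funext z; exact AddMonoidHom.ext (h z)

/-- Evaluation pairing. -/
def pairing (z : Z) (h : M →ₗ[R] K) : RTensor R (CZ R Z K) M →+ QZ :=
  rtLift
    { toFun := fun χ => (χ z).comp h.toAddMonoidHom
      map_zero' := rfl
      map_add' := fun _ _ => rfl }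
    (fun r χ m => by
      change χ z (r • h m) = χ z (h (r • m))
      rw [LinearMap.map_smul h])

@[simp] lemma pairing_mk (z : Z) (h : M →ₗ[R] K) (χ : CZ R Z K) (m : M) :
    pairing z h (rtmk R χ m) = χ z (h m) := rfl

lemma pairing_map (z : Z) (h : M' →ₗ[R] K) (g : M →ₗ[R] M') (t : RTensor R (CZ R Z K) M) :
    pairing z h (rtMap R _ g t) = pairing z (h.comp g) t := by
  have : (pairing z h).comp (rtMap R (CZ R Z K) g) = pairing z (h.comp g) := rt_hom_ext (by simp)
  exact DFunLike.congr_fun this t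

lemma pairing_contr (z : Z) (q : M →ₗ[R] R) (k : K) (t : RTensor R (CZ R Z K) M) :
    (contr q t) z k = pairing z (q.smulRight k) t := by
  induction t using rt_ind with
  | h0 => simp [CZ_zero]
  | hmk χ m => simp [CZ_smul]
  | hadd a b ha hb => simp [CZ_add, ha, hb]

lemma eq_zero_of_pairing [Module.Projective R M] (t : RTensor R (CZ R Z K) M)
    (h : ∀ z (h : M →ₗ[R] K), pairing z h t = 0) : t = 0 := by
  apply eq_zero_of_contr
  intro q
  apply CZ_ext
  intro z k
  rw [pairing_contr, h, CZ_zero]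

/-- Characters of `N ⊗ K` as maps from `N` to characters of `K`. -/
def homOfChar {N : Type v} [AddCommGroup N] [Module Rᵐᵒᵖ N] (θ : Z → RTensor R N K →+ QZ) :
    N →ₗ[Rᵐᵒᵖ] CZ R Z K where
  toFun y := fun z =>
    { toFun := fun k => θ z (rtmk R y k)
      map_zero' := by rw [rtmk_zero_right, map_zero]
      map_add' := fun a b => by rw [rtmk_add_right, map_add] }
  map_add' a b := by
    apply CZ_ext
    intro z k
    change θ z (rtmk R (a + b) k) = θ z (rtmk R a k) + θ z (rtmk R b k)
    rw [rtmk_add_left, map_add]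
  map_smul' r y := by
    apply CZ_ext
    intro z k
    change θ z (rtmk R (r • y) k) = θ z (rtmk R y (r.unop • k))
    rw [← rtmk_smul]; rfl

lemma CZ_injective (Z : Type v) (K : ModuleCat.{v} R) (hK : IsFlatMod R K) :
    Module.Injective Rᵐᵒᵖ (CZ R Z K) := by
  constructor
  intro X Y _ _ _ _ f hf g
  have hinj := hK (ModuleCat.of Rᵐᵒᵖ X) (ModuleCat.of Rᵐᵒᵖ Y) f hf
  let θ : Z → RTensor R X K →+ QZ := fun z => (pairing z LinearMap.id).comp (rtMapRight R K g)
  have hθ : ∀ z, ∃ Θ : RTensor R Y K →+ QZ, ∀ t, Θ (rtMapRight R K f t) = θ z t := fun z =>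
    char_extend (rtMapRight R K f) hinj (θ z)
  choose Θ hΘ using hθ
  refine ⟨homOfChar Θ, fun x => CZ_ext (fun z k => ?_)⟩
  exact hΘ z (rtmk R x k)

/-- Purity of extensions with flat cokernel. -/
lemma purity {A B : Type v} [AddCommGroup A] [Module R A] [AddCommGroup B] [Module R B]
    (C : ModuleCat.{v} R) (i : A →ₗ[R] B) (p : B →ₗ[R] C) (hi : Injective i)
    (hp : Surjective p) (hip : Exact i p) (hC : IsFlatMod R C)
    (N : Type v) [AddCommGroup N] [Module Rᵐᵒᵖ N] : Injective (rtMap R N i) := by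
  let z : PUnit.{v+1} := PUnit.unit
  have hCi := CZ_injective PUnit.{v+1} C hC
  let ps : CZ R PUnit.{v+1} C →ₗ[Rᵐᵒᵖ] CZ R PUnit.{v+1} B :=
    { toFun := fun χ z => (χ z).comp p.toAddMonoidHom
      map_add' := fun _ _ => rfl
      map_smul' := fun r χ => CZ_ext (fun z k => by
        change χ z (r.unop • p k) = χ z (p (r.unop • k))
        rw [LinearMap.map_smul p]) }
  have hps : ∀ χ z b, ps χ z b = χ z (p b) := fun _ _ _ => rfl
  have hpsi : Injective ps := by
    intro χ χ' h
    apply CZ_ext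
    intro z c
    obtain ⟨b, rfl⟩ := hp c
    rw [← hps, h, hps]
  obtain ⟨ρ, hρ⟩ := hCi.out ps hpsi LinearMap.id
  have hρ' : ∀ χ, ρ (ps χ) = χ := hρ
  -- two extensions differ by something coming from `C`
  have hker : ∀ χ : CZ R PUnit.{v+1} B, (∀ z a, χ z (i a) = 0) → χ - ps (ρ χ) = 0 := by
    intro χ hχ
    choose sec hsec using hp
    have hw : ∀ z b b', p b = p b' → χ z b = χ z b' := by
      intro z b b' hbb
      obtain ⟨a, ha⟩ := (hip (b - b')).1 (by rw [map_sub, hbb, sub_self])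
      have := hχ z a
      rw [ha, map_sub, sub_eq_zero] at this
      exact this
    let ω : CZ R PUnit.{v+1} C := fun z =>
      { toFun := fun c => χ z (sec c)
        map_zero' := by
          rw [hw z (sec 0) 0 (by rw [hsec, map_zero]), map_zero]
        map_add' := fun a b => by
          rw [hw z _ (sec a + sec b) (by simp [hsec]), map_add] }
    have : χ = ps ω := CZ_ext (fun z b => by
      rw [hps]
      exact hw z _ _ (by rw [hsec]))
    rw [this, hρ', sub_self]
  have hext : ∀ χ : CZ R PUnit.{v+1} A, ∃ χ' : CZ R PUnit.{v+1} B, ∀ z a, χ' z (i a) = χ z a := by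
    intro χ
    choose Θ hΘ using fun z => char_extend i.toAddMonoidHom hi (χ z)
    exact ⟨Θ, hΘ⟩
  choose ex hex using hext
  have hcong : ∀ χ χ' : CZ R PUnit.{v+1} B, (∀ z a, χ z (i a) = χ' z (i a)) →
      χ - ps (ρ χ) = χ' - ps (ρ χ') := by
    intro χ χ' h
    have := hker (χ - χ') (fun z a => by rw [CZ_sub, h, sub_self])
    rw [map_sub, map_sub] at this
    rw [← sub_eq_zero, ← this]
    abel
  let σ : CZ R PUnit.{v+1} A →ₗ[Rᵐᵒᵖ] CZ R PUnit.{v+1} B :=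
    { toFun := fun χ => ex χ - ps (ρ (ex χ))
      map_add' := fun χ χ' => by
        rw [hcong (ex (χ + χ')) (ex χ + ex χ') (fun z a => by simp [CZ_add, hex])]
        rw [map_add, map_add]; abel
      map_smul' := fun r χ => by
        rw [hcong (ex (r • χ)) (r • ex χ) (fun z a => by
          rw [hex, CZ_smul, CZ_smul, ← map_smul, hex])]
        rw [map_smul, map_smul, RingHom.id_apply, smul_sub] }
  have hσ : ∀ χ z a, σ χ z (i a) = χ z a := by
    intro χ z a
    change (ex χ - ps (ρ (ex χ))) z (i a) = _
    rw [CZ_sub, hps, hip.apply_apply_eq_zero, map_zero, sub_zero, hex]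
  rw [injective_iff_map_eq_zero]
  intro t ht
  apply eq_zero_of_char
  intro θ
  let w : N →ₗ[Rᵐᵒᵖ] CZ R PUnit.{v+1} A := homOfChar (fun _ => θ)
  have : ((pairing z LinearMap.id).comp (rtMapRight R B (σ.comp w))).comp (rtMap R N i) = θ := by
    apply rt_hom_ext
    intro n a
    simp only [AddMonoidHom.comp_apply, rtMap_mk, rtMapRight_mk, pairing_mk, LinearMap.id_apply,
      LinearMap.comp_apply]
    rw [hσ]; rfl
  rw [← this, AddMonoidHom.comp_apply, ht, map_zero]

lemma flat_kernel (A B C : ModuleCat.{v} R) (i : A →ₗ[R] B) (p : B →ₗ[R] C) (hi : Injective i)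
    (hp : Surjective p) (hip : Exact i p) (hB : IsFlatMod R B) (hC : IsFlatMod R C) :
    IsFlatMod R A := by
  intro N N' f hf
  rw [injective_iff_map_eq_zero]
  intro t ht
  apply purity C i p hi hp hip hC N
  apply hB N N' f hf
  rw [rtMap_comm, ht, map_zero, map_zero, map_zero]

end Characters

section Single

variable {R : Type u} [Ring R]
variable {K M : Type v} [AddCommGroup K] [Module R K] [AddCommGroup M] [Module R M]

/-- Linearization of a function along a dual basis. -/
def linz (s : M →ₗ[R] (M →₀ R)) (h : M → K) : M →ₗ[R] K :=
  (Finsupp.linearCombination R h).comp s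

lemma linz_apply (s : M →ₗ[R] (M →₀ R)) (h : M → K) (m : M) :
    linz s h m = ∑ x ∈ (s m).support, s m x • h x := rfl

lemma linz_add (s : M →ₗ[R] (M →₀ R)) (h h' : M → K) : linz s (h + h') = linz s h + linz s h' := by
  ext m
  simp [linz_apply, Finset.sum_add_distrib]

lemma linz_sub (s : M →ₗ[R] (M →₀ R)) (h h' : M → K) : linz s (h - h') = linz s h - linz s h' := by
  ext m
  simp [linz_apply, Finset.sum_sub_distrib, smul_sub]

lemma linz_zero (s : M →ₗ[R] (M →₀ R)) : linz s (0 : M → K) = 0 := by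
  ext m
  simp [linz_apply]

lemma linz_lin (s : M →ₗ[R] (M →₀ R)) (hs : LeftInverse (Finsupp.linearCombination R id) s)
    (h : M →ₗ[R] K) : linz s h = h := by
  ext m
  conv_rhs => rw [← hs m]
  rw [Finsupp.linearCombination_apply, Finsupp.sum, map_sum, linz_apply]
  simp

lemma linz_congr (s : M →ₗ[R] (M →₀ R)) (h h' : M → K) (m : M)
    (hh : ∀ x ∈ (s m).support, h x = h' x) : linz s h m = linz s h' m := by
  rw [linz_apply, linz_apply]
  exact Finset.sum_congr rfl (fun x hx => by rw [hh x hx])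

lemma linz_pairing (s : M →ₗ[R] (M →₀ R)) {Z : Type v} (t : RTensor R (CZ R Z K) M) :
    ∃ S : Finset M, ∀ h : M → K, (∀ x ∈ S, h x = 0) → ∀ z, pairing z (linz s h) t = 0 := by
  classical
  induction t using rt_ind with
  | h0 => exact ⟨∅, fun h _ z => map_zero _⟩
  | hmk χ m =>
    refine ⟨(s m).support, fun h hh z => ?_⟩
    rw [pairing_mk, linz_congr s h 0 m hh, linz_zero]
    simp
  | hadd a b ha hb =>
    obtain ⟨Sa, ha⟩ := ha
    obtain ⟨Sb, hb⟩ := hb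
    refine ⟨Sa ∪ Sb, fun h hh z => ?_⟩
    rw [map_add, ha h (fun x hx => hh x (by simp [hx])) z,
      hb h (fun x hx => hh x (by simp [hx])) z, add_zero]

/-- The twisted codifferential on functions on `M ⊕ M`. -/
def twist (s : M →ₗ[R] (M →₀ R)) (D : M →ₗ[R] M) : (M ⊕ M → K) →+ (M ⊕ M → K) where
  toFun h := Sum.elim (fun m => linz s (h ∘ Sum.inl) (D m))
    (fun m => h (Sum.inl m) - linz s (h ∘ Sum.inl) m + linz s (h ∘ Sum.inr) (D m))
  map_zero' := by
    have h1 : (0 : M ⊕ M → K) ∘ Sum.inl = 0 := rfl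
    have h2 : (0 : M ⊕ M → K) ∘ Sum.inr = 0 := rfl
    ext (m | m) <;> simp [h1, h2, linz_zero]
  map_add' a b := by
    have h1 : (a + b) ∘ Sum.inl = a ∘ Sum.inl + b ∘ Sum.inl := rfl
    have h2 : (a + b) ∘ Sum.inr = a ∘ Sum.inr + b ∘ Sum.inr := rfl
    ext (m | m)
    · simp [h1, linz_add]
    · simp only [h1, h2, linz_add, Sum.elim_inr, Pi.add_apply, LinearMap.add_apply]
      abel

lemma twist_inl (s : M →ₗ[R] (M →₀ R)) (D : M →ₗ[R] M) (h : M ⊕ M → K) (m : M) :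
    twist s D h (Sum.inl m) = linz s (h ∘ Sum.inl) (D m) := rfl

lemma twist_inr (s : M →ₗ[R] (M →₀ R)) (D : M →ₗ[R] M) (h : M ⊕ M → K) (m : M) :
    twist s D h (Sum.inr m) =
      h (Sum.inl m) - linz s (h ∘ Sum.inl) m + linz s (h ∘ Sum.inr) (D m) := rfl

lemma twist_inl' (s : M →ₗ[R] (M →₀ R)) (D : M →ₗ[R] M) (h : M ⊕ M → K) :
    twist s D h ∘ Sum.inl = (linz s (h ∘ Sum.inl)).comp D := rfl

lemma twist_inr' (s : M →ₗ[R] (M →₀ R)) (D : M →ₗ[R] M) (h : M ⊕ M → K) :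
    twist s D h ∘ Sum.inr =
      h ∘ Sum.inl - linz s (h ∘ Sum.inl) + (linz s (h ∘ Sum.inr)).comp D := rfl

lemma linz_twist_inl (s : M →ₗ[R] (M →₀ R)) (hs : LeftInverse (Finsupp.linearCombination R id) s)
    (D : M →ₗ[R] M) (h : M ⊕ M → K) :
    linz s (twist s D h ∘ Sum.inl) = (linz s (h ∘ Sum.inl)).comp D := by
  rw [twist_inl', linz_lin s hs]

lemma linz_twist_inr (s : M →ₗ[R] (M →₀ R)) (hs : LeftInverse (Finsupp.linearCombination R id) s)
    (D : M →ₗ[R] M) (h : M ⊕ M → K) :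
    linz s (twist s D h ∘ Sum.inr) = (linz s (h ∘ Sum.inr)).comp D := by
  rw [twist_inr', linz_add, linz_sub, linz_lin s hs, linz_lin s hs, sub_self, zero_add]

lemma twist_twist (s : M →ₗ[R] (M →₀ R)) (hs : LeftInverse (Finsupp.linearCombination R id) s)
    (D : M →ₗ[R] M) (hD : ∀ m, D (D m) = 0) (h : M ⊕ M → K) : twist s D (twist s D h) = 0 := by
  ext (m | m)
  · rw [twist_inl, linz_twist_inl s hs, LinearMap.comp_apply, hD, map_zero, Pi.zero_apply]
  · rw [twist_inr, linz_twist_inl s hs, linz_twist_inr s hs, twist_inl]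
    simp [hD]

theorem single_exact [hM : Module.Projective R M] (D : M →ₗ[R] M) (hD : ∀ m, D (D m) = 0)
    (hex : ∀ Z : Type v, Exact (rtMap R (CZ R Z K) D) (rtMap R (CZ R Z K) D))
    (f : M →ₗ[R] K) (hf : f.comp D = 0) : ∃ g : M →ₗ[R] K, g.comp D = f := by
  classical
  obtain ⟨s, hs⟩ := hM.out
  let supp : M ⊕ M → Finset (M ⊕ M) := fun x => (Sum.elim
    (fun m => (s (D m)).support.image Sum.inl)
    (fun m => {Sum.inl m} ∪ (s m).support.image Sum.inl ∪ (s (D m)).support.image Sum.inr) x)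
  have hloc : Local (twist (K := K) s D) supp := by
    rintro (m | m) h h' hh
    · rw [twist_inl, twist_inl]
      exact linz_congr s _ _ _ (fun x hx => hh (Sum.inl x) (by simp [supp] at hx ⊢; exact hx))
    · rw [twist_inr, twist_inr, hh (Sum.inl m) (by simp [supp]),
        linz_congr s (h ∘ Sum.inl) (h' ∘ Sum.inl) m
          (fun x hx => hh (Sum.inl x) (by simp [supp] at hx ⊢; exact Or.inr hx)),
        linz_congr s (h ∘ Sum.inr) (h' ∘ Sum.inr) (D m)
          (fun x hx => hh (Sum.inr x) (by simp [supp] at hx ⊢; exact hx))]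
  have hA : AProp (twist (K := K) s D) Set.univ := by
    intro S _
    let res : (M ⊕ M → K) →+ (S → K) :=
      { toFun := fun h x => h x, map_zero' := rfl, map_add' := fun _ _ => rfl }
    let B : AddSubgroup (S → K) := (res.comp (twist s D)).range
    let Z : Type v := {ψ : (S → K) →+ QZ // ∀ b ∈ B, ψ b = 0}
    let χ : S → CZ R Z K := fun x ψ => ψ.1.comp (AddMonoidHom.single (fun _ : S => K) x)
    have hχ : ∀ (ψ : Z) (h : M ⊕ M → K), ψ.1 (res h) = ∑ x : S, χ x ψ (h x) := by
      intro ψ h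
      conv_lhs => rw [← Finset.univ_sum_single (res h), map_sum]
      rfl
    have hZ : ∀ (ψ : Z) (g : M ⊕ M → K), ∑ x : S, χ x ψ (twist s D g x) = 0 := by
      intro ψ g
      rw [← hχ]
      exact ψ.2 _ ⟨g, rfl⟩
    let p1 : M ⊕ M → M := Sum.elim id 0
    let p2 : M ⊕ M → M := Sum.elim 0 id
    let a : RTensor R (CZ R Z K) M := ∑ x : S, rtmk R (χ x) (p1 x)
    let b : RTensor R (CZ R Z K) M := ∑ x : S, rtmk R (χ x) (p2 x)
    have hpa : ∀ (ψ : Z) (h : M →ₗ[R] K), pairing ψ h a = ∑ x : S, χ x ψ (h (p1 x)) := by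
      intro ψ h; simp [a]
    have hpb : ∀ (ψ : Z) (h : M →ₗ[R] K), pairing ψ h b = ∑ x : S, χ x ψ (h (p2 x)) := by
      intro ψ h; simp [b]
    have hDa : rtMap R (CZ R Z K) D a = 0 := by
      apply eq_zero_of_pairing
      intro ψ h
      rw [pairing_map, hpa, ← hZ ψ (Sum.elim h 0)]
      refine Finset.sum_congr rfl ?_
      rintro ⟨x | x, hx⟩ -
      · simp [twist_inl, linz_lin s hs, p1]
      · simp [twist_inr, linz_lin s hs, p1, linz_zero]
    have hDb : rtMap R (CZ R Z K) D b = 0 := by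
      apply eq_zero_of_pairing
      intro ψ h
      rw [pairing_map, hpb, ← hZ ψ (Sum.elim 0 h)]
      refine Finset.sum_congr rfl ?_
      rintro ⟨x | x, hx⟩ -
      · simp [twist_inl, linz_zero, p2]
      · simp [twist_inr, linz_lin s hs, p2, linz_zero]
    obtain ⟨a', ha'⟩ := (hex Z a).1 hDa
    obtain ⟨b', hb'⟩ := (hex Z b).1 hDb
    obtain ⟨Sa, hSa⟩ := linz_pairing s a'
    obtain ⟨Sb, hSb⟩ := linz_pairing s b'
    have hdelta : ∀ (ψ : Z) (g : M → K),
        ∑ x : S, χ x ψ (Sum.elim 0 (fun m => g m - linz s g m) x.1) = 0 := by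
      intro ψ g
      rw [← hZ ψ (Sum.elim (g - ⇑(linz s g)) 0)]
      refine Finset.sum_congr rfl ?_
      have h0 : linz s (g - ⇑(linz s g)) = 0 := by rw [linz_sub, linz_lin s hs, sub_self]
      rintro ⟨x | x, hx⟩ -
      · simp [twist_inl, h0]
      · simp [twist_inr, h0, linz_zero]
    let S' : Finset (M ⊕ M) := Sa.image Sum.inl ∪ Sb.image Sum.inr ∪
      S.biUnion (fun x => {Sum.inr (p1 x)} ∪ (s (p1 x)).support.image Sum.inr)
    refine ⟨S', by simp, fun h hh => ?_⟩
    have hmem : res h ∈ B := by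
      apply mem_of_char
      intro ψ0 hψ0
      let ψ : Z := ⟨ψ0, hψ0⟩
      change ψ.1 (res h) = 0
      rw [hχ]
      have e1 : pairing ψ (linz s (h ∘ Sum.inl)) a = 0 := by
        rw [← ha', pairing_map, ← linz_twist_inl s hs]
        exact hSa _ (fun x hx => hh (Sum.inl x) (by simp [S', hx])) ψ
      have e2 : pairing ψ (linz s (h ∘ Sum.inr)) b = 0 := by
        rw [← hb', pairing_map, ← linz_twist_inr s hs]
        exact hSb _ (fun x hx => hh (Sum.inr x) (by simp [S', hx])) ψ
      rw [hpa] at e1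
      rw [hpb] at e2
      have e3 := hdelta ψ (h ∘ Sum.inr)
      have : ∀ x : S, χ x ψ (h x) = χ x ψ (linz s (h ∘ Sum.inl) (p1 x)) +
          χ x ψ (linz s (h ∘ Sum.inr) (p2 x)) +
          χ x ψ (Sum.elim 0 (fun m => (h ∘ Sum.inr) m - linz s (h ∘ Sum.inr) m) x.1) := by
        rintro ⟨x | x, hx⟩
        · rw [← map_add, ← map_add]
          congr 1
          have h1 : twist s D h (Sum.inr x) = 0 := hh _ (by
            simp only [S', Finset.mem_union, Finset.mem_biUnion]
            exact Or.inr ⟨_, hx, Or.inl (by simp [p1])⟩)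
          have h2 : linz s (twist s D h ∘ Sum.inr) x = 0 := by
            rw [linz_congr s _ 0 x, linz_zero, LinearMap.zero_apply]
            intro y hy
            refine hh _ ?_
            simp only [S', Finset.mem_union, Finset.mem_biUnion]
            exact Or.inr ⟨_, hx, Or.inr (by simpa [p1] using hy)⟩
          rw [linz_twist_inr s hs, LinearMap.comp_apply] at h2
          rw [twist_inr, h2, add_zero, sub_eq_zero] at h1
          simp [p1, p2, h1]
        · rw [← map_add, ← map_add]
          congr 1
          simp [p1, p2]
      rw [Finset.sum_congr rfl (fun x _ => this x), Finset.sum_add_distrib,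
        Finset.sum_add_distrib, e1, e2, e3]
      simp
    obtain ⟨g, hg⟩ := hmem
    exact ⟨g, fun x hx => congrFun hg ⟨x, hx⟩⟩
  have hf' : twist s D (Sum.elim f 0 : M ⊕ M → K) = 0 := by
    have h1 : ∀ m, f (D m) = 0 := fun m => DFunLike.congr_fun hf m
    ext (m | m)
    · simp [twist_inl, linz_lin s hs, h1]
    · simp [twist_inr, linz_lin s hs, linz_zero]
  obtain ⟨g, hg⟩ := core_exact hloc (twist_twist s hs D hD) hA hf'
  refine ⟨linz s (g ∘ Sum.inl), ?_⟩
  ext m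
  exact congrFun hg (Sum.inl m)

end Single

section Graded

variable {R : Type u} [Ring R]

/-- A differential with a transported index. -/
def ddc {P : ℤ → ModuleCat.{v} R} (d : ∀ i : ℤ, P (i + 1) →ₗ[R] P i) {i j : ℤ} (h : i = j + 1) :
    P i →ₗ[R] P j := by
  subst h; exact d j

/-- The total module of a graded module. -/
abbrev Tot (P : ℤ → ModuleCat.{v} R) : Type v := DirectSum ℤ (fun i => (P i : Type v))

/-- The total differential. -/
def totD {P : ℤ → ModuleCat.{v} R} (d : ∀ i : ℤ, P (i + 1) →ₗ[R] P i) : Tot P →ₗ[R] Tot P :=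
  DirectSum.toModule R ℤ (Tot P) (fun i =>
    (DirectSum.lof R ℤ (fun i => (P i : Type v)) (i - 1)).comp (ddc d (by ring)))

lemma totD_lof {P : ℤ → ModuleCat.{v} R} (d : ∀ i : ℤ, P (i + 1) →ₗ[R] P i) (j : ℤ)
    (x : P (j + 1)) :
    totD d (DirectSum.lof R ℤ (fun i => (P i : Type v)) (j + 1) x) =
      DirectSum.lof R ℤ (fun i => (P i : Type v)) j (d j x) := by
  have key : ∀ (i j j' : ℤ) (h : i = j + 1) (h' : i = j' + 1) (x : P i),
      DirectSum.lof R ℤ (fun i => (P i : Type v)) j (ddc d h x) =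
      DirectSum.lof R ℤ (fun i => (P i : Type v)) j' (ddc d h' x) := by
    intro i j j' h h' x
    obtain rfl : j = j' := by omega
    rfl
  unfold totD
  rw [DirectSum.toModule_lof, LinearMap.comp_apply]
  exact key _ _ _ _ rfl x

lemma component_totD {P : ℤ → ModuleCat.{v} R} (d : ∀ i : ℤ, P (i + 1) →ₗ[R] P i) (j : ℤ) :
    (DirectSum.component R ℤ (fun i => (P i : Type v)) j).comp (totD d) =
      (d j).comp (DirectSum.component R ℤ (fun i => (P i : Type v)) (j + 1)) := by
  apply DirectSum.linearMap_ext
  intro i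
  obtain ⟨i, rfl⟩ : ∃ k, i = k + 1 := ⟨i - 1, by ring⟩
  ext x
  simp only [LinearMap.comp_apply]
  rw [totD_lof]
  by_cases h : i = j
  · subst h
    rw [DirectSum.component.lof_self, DirectSum.component.lof_self]
  · rw [DirectSum.component.of, DirectSum.component.of, dif_neg h, dif_neg (by omega), map_zero]

lemma tensor_decomp {P : ℤ → ModuleCat.{v} R} {I : Type v} [AddCommGroup I] [Module Rᵐᵒᵖ I]
    (t : RTensor R I (Tot P)) : ∃ S : Finset ℤ, ∀ S', S ⊆ S' → t = ∑ i ∈ S',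
      rtMap R I (DirectSum.lof R ℤ (fun i => (P i : Type v)) i)
        (rtMap R I (DirectSum.component R ℤ (fun i => (P i : Type v)) i) t) := by
  classical
  induction t using rt_ind with
  | h0 => exact ⟨∅, by simp⟩
  | hadd a b ha hb =>
    obtain ⟨Sa, ha⟩ := ha
    obtain ⟨Sb, hb⟩ := hb
    refine ⟨Sa ∪ Sb, fun S' hS' => ?_⟩
    simp only [map_add, Finset.sum_add_distrib]
    rw [← ha S' (Finset.subset_union_left.trans hS'),
      ← hb S' (Finset.subset_union_right.trans hS')]
  | hmk x m =>
    induction m using DirectSum.induction_on with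
    | zero => exact ⟨∅, fun S' _ => by simp [rtmk_zero_right]⟩
    | of i y =>
      refine ⟨{i}, fun S' hS' => ?_⟩
      have hi : i ∈ S' := hS' (by simp)
      rw [Finset.sum_eq_single i]
      · simp only [rtMap_mk]
        congr 1
        change DirectSum.lof R ℤ (fun i => (P i : Type v)) i y = DirectSum.lof R ℤ _ i
          (DirectSum.component R ℤ (fun i => (P i : Type v)) i
            (DirectSum.lof R ℤ (fun i => (P i : Type v)) i y))
        rw [DirectSum.component.lof_self]
      · intro j _ hj
        simp only [rtMap_mk]
        have : DirectSum.component R ℤ (fun i => (P i : Type v)) j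
            (DirectSum.lof R ℤ (fun i => (P i : Type v)) i y) = 0 := by
          rw [DirectSum.component.of, dif_neg (Ne.symm hj)]
        change rtmk R x (DirectSum.lof R ℤ (fun i => (P i : Type v)) j (DirectSum.component R ℤ (fun i => (P i : Type v)) j
            (DirectSum.lof R ℤ (fun i => (P i : Type v)) i y))) = 0
        rw [this, map_zero, rtmk_zero_right]
      · intro h; exact absurd hi h
    | add a b ha hb =>
      obtain ⟨Sa, ha⟩ := ha
      obtain ⟨Sb, hb⟩ := hb
      refine ⟨Sa ∪ Sb, fun S' hS' => ?_⟩
      simp only [rtmk_add_right, map_add, Finset.sum_add_distrib]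
      rw [← ha S' (Finset.subset_union_left.trans hS'),
        ← hb S' (Finset.subset_union_right.trans hS')]

lemma tot_exact {P : ℤ → ModuleCat.{v} R} (d : ∀ i : ℤ, P (i + 1) →ₗ[R] P i)
    (hd : ∀ i x, d i (d (i + 1) x) = 0) (I : Type v) [AddCommGroup I] [Module Rᵐᵒᵖ I]
    (hex : ∀ i : ℤ, Exact (rtMap R I (d (i + 1))) (rtMap R I (d i))) :
    (∀ m, totD d (totD d m) = 0) ∧ Exact (rtMap R I (totD d)) (rtMap R I (totD d)) := by
  have hDD : ∀ m, totD d (totD d m) = 0 := by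
    have : (totD d).comp (totD d) = 0 := by
      apply DirectSum.linearMap_ext
      intro i
      obtain ⟨i, rfl⟩ : ∃ k, i = k + 1 + 1 := ⟨i - 1 - 1, by ring⟩
      ext x
      simp only [LinearMap.comp_apply]
      rw [totD_lof, totD_lof, hd, map_zero]
      simp
    exact fun m => DFunLike.congr_fun this m
  refine ⟨hDD, fun t => ⟨fun ht => ?_, ?_⟩⟩
  · have h1 : ∀ i, ∃ w, rtMap R I (d i) w =
        rtMap R I (DirectSum.component R ℤ (fun i => (P i : Type v)) i) t := by
      intro i
      obtain ⟨i, rfl⟩ : ∃ k, i = k + 1 := ⟨i - 1, by ring⟩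
      apply (hex i _).1
      rw [rtMap_comp, ← component_totD, ← rtMap_comp, ht, map_zero]
    choose w hw using h1
    obtain ⟨S, hS⟩ := tensor_decomp t
    refine ⟨∑ i ∈ S, rtMap R I (DirectSum.lof R ℤ (fun i => (P i : Type v)) (i + 1)) (w i), ?_⟩
    rw [map_sum]
    conv_rhs => rw [hS S subset_rfl]
    refine Finset.sum_congr rfl (fun i _ => ?_)
    rw [← hw, rtMap_comp, rtMap_comp]
    congr 2
    exact LinearMap.ext (fun x => totD_lof d i x)
  · rintro ⟨w, rfl⟩
    rw [rtMap_comp]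
    have : (totD d).comp (totD d) = 0 := LinearMap.ext hDD
    rw [this, rtMap_zero]

/-- A complex of projectives which is exact after tensoring with injectives stays exact after
applying `Hom(-, K)` with `K` flat. -/
theorem hom_exact_of_projective {P : ℤ → ModuleCat.{v} R} (d : ∀ i : ℤ, P (i + 1) →ₗ[R] P i)
    (hP : ∀ i, Module.Projective R (P i)) (hd : ∀ i x, d i (d (i + 1) x) = 0)
    (hten : ∀ I : ModuleCat.{v} Rᵐᵒᵖ, Module.Injective Rᵐᵒᵖ I →
      ∀ i : ℤ, Exact (rtMap R (I : Type v) (d (i + 1))) (rtMap R (I : Type v) (d i)))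
    (K : ModuleCat.{v} R) (hK : IsFlatMod R K) (i : ℤ) (f : P (i + 1) →ₗ[R] K)
    (hf : f.comp (d (i + 1)) = 0) : ∃ g : P i →ₗ[R] K, g.comp (d i) = f := by
  have h1 : ∀ Z : Type v, _ := fun Z => tot_exact d hd (CZ R Z K)
    (hten (ModuleCat.of Rᵐᵒᵖ (CZ R Z K)) (CZ_injective Z K hK))
  obtain ⟨G, hG⟩ := single_exact (totD d) (h1 PUnit).1 (fun Z => (h1 Z).2)
    (f.comp (DirectSum.component R ℤ (fun i => (P i : Type v)) (i + 1))) (by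
      rw [LinearMap.comp_assoc, component_totD, ← LinearMap.comp_assoc, hf, LinearMap.zero_comp])
  refine ⟨G.comp (DirectSum.lof R ℤ (fun i => (P i : Type v)) i), ?_⟩
  ext x
  simp only [LinearMap.comp_apply]
  rw [← totD_lof]
  have := DFunLike.congr_fun hG (DirectSum.lof R ℤ (fun i => (P i : Type v)) (i + 1) x)
  rw [LinearMap.comp_apply, LinearMap.comp_apply, DirectSum.component.lof_self] at this
  exact this

end Graded

section Homological

variable {R : Type u} [Ring R]

/-- Short exact sequences. -/
structure SES_s4 {K A M : Type v} [AddCommGroup K] [Module R K] [AddCommGroup A] [Module R A]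
    [AddCommGroup M] [Module R M] (i : K →ₗ[R] A) (p : A →ₗ[R] M) : Prop where
  inj : Injective i
  exact : Exact i p
  surj : Surjective p

lemma ses_ker {A M : Type v} [AddCommGroup A] [Module R A]
    [AddCommGroup M] [Module R M] (p : A →ₗ[R] M) (hp : Surjective p) :
    SES_s4 (LinearMap.ker p).subtype p :=
  ⟨Subtype.coe_injective, fun a => by simp, hp⟩

lemma factor {X Y C : Type*} [AddCommGroup X] [Module R X] [AddCommGroup Y] [Module R Y]
    [AddCommGroup C] [Module R C] (q : X →ₗ[R] Y) (hq : Surjective q) (f : X →ₗ[R] C)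
    (h : ∀ x, q x = 0 → f x = 0) : ∃ g : Y →ₗ[R] C, ∀ x, g (q x) = f x := by
  have hle : LinearMap.ker q ≤ LinearMap.ker f := fun x hx => h x hx
  refine ⟨((LinearMap.ker q).liftQ f hle).comp
    (LinearMap.quotKerEquivOfSurjective q hq).symm.toLinearMap, fun x => ?_⟩
  have : (LinearMap.quotKerEquivOfSurjective q hq).symm (q x) = Submodule.Quotient.mk x := by
    rw [LinearEquiv.symm_apply_eq]; rfl
  simp [this]

/-- lifting along an injection with prescribed image. -/
lemma cofactor {X Y Z : Type*} [AddCommGroup X] [Module R X] [AddCommGroup Y] [Module R Y]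
    [AddCommGroup Z] [Module R Z] (i : X →ₗ[R] Y) (hi : Injective i) (f : Z →ₗ[R] Y)
    (h : ∀ z, ∃ x, i x = f z) : ∃ g : Z →ₗ[R] X, ∀ z, i (g z) = f z := by
  choose g hg using h
  exact ⟨{ toFun := g
           map_add' := fun a b => hi (by simp [hg])
           map_smul' := fun r a => hi (by simp [hg]) }, hg⟩

lemma split_equiv {K X P : Type v} [AddCommGroup K] [Module R K] [AddCommGroup X] [Module R X]
    [AddCommGroup P] [Module R P] [Module.Projective R P] (i : K →ₗ[R] X) (p : X →ₗ[R] P)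
    (h : SES_s4 i p) : Nonempty ((K × P) ≃ₗ[R] X) := by
  obtain ⟨σ, hσ⟩ := Module.projective_lifting_property p LinearMap.id h.surj
  have hσ' : ∀ y, p (σ y) = y := fun y => DFunLike.congr_fun hσ y
  refine ⟨LinearEquiv.ofBijective (i.coprod σ) ⟨?_, ?_⟩⟩
  · rw [injective_iff_map_eq_zero]
    rintro ⟨k, y⟩ hk
    simp only [LinearMap.coprod_apply] at hk
    have h1 := congrArg p hk
    rw [map_add, h.exact.apply_apply_eq_zero, hσ', zero_add, map_zero] at h1
    subst h1
    rw [map_zero, add_zero] at hk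
    rw [(injective_iff_map_eq_zero i).1 h.inj k hk]
    rfl
  · intro x
    obtain ⟨k, hk⟩ := (h.exact (x - σ (p x))).1 (by rw [map_sub, hσ', sub_self])
    exact ⟨(k, p x), by simp [hk]⟩

/-- Maps into `C` extend along kernels of surjections onto `M`. -/
def ExtP (C M : ModuleCat.{v} R) : Prop :=
  ∀ (K B : ModuleCat.{v} R) (i : K →ₗ[R] B) (p : B →ₗ[R] M), SES_s4 i p →
    ∀ φ : K →ₗ[R] C, ∃ Φ : B →ₗ[R] C, ∀ k, Φ (i k) = φ k

lemma extP_of {C M K A : ModuleCat.{v} R} (i : K →ₗ[R] A) (p : A →ₗ[R] M) (h : SES_s4 i p)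
    [Module.Projective R A] (hext : ∀ φ : K →ₗ[R] C, ∃ Φ : A →ₗ[R] C, ∀ k, Φ (i k) = φ k) :
    ExtP C M := by
  intro K' B i' p' h' φ
  obtain ⟨w, hw⟩ := Module.projective_lifting_property p' p h'.surj
  have hw' : ∀ a, p' (w a) = p a := fun a => DFunLike.congr_fun hw a
  obtain ⟨w', hw''⟩ := cofactor i' h'.inj (w.comp i) (fun k => by
    refine (h'.exact _).1 ?_
    rw [LinearMap.comp_apply, hw', h.exact.apply_apply_eq_zero])
  obtain ⟨α, hα⟩ := hext (φ.comp w')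
  obtain ⟨Φ, hΦ⟩ := factor (i'.coprod w) (by
    intro b
    obtain ⟨a, ha⟩ := h.surj (p' b)
    obtain ⟨k, hk⟩ := (h'.exact (b - w a)).1 (by rw [map_sub, hw', ha, sub_self])
    exact ⟨(k, a), by simp [hk]⟩) (φ.coprod α) (by
    rintro ⟨k, a⟩ hka
    simp only [LinearMap.coprod_apply] at hka ⊢
    have h1 := congrArg p' hka
    rw [map_add, h'.exact.apply_apply_eq_zero, hw', zero_add, map_zero] at h1
    obtain ⟨l, rfl⟩ := (h.exact a).1 h1
    rw [hα, LinearMap.comp_apply, ← map_add]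
    have : k + w' l = 0 := h'.inj (by rw [map_add, hw'', map_zero]; exact hka)
    rw [this, map_zero])
  exact ⟨Φ, fun k => by simpa using hΦ (k, 0)⟩

/-- Iterated version of `ExtP`. -/
def EVall (C : ModuleCat.{v} R) : ℕ → ModuleCat.{v} R → Prop
  | 0, M => ExtP C M
  | m + 1, M => ∀ (K A : ModuleCat.{v} R) (i : K →ₗ[R] A) (p : A →ₗ[R] M), SES_s4 i p →
      Module.Projective R A → EVall C m K

lemma SES_s4.congr {K A M M' : ModuleCat.{v} R} {i : K →ₗ[R] A} {p : A →ₗ[R] M} (h : SES_s4 i p)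
    (e : M ≃ₗ[R] M') : SES_s4 i (e.toLinearMap.comp p) :=
  ⟨h.inj, fun a => by simpa using h.exact a, e.surjective.comp h.surj⟩

lemma EVall_equiv {C M M' : ModuleCat.{v} R} (e : M ≃ₗ[R] M') {m : ℕ} (h : EVall C m M) :
    EVall C m M' := by
  cases m with
  | zero =>
    intro K B i p hip
    exact h K B i (e.symm.toLinearMap.comp p) (hip.congr e.symm)
  | succ m =>
    intro K B i p hip hB
    exact h K B i (e.symm.toLinearMap.comp p) (hip.congr e.symm) hB

lemma SES_s4.prod {K A M : ModuleCat.{v} R} {i : K →ₗ[R] A} {p : A →ₗ[R] M} (h : SES_s4 i p)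
    (P : Type v) [AddCommGroup P] [Module R P] :
    SES_s4 ((LinearMap.inl R A P).comp i) (p.prodMap (LinearMap.id : P →ₗ[R] P)) := by
  refine ⟨LinearMap.inl_injective.comp h.inj, ?_, ?_⟩
  · rintro ⟨a, x⟩
    simp only [LinearMap.prodMap_apply, LinearMap.id_apply, Prod.mk_eq_zero, Set.mem_range,
      LinearMap.comp_apply, LinearMap.inl_apply, Prod.mk.injEq, h.exact a]
    constructor
    · rintro ⟨⟨k, hk⟩, rfl⟩; exact ⟨k, hk, rfl⟩
    · rintro ⟨k, hk, rfl⟩; exact ⟨⟨k, hk⟩, rfl⟩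
  · rintro ⟨m, x⟩
    obtain ⟨a, rfl⟩ := h.surj m
    exact ⟨(a, x), rfl⟩

lemma EVall_of_prod {C M P : ModuleCat.{v} R} [Module.Projective R P] {m : ℕ}
    (h : EVall C m (ModuleCat.of R (M × P))) : EVall C m M := by
  cases m with
  | zero =>
    intro K B i p hip φ
    obtain ⟨Φ, hΦ⟩ := h K (ModuleCat.of R (B × P)) _ _ (hip.prod P) φ
    exact ⟨Φ.comp (LinearMap.inl R B P), hΦ⟩
  | succ m =>
    intro K B i p hip hB
    refine h K (ModuleCat.of R (B × P)) _ _ (hip.prod P) ?_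
    change Module.Projective R (B × P)
    infer_instance

lemma EVall_prod {C M P : ModuleCat.{v} R} [Module.Projective R P] {m : ℕ}
    (h : EVall C m M) : EVall C m (ModuleCat.of R (M × P)) := by
  have key : ∀ (K B : ModuleCat.{v} R) (i : K →ₗ[R] B) (p : B →ₗ[R] (M × P)), SES_s4 i p →
      ∃ (B1 : ModuleCat.{v} R) (j : B1 →ₗ[R] B) (r : B →ₗ[R] B1) (i1 : K →ₗ[R] B1)
        (p1 : B1 →ₗ[R] M), (∀ x, r (j x) = x) ∧ (∀ k, j (i1 k) = i k) ∧ SES_s4 i1 p1 := by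
    intro K B i p hip
    let q : B →ₗ[R] P := (LinearMap.snd R M P).comp p
    have hq : Surjective q := Prod.snd_surjective.comp hip.surj
    obtain ⟨σ, hσ⟩ := Module.projective_lifting_property q LinearMap.id hq
    have hσ' : ∀ y, q (σ y) = y := fun y => DFunLike.congr_fun hσ y
    have hpi : ∀ k, p (i k) = 0 := fun k => hip.exact.apply_apply_eq_zero k
    let r : B →ₗ[R] LinearMap.ker q := (LinearMap.id - σ.comp q).codRestrict _ (by
      intro b; simp [hσ'])
    let i1 : K →ₗ[R] LinearMap.ker q := i.codRestrict _ (by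
      intro k; simp [q, hpi])
    refine ⟨ModuleCat.of R (LinearMap.ker q), (LinearMap.ker q).subtype, r, i1,
      ((LinearMap.fst R M P).comp p).comp (LinearMap.ker q).subtype, ?_, ?_, ?_, ?_, ?_⟩
    · rintro ⟨x, hx⟩
      apply Subtype.ext
      have hx' : q x = 0 := hx
      simp [r, hx']
    · intro k; rfl
    · intro k k' hk
      exact hip.inj (congrArg Subtype.val hk)
    · rintro ⟨x, hx⟩
      have hx' : (p x).2 = 0 := hx
      constructor
      · intro h0
        have h0' : (p x).1 = 0 := h0
        obtain ⟨k, rfl⟩ := (hip.exact x).1 (Prod.ext h0' hx')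
        exact ⟨k, rfl⟩
      · rintro ⟨k, hk⟩
        have : i k = x := congrArg Subtype.val hk
        change (p x).1 = 0
        rw [← this, hpi]; rfl
    · intro y
      obtain ⟨b, hb⟩ := hip.surj (y, 0)
      refine ⟨⟨b, ?_⟩, ?_⟩
      · change (p b).2 = 0
        rw [hb]
      · change (p b).1 = y
        rw [hb]
  cases m with
  | zero =>
    intro K B i p hip φ
    obtain ⟨B1, j, r, i1, p1, hrj, hji, hs⟩ := key K B i p hip
    obtain ⟨Φ, hΦ⟩ := h K B1 i1 p1 hs φ
    refine ⟨Φ.comp r, fun k => ?_⟩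
    rw [← hji, LinearMap.comp_apply, hrj, hΦ]
  | succ m =>
    intro K B i p hip hB
    obtain ⟨B1, j, r, i1, p1, hrj, hji, hs⟩ := key K B i p hip
    exact h K B1 i1 p1 hs (Module.Projective.of_split j r (LinearMap.ext hrj))

/-- Schanuel comparison. -/
lemma EVall_schanuel {C M K A K' A' : ModuleCat.{v} R} [Module.Projective R A]
    [Module.Projective R A'] {i : K →ₗ[R] A} {p : A →ₗ[R] M} (h : SES_s4 i p)
    {i' : K' →ₗ[R] A'} {p' : A' →ₗ[R] M} (h' : SES_s4 i' p') {m : ℕ} (hK : EVall C m K) :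
    EVall C m K' := by
  let X : Submodule R (A × A') := LinearMap.ker
    (p.comp (LinearMap.fst R A A') - p'.comp (LinearMap.snd R A A'))
  have hX : ∀ x : A × A', x ∈ X ↔ p x.1 = p' x.2 := by
    intro x
    simp [X, sub_eq_zero]
  let j : K →ₗ[R] X := ((LinearMap.inl R A A').comp i).codRestrict X (by
    intro k; rw [hX]; simp [h.exact.apply_apply_eq_zero])
  let j' : K' →ₗ[R] X := ((LinearMap.inr R A A').comp i').codRestrict X (by
    intro k; rw [hX]; simp [h'.exact.apply_apply_eq_zero])
  have s1 : SES_s4 j ((LinearMap.snd R A A').comp X.subtype) := by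
    refine ⟨fun k k' hk => ?_, ?_, ?_⟩
    · exact h.inj (congrArg (fun x : X => x.1.1) hk)
    · rintro ⟨⟨a, a'⟩, hx⟩
      have hx' := (hX _).1 hx
      constructor
      · intro h0
        have h0' : a' = 0 := h0
        subst h0'
        obtain ⟨k, rfl⟩ := (h.exact a).1 (by rw [hx', map_zero])
        exact ⟨k, rfl⟩
      · rintro ⟨k, hk⟩
        exact (congrArg (fun x : X => x.1.2) hk).symm
    · intro a'
      obtain ⟨a, ha⟩ := h.surj (p' a')
      exact ⟨⟨(a, a'), (hX _).2 ha⟩, rfl⟩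
  have s2 : SES_s4 j' ((LinearMap.fst R A A').comp X.subtype) := by
    refine ⟨fun k k' hk => ?_, ?_, ?_⟩
    · exact h'.inj (congrArg (fun x : X => x.1.2) hk)
    · rintro ⟨⟨a, a'⟩, hx⟩
      have hx' := (hX _).1 hx
      constructor
      · intro h0
        have h0' : a = 0 := h0
        subst h0'
        obtain ⟨k, rfl⟩ := (h'.exact a').1 (by rw [← hx', map_zero])
        exact ⟨k, rfl⟩
      · rintro ⟨k, hk⟩
        exact (congrArg (fun x : X => x.1.1) hk).symm
    · intro a
      obtain ⟨a', ha⟩ := h'.surj (p a)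
      exact ⟨⟨(a, a'), (hX _).2 ha.symm⟩, rfl⟩
  obtain ⟨e1⟩ := split_equiv _ _ s1
  obtain ⟨e2⟩ := split_equiv _ _ s2
  have t1 : EVall C m (ModuleCat.of R X) := EVall_equiv e1 (EVall_prod (P := A') hK)
  have t2 : EVall C m (ModuleCat.of R (K' × A)) := EVall_equiv e2.symm t1
  exact EVall_of_prod t2

lemma extVanish_of_EVall {C : ModuleCat.{v} R} (m : ℕ) : ∀ (M : ModuleCat.{v} R),
    EVall C m M → ExtVanish R M C m := by
  induction m with
  | zero =>
    intro M h res f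
    constructor
    · intro hf
      have hf' : ∀ x, f (res.d 1 x) = 0 := fun x => DFunLike.congr_fun hf x
      obtain ⟨q, hq⟩ := cofactor (LinearMap.ker res.π).subtype Subtype.coe_injective (res.d 0)
        (fun z => ⟨⟨res.d 0 z, res.exact0.apply_apply_eq_zero z⟩, rfl⟩)
      obtain ⟨φ, hφ⟩ := factor q (by
        rintro ⟨x, hx⟩
        obtain ⟨y, hy⟩ := (res.exact0 x).1 hx
        exact ⟨y, Subtype.ext ((hq y).trans hy)⟩) f (by
        intro x hx
        have : res.d 0 x = 0 := by rw [← hq, hx]; simp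
        obtain ⟨y, rfl⟩ := (res.exact 0 x).1 this
        exact hf' y)
      obtain ⟨Φ, hΦ⟩ := h (ModuleCat.of R (LinearMap.ker res.π)) (res.P 0) _ _
        (ses_ker res.π res.surj) φ
      refine ⟨Φ, LinearMap.ext fun x => ?_⟩
      rw [← hφ, ← hΦ, hq]; rfl
    · rintro ⟨g, rfl⟩
      refine LinearMap.ext fun x => ?_
      change g (res.d 0 (res.d (0 + 1) x)) = 0
      rw [(res.exact 0).apply_apply_eq_zero, map_zero]
  | succ m ih =>
    intro M h res
    have h1 := h (ModuleCat.of R (LinearMap.ker res.π)) (res.P 0) _ _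
        (ses_ker res.π res.surj) (res.projective 0)
    let res' : ProjRes R (ModuleCat.of R (LinearMap.ker res.π)) :=
      { P := fun i => res.P (i + 1)
        d := fun i => res.d (i + 1)
        π := (res.d 0).codRestrict (LinearMap.ker res.π)
          (fun z => res.exact0.apply_apply_eq_zero z)
        projective := fun i => res.projective _
        surj := by
          rintro ⟨x, hx⟩
          obtain ⟨y, hy⟩ := (res.exact0 x).1 hx
          exact ⟨y, Subtype.ext hy⟩
        exact0 := by
          intro x
          rw [← res.exact 0 x]
          exact Subtype.ext_iff
        exact := fun i => res.exact (i + 1) }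
    exact ih _ h1 res'

/-- Projective dimension through exact sequences. -/
def PD : ℕ → ModuleCat.{v} R → Prop
  | 0, M => Module.Projective R M
  | k + 1, M => ∃ (K A : ModuleCat.{v} R) (i : K →ₗ[R] A) (p : A →ₗ[R] M), SES_s4 i p ∧
      Module.Projective R A ∧ PD k K

lemma PD_equiv {M M' : ModuleCat.{v} R} (e : M ≃ₗ[R] M') {k : ℕ} (h : PD k M) : PD k M' := by
  cases k with
  | zero =>
    have : Module.Projective R M := h
    exact Module.Projective.of_equiv e
  | succ k =>
    obtain ⟨K, A, i, p, hs, hA, hK⟩ := h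
    exact ⟨K, A, i, _, hs.congr e, hA, hK⟩

lemma PD_prod {M P : ModuleCat.{v} R} [Module.Projective R P] {k : ℕ} (h : PD k M) :
    PD k (ModuleCat.of R (M × P)) := by
  cases k with
  | zero =>
    have : Module.Projective R M := h
    change Module.Projective R (M × P)
    infer_instance
  | succ k =>
    obtain ⟨K, A, i, p, hs, hA, hK⟩ := h
    refine ⟨K, ModuleCat.of R (A × P), _, _, hs.prod P, ?_, hK⟩
    change Module.Projective R (A × P)
    infer_instance

lemma PD_of_projDimLE (k : ℕ) : ∀ M : ModuleCat.{v} R, ProjDimLE R M k → PD k M := by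
  induction k with
  | zero =>
    rintro M ⟨P, d, π, hP, hπ, h0, hex, hsub⟩
    have : Subsingleton (P 1) := hsub 1 (by norm_num)
    have hi : Injective π := by
      rw [injective_iff_map_eq_zero]
      intro x hx
      obtain ⟨y, rfl⟩ := (h0 x).1 hx
      have : y = 0 := Subsingleton.elim (α := P 1) y 0
      rw [this, map_zero]
    have := hP 0
    exact Module.Projective.of_equiv (LinearEquiv.ofBijective π ⟨hi, hπ⟩)
  | succ k ih =>
    rintro M ⟨P, d, π, hP, hπ, h0, hex, hsub⟩
    refine ⟨ModuleCat.of R (LinearMap.ker π), P 0, _, _, ses_ker π hπ, hP 0, ih _ ?_⟩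
    refine ⟨fun i => P (i + 1), fun i => d (i + 1), (d 0).codRestrict (LinearMap.ker π)
          (fun z => h0.apply_apply_eq_zero z), fun i => hP _, ?_, ?_, fun i => hex (i + 1),
          fun i hi => hsub _ (by omega)⟩
    · rintro ⟨x, hx⟩
      obtain ⟨y, hy⟩ := (h0 x).1 hx
      exact ⟨y, Subtype.ext hy⟩
    · intro x
      rw [← hex 0 x]
      exact Subtype.ext_iff

lemma gp_of_projective (A : ModuleCat.{v} R) [Module.Projective R A] :
    IsGorensteinProjective R A := by
  let B : ModuleCat.{v} R := ModuleCat.of R (A × A)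
  let δ : B →ₗ[R] B := (LinearMap.inl R A A).comp (LinearMap.snd R A A)
  refine ⟨fun _ => B, fun _ => δ, fun _ => ?_, fun _ => ?_, fun Q _ _ => ?_, ⟨?_⟩⟩
  · change Module.Projective R (A × A)
    infer_instance
  · rintro ⟨a, b⟩
    constructor
    · intro h
      have hb : b = 0 := congrArg Prod.fst h
      exact ⟨(0, a), by rw [hb]; rfl⟩
    · rintro ⟨⟨c, e⟩, h⟩
      have hb : 0 = b := congrArg Prod.snd h
      rw [← hb]; rfl
  · intro f
    constructor
    · intro hf
      refine ⟨f.comp ((LinearMap.inr R A A).comp (LinearMap.fst R A A)), LinearMap.ext ?_⟩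
      rintro ⟨a, b⟩
      have h1 : f ((a, 0) : A × A) = 0 := DFunLike.congr_fun hf ((0, a) : A × A)
      change f ((0, b) : A × A) = f ((a, b) : A × A)
      have h2 : ((a, b) : A × A) = (a, 0) + (0, b) := by simp
      rw [h2]
      erw [map_add f ((a, 0) : A × A) ((0, b) : A × A)]
      rw [h1, zero_add]
    · rintro ⟨g, rfl⟩
      refine LinearMap.ext ?_
      rintro ⟨a, b⟩
      exact map_zero g
  · exact LinearEquiv.ofBijective ((LinearMap.inl R A A).codRestrict (LinearMap.ker δ) (by
      intro a; rfl)) ⟨fun a b h => congrArg (fun x : LinearMap.ker δ => x.1.1) h, by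
      rintro ⟨⟨a, b⟩, h⟩
      have hb : b = 0 := congrArg Prod.fst h
      subst hb
      exact ⟨a, rfl⟩⟩

lemma gp_equiv {M M' : ModuleCat.{v} R} (e : M ≃ₗ[R] M') (h : IsGorensteinProjective R M) :
    IsGorensteinProjective R M' := by
  obtain ⟨P, d, h1, h2, h3, ⟨e'⟩⟩ := h
  exact ⟨P, d, h1, h2, h3, ⟨e.symm.trans e'⟩⟩

lemma gpd_zero {M : ModuleCat.{v} R} (h : IsGorensteinProjective R M) : GorProjDimLE R M 0 := by
  refine ⟨fun i => Nat.casesOn i M (fun _ => ModuleCat.of R PUnit.{v+1}), fun i => 0,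
    LinearMap.id, ?_, fun x => ⟨x, rfl⟩, ?_, ?_, ?_⟩
  · intro i
    cases i with
    | zero => exact h
    | succ i =>
      have : Module.Projective R (ModuleCat.of R PUnit.{v+1}) := by
        change Module.Projective R PUnit.{v+1}
        infer_instance
      exact gp_of_projective (ModuleCat.of R PUnit.{v+1})
  · intro x
    constructor
    · intro hx
      exact ⟨0, hx.symm⟩
    · rintro ⟨y, rfl⟩; rfl
  · intro i x
    constructor
    · intro _
      exact ⟨0, Subsingleton.elim (α := PUnit.{v+1}) _ _⟩
    · rintro ⟨y, rfl⟩
      rfl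
  · intro i hi
    obtain ⟨j, rfl⟩ : ∃ j, i = j + 1 := ⟨i - 1, by omega⟩
    change Subsingleton PUnit.{v+1}
    infer_instance

lemma gpd_succ {K A M : ModuleCat.{v} R} {i : K →ₗ[R] A} {p : A →ₗ[R] M} (h : SES_s4 i p)
    (hA : IsGorensteinProjective R A) {k : ℕ} (hK : GorProjDimLE R K k) :
    GorProjDimLE R M (k + 1) := by
  obtain ⟨G, d, π, hG, hπ, h0, hex, hsub⟩ := hK
  refine ⟨fun j => Nat.casesOn j A G, fun j => match j with
    | 0 => i.comp π
    | j + 1 => d j, p, ?_, h.surj, ?_, ?_, ?_⟩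
  · intro j
    cases j with
    | zero => exact hA
    | succ j => exact hG j
  · intro x
    rw [h.exact x]
    constructor
    · rintro ⟨k, rfl⟩
      obtain ⟨g, rfl⟩ := hπ k
      exact ⟨g, rfl⟩
    · rintro ⟨g, rfl⟩
      exact ⟨π g, rfl⟩
  · intro j
    cases j with
    | zero =>
      intro x
      change i (π x) = 0 ↔ x ∈ Set.range (d 0)
      rw [← h0 x]
      exact map_eq_zero_iff i h.inj
    | succ j => exact hex j
  · intro j hj
    obtain ⟨j', rfl⟩ : ∃ j', j = j' + 1 := ⟨j - 1, by omega⟩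
    exact hsub j' (by omega)

lemma gpd_equiv {M M' : ModuleCat.{v} R} (e : M ≃ₗ[R] M') {k : ℕ} (h : GorProjDimLE R M k) :
    GorProjDimLE R M' k := by
  obtain ⟨G, d, π, hG, hπ, h0, hex, hsub⟩ := h
  exact ⟨G, d, e.toLinearMap.comp π, hG, e.surjective.comp hπ, fun x => by simpa using h0 x,
    hex, hsub⟩

end Homological

section Step

variable {R : Type u} [Ring R]

/-- Exact complexes of flat modules that stay exact after tensoring with injectives. -/
structure GFC (F : ℤ → ModuleCat.{v} R) (d : ∀ i : ℤ, F (i + 1) →ₗ[R] F i) : Prop where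
  flat : ∀ i, IsFlatMod R (F i)
  exact : ∀ i, Exact (d (i + 1)) (d i)
  tensor : ∀ I : ModuleCat.{v} Rᵐᵒᵖ, Module.Injective Rᵐᵒᵖ I →
      ∀ i : ℤ, Exact (rtMap R (I : Type v) (d (i + 1))) (rtMap R (I : Type v) (d i))

abbrev sB (A : ℤ → ModuleCat.{v} R) (i : ℤ) : Type v := A (i + 1) × A i

def sBd (A : ℤ → ModuleCat.{v} R) (i : ℤ) : sB A (i + 1) →ₗ[R] sB A i :=
  (LinearMap.inl R (A (i + 1)) (A i)).comp (LinearMap.snd R (A (i + 1 + 1)) (A (i + 1)))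

def sH (A : ℤ → ModuleCat.{v} R) (i : ℤ) : sB A i →ₗ[R] sB A (i + 1) :=
  (LinearMap.inr R (A (i + 1 + 1)) (A (i + 1))).comp (LinearMap.fst R (A (i + 1)) (A i))

variable {F : ℤ → ModuleCat.{v} R} (d : ∀ i : ℤ, F (i + 1) →ₗ[R] F i)
  {A : ℤ → ModuleCat.{v} R} (ρ : ∀ i, A i →ₗ[R] F i)

def sPsi (i : ℤ) : sB A i →ₗ[R] F i := ((d i).comp (ρ (i + 1))).coprod (ρ i)

def sF (i : ℤ) : ModuleCat.{v} R := ModuleCat.of R (LinearMap.ker (sPsi d ρ i))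

def sI (i : ℤ) : sF d ρ i →ₗ[R] sB A i := (LinearMap.ker (sPsi d ρ i)).subtype

lemma sPsi_apply (i : ℤ) (a : A (i + 1)) (b : A i) :
    sPsi d ρ i (a, b) = d i (ρ (i + 1) a) + ρ i b := rfl

lemma sBd_sBd (i : ℤ) : (sBd A i).comp (sBd A (i + 1)) = 0 := by
  refine LinearMap.ext ?_
  rintro ⟨a, b⟩
  rfl

lemma sBd_sH (i : ℤ) :
    (sBd A (i + 1)).comp (sH A (i + 1)) + (sH A i).comp (sBd A i) = LinearMap.id := by
  refine LinearMap.ext ?_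
  rintro ⟨a, b⟩
  change ((a, 0) : sB A (i + 1)) + (0, b) = (a, b)
  simp

variable {d} in
lemma sPsi_sBd (hd : ∀ i, Exact (d (i + 1)) (d i)) (i : ℤ) :
    (sPsi d ρ i).comp (sBd A i) = (d i).comp (sPsi d ρ (i + 1)) := by
  refine LinearMap.ext ?_
  rintro ⟨a, b⟩
  change d i (ρ (i + 1) b) + ρ i 0 = d i (d (i + 1) (ρ (i + 1 + 1) a) + ρ (i + 1) b)
  rw [map_zero, add_zero, map_add, (hd i).apply_apply_eq_zero, zero_add]

variable {d ρ}

lemma sSES (hρ : ∀ i, Surjective (ρ i)) (i : ℤ) : SES_s4 (sI d ρ i) (sPsi d ρ i) :=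
  ses_ker (sPsi d ρ i) (fun x => by
    obtain ⟨a, rfl⟩ := hρ i x
    exact ⟨(0, a), by rw [sPsi_apply, map_zero, map_zero, zero_add]⟩)

/-- The differential of the kernel complex. -/
def sD (hd : ∀ i, Exact (d (i + 1)) (d i)) (i : ℤ) : sF d ρ (i + 1) →ₗ[R] sF d ρ i :=
  ((sBd A i).comp (sI d ρ (i + 1))).codRestrict (LinearMap.ker (sPsi d ρ i)) (fun x => by
    have h := DFunLike.congr_fun (sPsi_sBd ρ hd i) (sI d ρ (i + 1) x)
    rw [LinearMap.comp_apply, LinearMap.comp_apply] at h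
    have h2 : sPsi d ρ (i + 1) (sI d ρ (i + 1) x) = 0 := x.2
    rw [h2, map_zero] at h
    exact h)

lemma sI_sD (hd : ∀ i, Exact (d (i + 1)) (d i)) (i : ℤ) :
    (sI d ρ i).comp (sD hd i) = (sBd A i).comp (sI d ρ (i + 1)) := rfl

lemma proj_sB (hA : ∀ i, Module.Projective R (A i)) (i : ℤ) : Module.Projective R (sB A i) := by
  have := hA i
  have := hA (i + 1)
  infer_instance

lemma step_flat (h : GFC F d) (hA : ∀ i, Module.Projective R (A i))
    (hρ : ∀ i, Surjective (ρ i)) (i : ℤ) : IsFlatMod R (sF d ρ i) := by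
  have := proj_sB hA i
  have s := sSES (d := d) hρ i
  exact flat_kernel (sF d ρ i) (ModuleCat.of R (sB A i)) (F i) (sI d ρ i) (sPsi d ρ i)
    s.inj s.surj s.exact (isFlat_of_projective (ModuleCat.of R (sB A i))) (h.flat i)

lemma step_exact (hd : ∀ i, Exact (d (i + 1)) (d i)) (hρ : ∀ i, Surjective (ρ i)) (i : ℤ) :
    Exact (sD (ρ := ρ) hd (i + 1)) (sD (ρ := ρ) hd i) := by
  rintro ⟨⟨a, b⟩, hab⟩
  constructor
  · intro h0
    have hb : b = 0 := congrArg (fun x : sF d ρ i => (sI d ρ i x).1) h0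
    subst hb
    have hab' : d (i + 1) (ρ (i + 1 + 1) a) = 0 := by
      have : d (i + 1) (ρ (i + 1 + 1) a) + ρ (i + 1) 0 = 0 := hab
      rwa [map_zero, add_zero] at this
    obtain ⟨x, hx⟩ := (hd (i + 1) (ρ (i + 1 + 1) a)).1 hab'
    obtain ⟨a', rfl⟩ := hρ _ x
    refine ⟨⟨(-a', a), ?_⟩, rfl⟩
    change d (i + 1 + 1) (ρ (i + 1 + 1 + 1) (-a')) + ρ (i + 1 + 1) a = 0
    rw [map_neg, map_neg, hx, neg_add_cancel]
  · rintro ⟨y, hy⟩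
    rw [← hy]
    apply Subtype.ext
    exact DFunLike.congr_fun (sBd_sBd (A := A) i) (sI d ρ (i + 1 + 1) y)

lemma step_tensor (h : GFC F d) (hρ : ∀ i, Surjective (ρ i)) (I : ModuleCat.{v} Rᵐᵒᵖ)
    (hI : Module.Injective Rᵐᵒᵖ I) (i : ℤ) :
    Exact (rtMap R (I : Type v) (sD (ρ := ρ) h.exact (i + 1)))
      (rtMap R (I : Type v) (sD (ρ := ρ) h.exact i)) := by
  intro t
  constructor
  · intro ht
    have hψι : ∀ j (t : RTensor R I (sF d ρ j)),
        rtMap R I (sPsi d ρ j) (rtMap R I (sI d ρ j) t) = 0 := fun j t =>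
      (rt_right_exact (I := I) (sSES (d := d) hρ j).exact (sSES (d := d) hρ j).surj
        ).apply_apply_eq_zero t
    have hψB : ∀ j (t : RTensor R I (sB A (j + 1))),
        rtMap R I (sPsi d ρ j) (rtMap R I (sBd A j) t) =
          rtMap R I (d j) (rtMap R I (sPsi d ρ (j + 1)) t) := fun j t => by
      rw [rtMap_comp, rtMap_comp, sPsi_sBd ρ h.exact]
    have hιD : ∀ j (t : RTensor R I (sF d ρ (j + 1))),
        rtMap R I (sI d ρ j) (rtMap R I (sD h.exact j) t) =
          rtMap R I (sBd A j) (rtMap R I (sI d ρ (j + 1)) t) := fun j t => by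
      rw [rtMap_comp, rtMap_comp, sI_sD]
    obtain ⟨σ, hσ⟩ : ∃ σ, rtMap R I (sBd A (i + 1)) σ = rtMap R I (sI d ρ (i + 1)) t := by
      refine ⟨rtMap R I (sH A (i + 1)) (rtMap R I (sI d ρ (i + 1)) t), ?_⟩
      have e := congrArg (fun g => rtMap R I g (rtMap R I (sI d ρ (i + 1)) t)) (sBd_sH (A := A) i)
      rw [rtMap_id, rtMap_add, ← rtMap_comp, ← rtMap_comp (sBd A i) (sH A i), ← hιD, ht,
        map_zero, map_zero, add_zero] at e
      exact e
    obtain ⟨φ', hφ'⟩ := (h.tensor I hI (i + 1) (rtMap R I (sPsi d ρ (i + 1 + 1)) σ)).1 (by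
      rw [← hψB, hσ, hψι])
    obtain ⟨σ', rfl⟩ := rtMap_surj (I := I) (sSES (d := d) hρ (i + 1 + 1 + 1)).surj φ'
    obtain ⟨t', ht'⟩ := (rt_right_exact (I := I) (sSES (d := d) hρ (i + 1 + 1)).exact
      (sSES (d := d) hρ (i + 1 + 1)).surj (σ - rtMap R I (sBd A (i + 1 + 1)) σ')).1 (by
        rw [map_sub, hψB, hφ', sub_self])
    refine ⟨t', ?_⟩
    have s := sSES (d := d) hρ (i + 1)
    apply purity (F (i + 1)) (sI d ρ (i + 1)) (sPsi d ρ (i + 1)) s.inj s.surj s.exact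
      (h.flat _) I
    rw [hιD, ht', map_sub, hσ, rtMap_comp, sBd_sBd, rtMap_zero, sub_zero]
  · rintro ⟨t', rfl⟩
    rw [rtMap_comp]
    have : (sD h.exact i).comp (sD (ρ := ρ) h.exact (i + 1)) = 0 :=
      LinearMap.ext fun x => (step_exact h.exact hρ i).apply_apply_eq_zero x
    rw [this, rtMap_zero]

lemma step_GFC (h : GFC F d) (hA : ∀ i, Module.Projective R (A i))
    (hρ : ∀ i, Surjective (ρ i)) : GFC (sF d ρ) (sD h.exact) :=
  ⟨step_flat h hA hρ, step_exact h.exact hρ, step_tensor h hρ⟩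

lemma step_PD (hA : ∀ i, Module.Projective R (A i)) (hρ : ∀ i, Surjective (ρ i)) (i : ℤ)
    {K : ModuleCat.{v} R} (j : K →ₗ[R] A i) (hj : SES_s4 j (ρ i)) {k : ℕ} (hK : PD k K) :
    PD k (sF d ρ i) := by
  have := hA (i + 1)
  have s : SES_s4 (((LinearMap.inr R (A (i + 1)) (A i)).comp j).codRestrict
      (LinearMap.ker (sPsi d ρ i)) (fun x => by
        change d i (ρ (i + 1) 0) + ρ i (j x) = 0
        rw [map_zero, map_zero, zero_add, hj.exact.apply_apply_eq_zero]) : K →ₗ[R] sF d ρ i)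
      ((LinearMap.fst R (A (i + 1)) (A i)).comp (sI d ρ i)) := by
    refine ⟨fun x y hxy => ?_, ?_, ?_⟩
    · exact hj.inj (congrArg (fun x : sF d ρ i => (sI d ρ i x).2) hxy)
    · rintro ⟨⟨a, b⟩, hab⟩
      constructor
      · intro h0
        have h0' : a = 0 := h0
        subst h0'
        have hab' : d i (ρ (i + 1) 0) + ρ i b = 0 := hab
        rw [map_zero, map_zero, zero_add] at hab'
        obtain ⟨x, rfl⟩ := (hj.exact b).1 hab'
        exact ⟨x, rfl⟩
      · rintro ⟨x, hx⟩
        rw [← hx]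
        rfl
    · intro a
      obtain ⟨b, hb⟩ := hρ i (d i (ρ (i + 1) a))
      refine ⟨⟨(a, -b), ?_⟩, rfl⟩
      change d i (ρ (i + 1) a) + ρ i (-b) = 0
      rw [map_neg, hb, add_neg_cancel]
  obtain ⟨e⟩ := split_equiv _ _ s
  exact PD_equiv e (PD_prod (P := A (i + 1)) hK)

lemma step_SES (hd : ∀ i, Exact (d (i + 1)) (d i)) (hρ : ∀ i, Surjective (ρ i)) (i : ℤ) :
    ∃ (j : ModuleCat.of R (LinearMap.ker (sD (ρ := ρ) hd i)) →ₗ[R] A (i + 1 + 1))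
      (p : A (i + 1 + 1) →ₗ[R] ModuleCat.of R (LinearMap.ker (d i))),
      SES_s4 j p ∧ ∀ a, (p a).1 = d (i + 1) (ρ (i + 1 + 1) a) := by
  refine ⟨((LinearMap.fst R (A (i + 1 + 1)) (A (i + 1))).comp (sI d ρ (i + 1))).comp
      (LinearMap.ker (sD (ρ := ρ) hd i)).subtype,
    ((d (i + 1)).comp (ρ (i + 1 + 1))).codRestrict (LinearMap.ker (d i))
      (fun a => (hd i).apply_apply_eq_zero _), ⟨?_, ?_, ?_⟩, fun a => rfl⟩
  · rintro ⟨⟨⟨a, b⟩, hab⟩, h0⟩ ⟨⟨⟨a', b'⟩, hab'⟩, h0'⟩ hh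
    have hb : b = 0 := congrArg (fun x : sF d ρ i => (sI d ρ i x).1) h0
    have hb' : b' = 0 := congrArg (fun x : sF d ρ i => (sI d ρ i x).1) h0'
    have ha : a = a' := hh
    subst hb hb' ha
    rfl
  · intro a
    constructor
    · intro ha
      have ha' : d (i + 1) (ρ (i + 1 + 1) a) = 0 := congrArg Subtype.val ha
      refine ⟨⟨⟨(a, 0), ?_⟩, ?_⟩, rfl⟩
      · change d (i + 1) (ρ (i + 1 + 1) a) + ρ (i + 1) 0 = 0
        rw [ha', map_zero, add_zero]
      · exact Subtype.ext rfl
    · rintro ⟨⟨⟨⟨a', b⟩, hab⟩, h0⟩, rfl⟩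
      have hb : b = 0 := congrArg (fun x : sF d ρ i => (sI d ρ i x).1) h0
      subst hb
      have hab' : d (i + 1) (ρ (i + 1 + 1) a') + ρ (i + 1) 0 = 0 := hab
      rw [map_zero, add_zero] at hab'
      exact Subtype.ext hab'
  · rintro ⟨x, hx⟩
    obtain ⟨y, rfl⟩ := (hd i x).1 hx
    obtain ⟨a, rfl⟩ := hρ _ y
    exact ⟨a, rfl⟩

end Step

section Main

variable {R : Type u} [Ring R]

lemma part_one (k : ℕ) : ∀ (F : ℤ → ModuleCat.{v} R) (d : ∀ i : ℤ, F (i + 1) →ₗ[R] F i),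
    GFC F d → (∀ i, PD k (F i)) → GorProjDimLE R (ModuleCat.of R (LinearMap.ker (d (-1)))) k := by
  induction k with
  | zero =>
    intro F d h hP
    refine gpd_zero ⟨F, d, hP, h.exact, fun Q hQ i f => ?_, ⟨LinearEquiv.refl R _⟩⟩
    constructor
    · intro hf
      exact hom_exact_of_projective d hP (fun i x => (h.exact i).apply_apply_eq_zero x) h.tensor Q
        (isFlat_of_projective Q) i f hf
    · rintro ⟨g, rfl⟩
      refine LinearMap.ext fun x => ?_
      change g (d i (d (i + 1) x)) = 0
      rw [(h.exact i).apply_apply_eq_zero, map_zero]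
  | succ k ih =>
    intro F d h hP
    choose K A j ρ hs hA hK using hP
    have hρ := fun i => (hs i).surj
    obtain ⟨j', p', hs', -⟩ := step_SES (d := d) h.exact hρ (-1)
    have := hA (-1 + 1 + 1)
    exact gpd_succ hs' (gp_of_projective _) (ih _ _ (step_GFC h hA hρ)
      (fun i => step_PD hA hρ i (j i) (hs i) (hK i)))

/-- `Hom(-, C)` exactness. -/
lemma hom_exact (C : ModuleCat.{v} R) (hC : IsFlatMod R C)
    (hE : ∀ K : ModuleCat.{v} R, IsFlatMod R K → ExtP C K) (k : ℕ) :
    ∀ (F : ℤ → ModuleCat.{v} R) (d : ∀ i : ℤ, F (i + 1) →ₗ[R] F i),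
    GFC F d → (∀ i, PD k (F i)) → ∀ (i : ℤ) (f : F (i + 1) →ₗ[R] C), f.comp (d (i + 1)) = 0 →
      ∃ g : F i →ₗ[R] C, g.comp (d i) = f := by
  induction k with
  | zero =>
    intro F d h hP i f hf
    exact hom_exact_of_projective d hP (fun i x => (h.exact i).apply_apply_eq_zero x) h.tensor C
      hC i f hf
  | succ k ih =>
    intro F d h hP i f hf
    choose K A j ρ hs hA hK using hP
    have hρ := fun i => (hs i).surj
    obtain ⟨l, rfl⟩ : ∃ l, i = l + 1 := ⟨i - 1, by omega⟩
    let G : sB A (l + 1) →ₗ[R] C := (f.comp (sPsi d ρ (l + 1 + 1))).comp (sH A (l + 1))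
    have hG : ∀ a b, G (a, b) = f (ρ (l + 1 + 1) a) := by
      intro a b
      change f (d (l + 1 + 1) (ρ (l + 1 + 1 + 1) 0) + ρ (l + 1 + 1) a) = _
      rw [map_zero, map_zero, zero_add]
    have hf' : ∀ x, f (d (l + 1 + 1) x) = 0 := fun x => DFunLike.congr_fun hf x
    obtain ⟨γ, hγ⟩ := ih _ _ (step_GFC h hA hρ)
      (fun i => step_PD hA hρ i (j i) (hs i) (hK i)) l (G.comp (sI d ρ (l + 1))) (by
        refine LinearMap.ext ?_
        rintro ⟨⟨a, b⟩, hab⟩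
        change G (b, 0) = 0
        have hab' : d (l + 1 + 1) (ρ (l + 1 + 1 + 1) a) + ρ (l + 1 + 1) b = 0 := hab
        have := congrArg f hab'
        rw [map_add, hf', zero_add, map_zero] at this
        rw [hG, this])
    have hγ' : ∀ x, γ (sD h.exact l x) = G (sI d ρ (l + 1) x) := fun x => DFunLike.congr_fun hγ x
    obtain ⟨Γ, hΓ⟩ := hE (F l) (h.flat l) (sF d ρ l) (ModuleCat.of R (sB A l)) (sI d ρ l)
      (sPsi d ρ l) (sSES hρ l) γ
    obtain ⟨g, hg⟩ := factor (sPsi d ρ (l + 1)) (sSES (d := d) hρ (l + 1)).surj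
      (G - LinearMap.comp (M₂ := sB A l) Γ (sBd A l)) (by
        intro x hx
        obtain ⟨y, rfl⟩ := ((sSES (d := d) hρ (l + 1)).exact x).1 hx
        rw [LinearMap.sub_apply, ← hγ', ← hΓ, sub_eq_zero]
        rfl)
    refine ⟨g, LinearMap.ext fun x => ?_⟩
    obtain ⟨a, rfl⟩ := hρ _ x
    have h1 := hg (a, 0)
    rw [sPsi_apply, map_zero, add_zero, LinearMap.sub_apply, hG] at h1
    rw [LinearMap.comp_apply, h1, LinearMap.comp_apply]
    have : sBd A l ((a, 0) : sB A (l + 1)) = 0 := rfl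
    rw [this]
    erw [map_zero Γ]
    rw [sub_zero]

lemma extP_flat {n : ℕ} (hperf : LeftNPerfect.{u, v} R n) (C : ModuleCat.{v} R)
    (hC : IsCotorsion R C) (K : ModuleCat.{v} R) (hK : IsFlatMod R K) : ExtP C K := by
  obtain ⟨P, d, π, hP, hπ, h0, hex, -⟩ := hperf K hK
  have := hP 0
  have s := ses_ker π hπ
  refine extP_of (K := ModuleCat.of R (LinearMap.ker π)) _ _ s ?_
  intro φ
  let q : P 1 →ₗ[R] LinearMap.ker π := (d 0).codRestrict (LinearMap.ker π)
    (fun z => h0.apply_apply_eq_zero z)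
  obtain ⟨Φ, hΦ⟩ := (hC K hK ⟨P, d, π, hP, hπ, h0, hex⟩ (φ.comp q)).1 (by
    refine LinearMap.ext fun x => ?_
    change φ (q (d 1 x)) = 0
    have : q (d 1 x) = 0 := Subtype.ext ((hex 0).apply_apply_eq_zero x)
    rw [this, map_zero])
  refine ⟨Φ, ?_⟩
  rintro ⟨x, hx⟩
  obtain ⟨y, rfl⟩ := (h0 x).1 hx
  exact DFunLike.congr_fun hΦ y

lemma ev_zero {n : ℕ} (hpd : ∀ K : ModuleCat.{v} R, IsFlatMod R K → PD n K)
    (C : ModuleCat.{v} R) (hC : IsFlatMod R C)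
    (hE : ∀ K : ModuleCat.{v} R, IsFlatMod R K → ExtP C K)
    (F : ℤ → ModuleCat.{v} R) (d : ∀ i : ℤ, F (i + 1) →ₗ[R] F i) (h : GFC F d)
    (A : ModuleCat.{v} R) [Module.Projective R A] (i : ℤ) (ρ : A →ₗ[R] F (i + 1 + 1))
    (hρ : Surjective ρ) : ExtP C (ModuleCat.of R (LinearMap.ker (d i))) := by
  let θ : A →ₗ[R] LinearMap.ker (d i) := ((d (i + 1)).comp ρ).codRestrict (LinearMap.ker (d i))
      (fun a => (h.exact i).apply_apply_eq_zero _)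
  have hθ : Surjective θ := by
    rintro ⟨x, hx⟩
    obtain ⟨y, rfl⟩ := (h.exact i x).1 hx
    obtain ⟨a, rfl⟩ := hρ y
    exact ⟨a, rfl⟩
  refine extP_of (K := ModuleCat.of R (LinearMap.ker θ)) _ _ (ses_ker θ hθ) ?_
  intro φ
  have hθρ : ∀ a, a ∈ LinearMap.ker θ ↔ d (i + 1) (ρ a) = 0 := fun a =>
    ⟨fun h => congrArg Subtype.val h, fun h => Subtype.ext h⟩
  let κ : LinearMap.ker ρ →ₗ[R] LinearMap.ker θ := Submodule.inclusion (fun a ha => by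
    rw [hθρ, LinearMap.mem_ker.1 ha, map_zero])
  obtain ⟨α, hα⟩ := hE _ (h.flat (i + 1 + 1)) (ModuleCat.of R (LinearMap.ker ρ)) A _ _
    (ses_ker ρ hρ) (φ.comp κ)
  let q : LinearMap.ker θ →ₗ[R] LinearMap.ker (d (i + 1)) :=
    (ρ.comp (LinearMap.ker θ).subtype).codRestrict _ (fun x => (hθρ x.1).1 x.2)
  obtain ⟨β, hβ⟩ := factor q (by
    rintro ⟨x, hx⟩
    obtain ⟨a, rfl⟩ := hρ x
    exact ⟨⟨a, (hθρ a).2 hx⟩, rfl⟩) (φ - α.comp (LinearMap.ker θ).subtype) (by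
    rintro ⟨a, ha⟩ h0
    have h0' : ρ a = 0 := congrArg Subtype.val h0
    have := hα ⟨a, h0'⟩
    rw [LinearMap.sub_apply, sub_eq_zero]
    exact this.symm)
  let δ : F (i + 1 + 1 + 1) →ₗ[R] LinearMap.ker (d (i + 1)) :=
    (d (i + 1 + 1)).codRestrict _ (fun x => (h.exact (i + 1)).apply_apply_eq_zero x)
  obtain ⟨g, hg⟩ := hom_exact C hC hE n F d h (fun i => hpd _ (h.flat i)) (i + 1 + 1)
    (β.comp δ) (by
      refine LinearMap.ext fun x => ?_
      have : δ (d (i + 1 + 1 + 1) x) = 0 :=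
        Subtype.ext ((h.exact (i + 1 + 1)).apply_apply_eq_zero x)
      rw [LinearMap.comp_apply, LinearMap.comp_apply, this, map_zero]
      rfl)
  have hg' : ∀ x, g (d (i + 1 + 1) x) = β (δ x) := fun x => DFunLike.congr_fun hg x
  refine ⟨α + g.comp ρ, ?_⟩
  rintro ⟨a, ha⟩
  obtain ⟨y, hy⟩ := (h.exact (i + 1) (ρ a)).1 ((hθρ a).1 ha)
  have h1 : δ y = q ⟨a, ha⟩ := Subtype.ext hy
  have h2 := hβ ⟨a, ha⟩
  rw [← h1, ← hg', hy] at h2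
  change α a + g (ρ a) = _
  rw [h2]
  change α a + (φ ⟨a, ha⟩ - α a) = _
  abel

lemma ev_all {n : ℕ} (hpd : ∀ K : ModuleCat.{v} R, IsFlatMod R K → PD n K)
    (C : ModuleCat.{v} R) (hC : IsFlatMod R C)
    (hE : ∀ K : ModuleCat.{v} R, IsFlatMod R K → ExtP C K) (m : ℕ) :
    ∀ (F : ℤ → ModuleCat.{v} R) (d : ∀ i : ℤ, F (i + 1) →ₗ[R] F i), GFC F d → ∀ i : ℤ,
      EVall C m (ModuleCat.of R (LinearMap.ker (d i))) := by
  have hcov : ∀ M : ModuleCat.{v} R, IsFlatMod R M → ∃ (A : ModuleCat.{v} R) (ρ : A →ₗ[R] M),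
      Module.Projective R A ∧ Surjective ρ := by
    intro M hM
    have h := hpd M hM
    cases n with
    | zero => exact ⟨M, LinearMap.id, h, fun x => ⟨x, rfl⟩⟩
    | succ k =>
      obtain ⟨K, A, i, p, hs, hA, -⟩ := h
      exact ⟨A, p, hA, hs.surj⟩
  induction m with
  | zero =>
    intro F d h i
    obtain ⟨A, ρ, hA, hρ⟩ := hcov _ (h.flat (i + 1 + 1))
    exact ev_zero hpd C hC hE F d h A i ρ hρ
  | succ m ih =>
    intro F d h i K B j p hs hB
    choose A ρ hA hρ using fun i => hcov _ (h.flat i)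
    obtain ⟨j', p', hs', -⟩ := step_SES (d := d) h.exact hρ i
    have := hA (i + 1 + 1)
    exact EVall_schanuel hs' hs (ih _ _ (step_GFC h hA hρ) i)

end Main

end


/-- For a left GF-closed, left `n`-perfect ring `R`, the following
are equivalent: (1) `Gpd_R G ≤ n` for every Gorenstein flat `G`; (2) `Gpd_R G < ∞`
for every Gorenstein flat `G`; (3) `Ext^i(G, F) = 0` for every Gorenstein flat `G`,
every flat and cotorsion `F`, and all `i ≥ 1`. -/
theorem gpd_of_gorenstein_flat_tfae
    (R : Type u) [Ring R] (n : ℕ)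
    (hclosed : GFClosed.{u, v} R) (hperf : LeftNPerfect.{u, v} R n) :
    ((∀ G : ModuleCat.{v} R, IsGorensteinFlat R G → GorProjDimLE R G n) ↔
      (∀ G : ModuleCat.{v} R, IsGorensteinFlat R G → ∃ d : ℕ, GorProjDimLE R G d)) ∧
    ((∀ G : ModuleCat.{v} R, IsGorensteinFlat R G → ∃ d : ℕ, GorProjDimLE R G d) ↔
      (∀ (G F : ModuleCat.{v} R), IsGorensteinFlat R G → IsFlatMod R F →
        IsCotorsion R F → ∀ m : ℕ, ExtVanish R G F m)) := by
  have hpd : ∀ K : ModuleCat.{v} R, IsFlatMod R K → PD n K := fun K hK =>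
    PD_of_projDimLE n K (hperf K hK)
  have one : ∀ G : ModuleCat.{v} R, IsGorensteinFlat R G → GorProjDimLE R G n := by
    rintro G ⟨F, d, h1, h2, h3, ⟨e⟩⟩
    exact gpd_equiv (M := ModuleCat.of R (LinearMap.ker (d (-1)))) e.symm
      (part_one n F d ⟨h1, h2, h3⟩ (fun i => hpd _ (h1 i)))
  have three : ∀ (G F : ModuleCat.{v} R), IsGorensteinFlat R G → IsFlatMod R F →
        IsCotorsion R F → ∀ m : ℕ, ExtVanish R G F m := by
    rintro G C ⟨F, d, h1, h2, h3, ⟨e⟩⟩ hC hcot m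
    exact extVanish_of_EVall m G
      (EVall_equiv (M := ModuleCat.of R (LinearMap.ker (d (-1)))) e.symm
        (ev_all hpd C hC (extP_flat hperf C hcot) m F d ⟨h1, h2, h3⟩ (-1)))
  exact ⟨⟨fun h G hG => ⟨n, h G hG⟩, fun _ => one⟩, ⟨fun _ => three, fun _ G hG => ⟨n, one G hG⟩⟩⟩

end GorensteinPrecover
end

section
/- Let A be the ring of 3×3 upper triangular matrices with (1,1), (1,2) entries in ℚ, (2,2) entry in ℚ, (3,3) entry in ℚ, and (1,3), (2,3) entries in ℝ, and let K be the two-sided ideal of A consisting of matrices whose only possibly nonzero entry is the (1,3) entry (in ℝ). Let R = A/K. Then R is semiprimary: its Jacobson radical J(R) satisfies J(R)² = 0 and R/J(R) is isomorphic to ℚ × ℚ × ℚ, which is a semisimple ring. -/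
noncomputable section

open Function

namespace GorensteinPrecover

/-- The ring `A` of 3×3 upper triangular matrices with `(1,1)`, `(1,2)`, `(2,2)`,
`(3,3)` entries rational and `(1,3)`, `(2,3)` entries real, as a subring of
`Matrix (Fin 3) (Fin 3) ℝ`. -/
def Aring : Subring (Matrix (Fin 3) (Fin 3) ℝ) where
  carrier := {M | M 1 0 = 0 ∧ M 2 0 = 0 ∧ M 2 1 = 0 ∧
    (∃ q : ℚ, M 0 0 = (q : ℝ)) ∧ (∃ q : ℚ, M 0 1 = (q : ℝ)) ∧
    (∃ q : ℚ, M 1 1 = (q : ℝ)) ∧ (∃ q : ℚ, M 2 2 = (q : ℝ))}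
  zero_mem' := ⟨rfl, rfl, rfl, ⟨0, by simp⟩, ⟨0, by simp⟩, ⟨0, by simp⟩, ⟨0, by simp⟩⟩
  one_mem' := by
    refine ⟨?_, ?_, ?_, ⟨1, ?_⟩, ⟨0, ?_⟩, ⟨1, ?_⟩, ⟨1, ?_⟩⟩ <;>
      simp [Matrix.one_apply]
  add_mem' := by
    rintro a b ⟨ha10, ha20, ha21, ⟨qa00, ha00⟩, ⟨qa01, ha01⟩, ⟨qa11, ha11⟩, ⟨qa22, ha22⟩⟩
      ⟨hb10, hb20, hb21, ⟨qb00, hb00⟩, ⟨qb01, hb01⟩, ⟨qb11, hb11⟩, ⟨qb22, hb22⟩⟩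
    refine ⟨?_, ?_, ?_, ⟨qa00 + qb00, ?_⟩, ⟨qa01 + qb01, ?_⟩, ⟨qa11 + qb11, ?_⟩,
      ⟨qa22 + qb22, ?_⟩⟩ <;>
      simp [Matrix.add_apply, ha10, ha20, ha21, hb10, hb20, hb21,
        ha00, ha01, ha11, ha22, hb00, hb01, hb11, hb22]
  neg_mem' := by
    rintro a ⟨ha10, ha20, ha21, ⟨qa00, ha00⟩, ⟨qa01, ha01⟩, ⟨qa11, ha11⟩, ⟨qa22, ha22⟩⟩
    refine ⟨?_, ?_, ?_, ⟨-qa00, ?_⟩, ⟨-qa01, ?_⟩, ⟨-qa11, ?_⟩, ⟨-qa22, ?_⟩⟩ <;>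
      simp [Matrix.neg_apply, ha10, ha20, ha21, ha00, ha01, ha11, ha22]
  mul_mem' := by
    rintro a b ⟨ha10, ha20, ha21, ⟨qa00, ha00⟩, ⟨qa01, ha01⟩, ⟨qa11, ha11⟩, ⟨qa22, ha22⟩⟩
      ⟨hb10, hb20, hb21, ⟨qb00, hb00⟩, ⟨qb01, hb01⟩, ⟨qb11, hb11⟩, ⟨qb22, hb22⟩⟩
    refine ⟨?_, ?_, ?_, ⟨qa00 * qb00, ?_⟩, ⟨qa00 * qb01 + qa01 * qb11, ?_⟩,
      ⟨qa11 * qb11, ?_⟩, ⟨qa22 * qb22, ?_⟩⟩ <;>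
      simp [Matrix.mul_apply, Fin.sum_univ_three, ha10, ha20, ha21, hb10, hb20, hb21,
        ha00, ha01, ha11, ha22, hb00, hb01, hb11, hb22]

lemma mem_Aring_iff (M : Matrix (Fin 3) (Fin 3) ℝ) :
    M ∈ Aring ↔ (M 1 0 = 0 ∧ M 2 0 = 0 ∧ M 2 1 = 0 ∧
      (∃ q : ℚ, M 0 0 = (q : ℝ)) ∧ (∃ q : ℚ, M 0 1 = (q : ℝ)) ∧
      (∃ q : ℚ, M 1 1 = (q : ℝ)) ∧ (∃ q : ℚ, M 2 2 = (q : ℝ))) :=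
  Iff.rfl

/-- The ring congruence on `A` given by the two-sided ideal `K` of matrices in `A`
whose only possibly nonzero entry is the `(1,3)` entry: two matrices are related
exactly when they agree in all entries except possibly the `(1,3)` one, i.e. when
their difference lies in `K`. -/
def Kcon : RingCon Aring where
  r x y := ∀ i j : Fin 3, ¬(i = 0 ∧ j = 2) →
    (x : Matrix (Fin 3) (Fin 3) ℝ) i j = (y : Matrix (Fin 3) (Fin 3) ℝ) i j
  iseqv := by
    constructor
    · intro x i j _; rfl
    · intro x y h i j hij; exact (h i j hij).symm
    · intro x y z h h' i j hij; exact (h i j hij).trans (h' i j hij)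
  add' := by
    intro w x y z h h' i j hij
    simp only [Subring.coe_add, Matrix.add_apply, h i j hij, h' i j hij]
  mul' := by
    intro w x y z h h' i j hij
    obtain ⟨hw10, hw20, hw21, -, -, -, -⟩ := w.2
    obtain ⟨hx10, hx20, hx21, -, -, -, -⟩ := x.2
    obtain ⟨hy10, hy20, hy21, -, -, -, -⟩ := y.2
    obtain ⟨hz10, hz20, hz21, -, -, -, -⟩ := z.2
    have h00 := h 0 0 (by decide); have h01 := h 0 1 (by decide)
    have h10 := h 1 0 (by decide); have h11 := h 1 1 (by decide)
    have h12 := h 1 2 (by decide); have h20 := h 2 0 (by decide)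
    have h21 := h 2 1 (by decide); have h22 := h 2 2 (by decide)
    have k00 := h' 0 0 (by decide); have k01 := h' 0 1 (by decide)
    have k10 := h' 1 0 (by decide); have k11 := h' 1 1 (by decide)
    have k12 := h' 1 2 (by decide); have k20 := h' 2 0 (by decide)
    have k21 := h' 2 1 (by decide); have k22 := h' 2 2 (by decide)
    simp only [Subring.coe_mul, Matrix.mul_apply, Fin.sum_univ_three]
    fin_cases i <;> fin_cases j <;>
      simp_all

end GorensteinPrecover

end

namespace GorensteinPrecover

/-- The quotient ring `R = A/K`. -/
abbrev Rquot : Type := Kcon.Quotient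

/-- The rational diagonal entries. -/
lemma exists_diag (M : Aring) (i : Fin 3) : ∃ q : ℚ, M.1 i i = (q : ℝ) := by
  obtain ⟨-, -, -, h0, -, h1, h2⟩ := M.2
  fin_cases i
  · exact h0
  · exact h1
  · exact h2

/-- The `i`-th diagonal entry, as a rational number. -/
noncomputable def dg (i : Fin 3) (M : Aring) : ℚ := (exists_diag M i).choose

lemma dg_spec (i : Fin 3) (M : Aring) : (dg i M : ℝ) = M.1 i i :=
  (exists_diag M i).choose_spec.symm

lemma mul_diag (M N : Aring) (i : Fin 3) : (M * N).1 i i = M.1 i i * N.1 i i := by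
  obtain ⟨a, b, c, -⟩ := M.2
  obtain ⟨a', b', c', -⟩ := N.2
  fin_cases i <;> simp [Matrix.mul_apply, Fin.sum_univ_three, a, b, c, a', b', c']

/-- The `i`-th diagonal entry as a ring homomorphism. -/
noncomputable def dgHom (i : Fin 3) : Aring →+* ℚ where
  toFun := dg i
  map_one' := by
    apply Rat.cast_injective (α := ℝ); rw [dg_spec]; simp
  map_zero' := by
    apply Rat.cast_injective (α := ℝ); rw [dg_spec]; simp
  map_add' M N := by
    apply Rat.cast_injective (α := ℝ); push_cast; simp only [dg_spec]; simp
  map_mul' M N := by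
    apply Rat.cast_injective (α := ℝ); push_cast; simp only [dg_spec]; exact mul_diag M N i

/-- The diagonal as a ring homomorphism on the quotient. -/
noncomputable def diagHom : Rquot →+* ℚ × ℚ × ℚ :=
  Kcon.lift ((dgHom 0).prod ((dgHom 1).prod (dgHom 2))) (by
    intro M N h
    have key : ∀ i, dgHom i M = dgHom i N := by
      intro i
      apply Rat.cast_injective (α := ℝ)
      change (dg i M : ℝ) = dg i N
      rw [dg_spec, dg_spec]
      exact h i i (by rintro ⟨rfl, h⟩; exact absurd h (by decide))
    change (_, _, _) = (_, _, _)
    rw [Prod.mk.injEq, Prod.mk.injEq]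
    exact ⟨key 0, key 1, key 2⟩)

lemma diagHom_mk (M : Aring) : diagHom (Kcon.mk' M) = (dg 0 M, dg 1 M, dg 2 M) := rfl

lemma mk'_surj : Function.Surjective Kcon.mk' := Kcon.mk'_surjective

lemma diagHom_surj : Function.Surjective diagHom := by
  rintro ⟨a, b, c⟩
  refine ⟨Kcon.mk' ⟨Matrix.diagonal ![(a : ℝ), b, c], ?_⟩, ?_⟩
  · rw [mem_Aring_iff]
    exact ⟨by simp [Matrix.diagonal], by simp [Matrix.diagonal], by simp [Matrix.diagonal],
      ⟨a, by simp⟩, ⟨0, by simp [Matrix.diagonal]⟩, ⟨b, by simp⟩, ⟨c, by simp⟩⟩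
  · rw [diagHom_mk, Prod.mk.injEq, Prod.mk.injEq]
    refine ⟨?_, ?_, ?_⟩ <;> apply Rat.cast_injective (α := ℝ) <;> rw [dg_spec] <;> simp

lemma mul_eq_zero_of_diag {x y : Rquot} (hx : diagHom x = 0) (hy : diagHom y = 0) :
    x * y = 0 := by
  obtain ⟨M, rfl⟩ := mk'_surj x
  obtain ⟨N, rfl⟩ := mk'_surj y
  rw [diagHom_mk, Prod.mk_eq_zero, Prod.mk_eq_zero] at hx hy
  obtain ⟨p0, p1, p2⟩ := hx
  obtain ⟨q0, q1, q2⟩ := hy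
  have P0 := dg_spec 0 M
  have P1 := dg_spec 1 M
  have P2 := dg_spec 2 M
  have Q0 := dg_spec 0 N
  have Q1 := dg_spec 1 N
  have Q2 := dg_spec 2 N
  rw [p0, Rat.cast_zero] at P0
  rw [p1, Rat.cast_zero] at P1
  rw [p2, Rat.cast_zero] at P2
  rw [q0, Rat.cast_zero] at Q0
  rw [q1, Rat.cast_zero] at Q1
  rw [q2, Rat.cast_zero] at Q2
  obtain ⟨a, b, c, -⟩ := M.2
  obtain ⟨a', b', c', -⟩ := N.2
  rw [← map_mul, ← map_zero Kcon.mk']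
  refine (RingCon.eq Kcon).2 ?_
  intro i j hij
  fin_cases i <;> fin_cases j <;>
    simp [Matrix.mul_apply, Fin.sum_univ_three, a, b, c, a', b', c', ← P0, ← P1, ← P2,
      ← Q0, ← Q1, ← Q2] at hij ⊢

lemma diagHom_eq_zero_iff (x : Rquot) :
    diagHom x = 0 ↔ x ∈ Ideal.jacobson (⊥ : Ideal Rquot) := by
  rw [Ideal.mem_jacobson_iff]
  constructor
  · intro hx y
    refine ⟨1 - y * x, ?_⟩
    have h : diagHom (y * x) = 0 := by rw [map_mul, hx, mul_zero]
    have h2 := mul_eq_zero_of_diag h h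
    rw [Ideal.mem_bot, mul_assoc, sub_mul, h2]
    simp
  · intro h
    obtain ⟨y, hy⟩ := diagHom_surj
      (-(diagHom x).1⁻¹, -(diagHom x).2.1⁻¹, -(diagHom x).2.2⁻¹)
    obtain ⟨z, hz⟩ := h y
    rw [Ideal.mem_bot] at hz
    have e := congrArg diagHom hz
    rw [map_sub, map_add, map_mul, map_mul, hy, map_one, map_zero] at e
    generalize diagHom x = u at e
    generalize diagHom z = v at e
    obtain ⟨u0, u1, u2⟩ := u
    obtain ⟨v0, v1, v2⟩ := v
    have key : ∀ u v : ℚ, v * -u⁻¹ * u + v - 1 = 0 → u = 0 := by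
      intro u v h
      by_contra hu
      have : v * -u⁻¹ * u = -v := by field_simp
      rw [this] at h
      norm_num at h
    have e0 := key u0 v0 (congrArg Prod.fst e)
    have e1 := key u1 v1 (congrArg (fun t => t.2.1) e)
    have e2 := key u2 v2 (congrArg (fun t => t.2.2) e)
    rw [e0, e1, e2]
    rfl

/-- The ring `R = A/K` is semiprimary: its Jacobson radical `J(R)`
satisfies `J(R)² = 0`, and `R/J(R)` is isomorphic to `ℚ × ℚ × ℚ`, which is a
semisimple ring. -/
theorem Rquot_semiprimary :
    (∀ a ∈ Ideal.jacobson (⊥ : Ideal Rquot), ∀ b ∈ Ideal.jacobson (⊥ : Ideal Rquot),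
      a * b = 0) ∧
    (∃ f : Rquot →+* ℚ × ℚ × ℚ, Function.Surjective f ∧
      ∀ x : Rquot, f x = 0 ↔ x ∈ Ideal.jacobson (⊥ : Ideal Rquot)) ∧
    IsSemisimpleRing (ℚ × ℚ × ℚ) := by
  refine ⟨?_, ⟨diagHom, diagHom_surj, diagHom_eq_zero_iff⟩, inferInstance⟩
  intro a ha b hb
  exact mul_eq_zero_of_diag ((diagHom_eq_zero_iff a).2 ha) ((diagHom_eq_zero_iff b).2 hb)

end GorensteinPrecover
end

section
/- Let A be the ring of 3×3 upper triangular matrices with (1,1), (1,2) entries in ℚ, (2,2) entry in ℚ, (3,3) entry in ℚ, and (1,3), (2,3) entries in ℝ, and let K be the two-sided ideal of A consisting of matrices whose only possibly nonzero entry is the (1,3) entry. Then the quotient ring R = A/K has left global dimension at most 2. -/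
/-!
Common definitions: Gorenstein projective/flat modules, Ext-vanishing via projective
resolutions, Gorenstein projective dimension, flat and cotorsion modules over an
arbitrary (possibly noncommutative) ring, tensor product of a right module with a
left module, coherence and perfectness conditions.
-/

universe u v

namespace GorensteinPrecover

section Triangular

variable {R : Type} [Ring R]

/-- The left ideal `R e` for an idempotent `e`, as the set of `x` with `x * e = x`. -/
def leftIdem (e : R) : Submodule R R where
  carrier := {x | x * e = x}
  zero_mem' := by simp
  add_mem' := by
    intro a b ha hb
    simp only [Set.mem_setOf_eq] at *
    rw [add_mul, ha, hb]
  smul_mem' := by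
    intro c x hx
    simp only [Set.mem_setOf_eq, smul_eq_mul] at *
    rw [mul_assoc, hx]

lemma leftIdem_mul (e : R) (x : leftIdem e) : (x : R) * e = x := x.2

lemma leftIdem_projective (e : R) (he : e * e = e) : Module.Projective R (leftIdem e) := by
  refine Module.Projective.of_split (leftIdem e).subtype
    ((LinearMap.toSpanSingleton R R e).codRestrict (leftIdem e) ?_) ?_
  · intro x
    change (x * e) * e = x * e
    rw [mul_assoc, he]
  · ext x
    exact x.2

lemma cover_exists (c : ℚ →+* R) (hc : ∀ q x, c q * x = x * c q) (e : R) (he : e * e = e)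
    (heR : ∀ x, ∃ q, e * x * e = c q * e)
    (N : Type v) [AddCommGroup N] [Module R N] :
    ∃ (P : Type v) (_ : AddCommGroup P) (_ : Module R P) (φ : P →ₗ[R] N),
      Module.Projective R P ∧ (∀ z, e • z = z → φ z = 0 → z = 0) ∧
      (∀ n : N, ∃ z, φ z = e • n) ∧
      (∀ f : R, (∀ x, f * x * e = 0) → ∀ z : P, f • z = 0) := by
  letI : Module ℚ N := Module.compHom N c
  have hsm : ∀ (q : ℚ) (n : N), q • n = c q • n := fun _ _ => rfl
  let E : Submodule ℚ N :=
    { carrier := {n | e • n = n}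
      zero_mem' := by simp
      add_mem' := by
        intro a b ha hb
        simp only [Set.mem_setOf_eq] at *
        rw [smul_add, ha, hb]
      smul_mem' := by
        intro q n hn
        simp only [Set.mem_setOf_eq] at *
        rw [hsm, smul_smul, ← hc, mul_smul, hn] }
  let b := Module.Basis.ofVectorSpace ℚ E
  haveI := leftIdem_projective e he
  let φ : (Module.Basis.ofVectorSpaceIndex ℚ E →₀ leftIdem e) →ₗ[R] N :=
    Finsupp.lsum ℕ (fun i => (LinearMap.toSpanSingleton R N (b i : N)).comp (leftIdem e).subtype)
  have hφ : ∀ z, φ z = z.sum fun i x => (x : R) • (b i : N) := fun z => rfl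
  refine ⟨_, inferInstance, inferInstance, φ, ?_, ?_, ?_, ?_⟩
  · classical
    exact Module.Projective.of_equiv (finsuppLequivDFinsupp R).symm
  · intro z hz h0
    have h1 : ∀ i, ∃ q, ((z i : leftIdem e) : R) = c q * e := by
      intro i
      obtain ⟨q, hq⟩ := heR (z i)
      refine ⟨q, ?_⟩
      rw [← hq, mul_assoc, leftIdem_mul]
      have := congrArg (fun w => ((w i : leftIdem e) : R)) hz
      exact this.symm
    choose q hq using h1
    have hs : ∑ i ∈ z.support, q i • b i = 0 := by
      apply Subtype.ext
      rw [hφ, Finsupp.sum] at h0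
      rw [← E.subtype_apply, map_sum, ← E.subtype_apply, map_zero, ← h0]
      refine Finset.sum_congr rfl fun i _ => ?_
      rw [hq i, mul_smul, map_smul, hsm]
      congr 1
      exact (b i).2.symm
    have hli := linearIndependent_iff'.1 b.linearIndependent z.support q hs
    ext i
    by_cases hi : i ∈ z.support
    · rw [hq i, hli i hi]; simp
    · simp [Finsupp.notMem_support_iff.1 hi]
  · intro n
    have hn : e • n ∈ E := by
      change e • e • n = e • n
      rw [smul_smul, he]
    have hmem : ∀ q, c q * e ∈ leftIdem e := fun q => by
      change c q * e * e = c q * e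
      rw [mul_assoc, he]
    refine ⟨∑ i ∈ (b.repr ⟨_, hn⟩).support,
      Finsupp.single i ⟨c (b.repr ⟨_, hn⟩ i) * e, hmem _⟩, ?_⟩
    have h2 := congrArg E.subtype (b.linearCombination_repr ⟨_, hn⟩)
    rw [Finsupp.linearCombination_apply, Finsupp.sum, map_sum] at h2
    rw [map_sum]
    refine Eq.trans (Finset.sum_congr rfl fun i _ => ?_) h2
    rw [hφ, Finsupp.sum_single_index (by simp), map_smul, hsm, mul_smul]
    congr 1
    exact (b i).2
  · intro f hf z
    ext i
    have : f * (z i : R) = 0 := by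
      rw [← leftIdem_mul e (z i), ← mul_assoc, hf]
    simpa using this

/-- Global dimension at most two for a triangular ring with three diagonal idempotents. -/
lemma triangular_projDim (c : ℚ →+* R) (hc : ∀ q x, c q * x = x * c q) (e₁ e₂ e₃ : R)
    (h₁ : e₁ * e₁ = e₁) (h₂ : e₂ * e₂ = e₂) (h₃ : e₃ * e₃ = e₃) (hsum : e₁ + e₂ + e₃ = 1)
    (hR₁ : ∀ x, ∃ q, e₁ * x * e₁ = c q * e₁) (hR₂ : ∀ x, ∃ q, e₂ * x * e₂ = c q * e₂)
    (hR₃ : ∀ x, ∃ q, e₃ * x * e₃ = c q * e₃)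
    (h21 : ∀ x, e₂ * x * e₁ = 0) (h31 : ∀ x, e₃ * x * e₁ = 0) (h32 : ∀ x, e₃ * x * e₂ = 0)
    (M : ModuleCat.{v} R) : ProjDimLE R M 2 := by
  have hdec : ∀ {N : Type v} [AddCommGroup N] [Module R N] (n : N),
      n = e₁ • n + e₂ • n + e₃ • n := by
    intro N _ _ n
    rw [← add_smul, ← add_smul, hsum, one_smul]
  -- modules concentrated in vertex 1
  have stepA : ∀ (N : Type v) [AddCommGroup N] [Module R N],
      (∀ n : N, e₂ • n = 0) → (∀ n : N, e₃ • n = 0) → Module.Projective R N := by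
    intro N _ _ hN2 hN3
    obtain ⟨P, _, _, φ, hP, hi, hs, hf⟩ := cover_exists c hc e₁ h₁ hR₁ N
    refine Module.Projective.of_equiv (LinearEquiv.ofBijective φ ⟨?_, ?_⟩)
    · rw [injective_iff_map_eq_zero]
      intro z hz
      refine hi z ?_ hz
      conv_rhs => rw [hdec z, hf e₂ h21, hf e₃ h31]
      simp
    · intro n
      obtain ⟨z, hz⟩ := hs n
      refine ⟨z, ?_⟩
      conv_rhs => rw [hdec n, hN2, hN3]
      simp [hz]
  have stepB : ∀ (N : Type v) [AddCommGroup N] [Module R N], (∀ n : N, e₃ • n = 0) →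
      ∃ (P : Type v) (_ : AddCommGroup P) (_ : Module R P) (φ : P →ₗ[R] N),
        Module.Projective R P ∧ Function.Surjective φ ∧ Module.Projective R (LinearMap.ker φ) := by
    intro N _ _ hN3
    obtain ⟨P, _, _, φ, hP, hi, hs, hf⟩ := cover_exists c hc e₁ h₁ hR₁ N
    obtain ⟨P', _, _, φ', hP', hi', hs', hf'⟩ := cover_exists c hc e₂ h₂ hR₂ N
    refine ⟨P × P', inferInstance, inferInstance, φ.coprod φ', inferInstance, ?_, ?_⟩
    · intro n
      obtain ⟨z, hz⟩ := hs n
      obtain ⟨z', hz'⟩ := hs' n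
      refine ⟨(z, z'), ?_⟩
      conv_rhs => rw [hdec n, hN3]
      simp [hz, hz']
    · refine stepA _ ?_ ?_
      · rintro ⟨⟨z, z'⟩, hz⟩
        have hk := (LinearMap.ker (φ.coprod φ')).smul_mem e₂ hz
        rw [LinearMap.mem_ker] at hk
        have hz0 : e₂ • z = 0 := hf e₂ h21 z
        have hz1 : e₂ • z' = 0 := by
          refine hi' _ (by rw [smul_smul, h₂]) ?_
          simpa [hz0, -map_smul] using hk
        apply Subtype.ext
        exact Prod.ext hz0 hz1
      · rintro ⟨⟨z, z'⟩, hz⟩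
        apply Subtype.ext
        exact Prod.ext (hf e₃ h31 z) (hf' e₃ h32 z')
  have stepC : ∀ (N : Type v) [AddCommGroup N] [Module R N],
      ∃ (P : Type v) (_ : AddCommGroup P) (_ : Module R P) (φ : P →ₗ[R] N),
        Module.Projective R P ∧ Function.Surjective φ ∧ ∀ z : LinearMap.ker φ, e₃ • z = 0 := by
    intro N _ _
    obtain ⟨P, _, _, φ, hP, hi, hs, hf⟩ := cover_exists c hc e₁ h₁ hR₁ N
    obtain ⟨P', _, _, φ', hP', hi', hs', hf'⟩ := cover_exists c hc e₂ h₂ hR₂ N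
    obtain ⟨Q, _, _, ψ, hQ, hj, ht, hg⟩ := cover_exists c hc e₃ h₃ hR₃ N
    refine ⟨(P × P') × Q, inferInstance, inferInstance, (φ.coprod φ').coprod ψ,
      inferInstance, ?_, ?_⟩
    · intro n
      obtain ⟨z, hz⟩ := hs n
      obtain ⟨z', hz'⟩ := hs' n
      obtain ⟨w, hw⟩ := ht n
      refine ⟨((z, z'), w), ?_⟩
      conv_rhs => rw [hdec n]
      simp [hz, hz', hw]
    · rintro ⟨⟨⟨z, z'⟩, w⟩, hz⟩
      have hk := (LinearMap.ker ((φ.coprod φ').coprod ψ)).smul_mem e₃ hz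
      rw [LinearMap.mem_ker] at hk
      have hz0 : e₃ • z = 0 := hf e₃ h31 z
      have hz1 : e₃ • z' = 0 := hf' e₃ h32 z'
      have hz2 : e₃ • w = 0 := by
        refine hj _ (by rw [smul_smul, h₃]) ?_
        simpa [hz0, hz1, -map_smul] using hk
      apply Subtype.ext
      exact Prod.ext (Prod.ext hz0 hz1) hz2
  obtain ⟨P0, _, _, π, hP0, hπ, hker⟩ := stepC M
  obtain ⟨P1, _, _, ρ, hP1, hρ, hP2⟩ := stepB (LinearMap.ker π) hker
  refine ⟨fun i => match i with
      | 0 => ModuleCat.of R P0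
      | 1 => ModuleCat.of R P1
      | 2 => ModuleCat.of R (LinearMap.ker ρ)
      | _ + 3 => ModuleCat.of R PUnit.{v + 1},
    fun i => match i with
      | 0 => (LinearMap.ker π).subtype.comp ρ
      | 1 => (LinearMap.ker ρ).subtype
      | 2 => (0 : PUnit.{v + 1} →ₗ[R] LinearMap.ker ρ)
      | _ + 3 => (0 : PUnit.{v + 1} →ₗ[R] PUnit.{v + 1}),
    π, ?_, hπ, ?_, ?_, ?_⟩
  · rintro (_ | _ | _ | i)
    · exact hP0
    · exact hP1
    · exact hP2
    · change Module.Projective R PUnit.{v + 1}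
      infer_instance
  · intro x
    change π x = 0 ↔ x ∈ Set.range fun y => ((ρ y : LinearMap.ker π) : P0)
    constructor
    · intro hx
      obtain ⟨y, hy⟩ := hρ ⟨x, hx⟩
      exact ⟨y, by simp [hy]⟩
    · rintro ⟨y, rfl⟩
      exact (ρ y).2
  · rintro (_ | _ | _ | i)
    · intro x
      change ((ρ x : LinearMap.ker π) : P0) = 0 ↔
        x ∈ Set.range fun y : LinearMap.ker ρ => (y : P1)
      constructor
      · intro hx
        exact ⟨⟨x, Subtype.ext hx⟩, rfl⟩
      · rintro ⟨y, rfl⟩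
        rw [LinearMap.mem_ker.1 y.2]; rfl
    · intro x
      change (x : P1) = 0 ↔ x ∈ Set.range fun _ : PUnit.{v + 1} => (0 : LinearMap.ker ρ)
      constructor
      · intro hx
        exact ⟨PUnit.unit, Subtype.ext hx.symm⟩
      · rintro ⟨y, rfl⟩
        rfl
    · intro x
      exact ⟨fun _ => ⟨PUnit.unit, rfl⟩, fun _ => rfl⟩
    · intro x
      exact ⟨fun _ => ⟨PUnit.unit, rfl⟩, fun _ => rfl⟩
  · rintro (_ | _ | _ | i) hi
    · omega
    · omega
    · omega
    · change Subsingleton PUnit.{v + 1}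
      infer_instance

end Triangular

/-- Rational scalar matrices inside `A`. -/
noncomputable def scalA : ℚ →+* Aring :=
  ((Matrix.scalar (Fin 3)).comp (algebraMap ℚ ℝ)).codRestrict Aring (by
    intro q
    refine ⟨?_, ?_, ?_, ⟨q, ?_⟩, ⟨0, ?_⟩, ⟨q, ?_⟩, ⟨q, ?_⟩⟩ <;> simp)

lemma scalA_coe (q : ℚ) :
    (scalA q : Matrix (Fin 3) (Fin 3) ℝ) = Matrix.diagonal fun _ => (q : ℝ) := rfl

/-- The diagonal idempotents of `A`. -/
noncomputable def idemA (i : Fin 3) : Aring :=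
  ⟨Matrix.diagonal (Pi.single i 1), by
    refine ⟨?_, ?_, ?_, ⟨(Pi.single i 1 : Fin 3 → ℚ) 0, ?_⟩, ⟨0, ?_⟩,
      ⟨(Pi.single i 1 : Fin 3 → ℚ) 1, ?_⟩, ⟨(Pi.single i 1 : Fin 3 → ℚ) 2, ?_⟩⟩ <;>
      fin_cases i <;> simp⟩

lemma idemA_coe (i : Fin 3) :
    (idemA i : Matrix (Fin 3) (Fin 3) ℝ) = Matrix.diagonal (Pi.single i 1) := rfl

lemma scalA_comm (q : ℚ) (a : Aring) : scalA q * a = a * scalA q := by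
  apply Subtype.ext
  ext i j
  simp [scalA_coe, mul_comm]

lemma idemA_mul_self (i : Fin 3) : idemA i * idemA i = idemA i := by
  apply Subtype.ext
  simp only [Subring.coe_mul, idemA_coe, Matrix.diagonal_mul_diagonal]
  congr 1
  ext k
  by_cases hk : k = i <;> simp [hk]

lemma idemA_sum : idemA 0 + idemA 1 + idemA 2 = 1 := by
  apply Subtype.ext
  ext i j
  fin_cases i <;> fin_cases j <;> simp [idemA_coe, Matrix.one_apply]

lemma idemA_corner (i : Fin 3) (a : Aring) : ∃ q, idemA i * a * idemA i = scalA q * idemA i := by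
  have h : ∃ q : ℚ, (a : Matrix (Fin 3) (Fin 3) ℝ) i i = q := by
    obtain ⟨-, -, -, h0, -, h1, h2⟩ := a.2
    fin_cases i
    · exact h0
    · exact h1
    · exact h2
  obtain ⟨q, hq⟩ := h
  refine ⟨q, Subtype.ext ?_⟩
  ext k l
  simp only [Subring.coe_mul, idemA_coe, scalA_coe, Matrix.mul_diagonal, Matrix.diagonal_mul,
    Matrix.diagonal_apply, Pi.single_apply]
  by_cases hk : k = i <;> by_cases hl : l = i <;> simp_all

lemma idemA_low (i j : Fin 3) (hij : j < i) (a : Aring) : idemA i * a * idemA j = 0 := by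
  have h : (a : Matrix (Fin 3) (Fin 3) ℝ) i j = 0 := by
    obtain ⟨h0, h1, h2, -⟩ := a.2
    fin_cases i <;> fin_cases j <;> first | exact h0 | exact h1 | exact h2 | simp at hij
  apply Subtype.ext
  ext k l
  simp only [Subring.coe_mul, idemA_coe, Matrix.mul_diagonal, Matrix.diagonal_mul,
    Pi.single_apply]
  by_cases hk : k = i <;> by_cases hl : l = j <;> simp_all

/-- The quotient ring `R = A/K` has left global dimension at most
`2`: every left `R`-module has projective dimension at most `2`. -/
theorem Rquot_global_dimension_le_two :
    ∀ M : ModuleCat.{v} Rquot, ProjDimLE Rquot M 2 := by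
  intro M
  have hsurj : Function.Surjective Kcon.mk' := Kcon.mk'_surjective
  have idem : ∀ i, Kcon.mk' (idemA i) * Kcon.mk' (idemA i) = Kcon.mk' (idemA i) := by
    intro i
    rw [← map_mul, idemA_mul_self]
  have corner : ∀ i x, ∃ q, Kcon.mk' (idemA i) * x * Kcon.mk' (idemA i) =
      (Kcon.mk'.comp scalA) q * Kcon.mk' (idemA i) := by
    intro i x
    obtain ⟨a, rfl⟩ := hsurj x
    obtain ⟨q, hq⟩ := idemA_corner i a
    refine ⟨q, ?_⟩
    rw [← map_mul, ← map_mul, hq, map_mul]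
    rfl
  have low : ∀ i j : Fin 3, j < i → ∀ x, Kcon.mk' (idemA i) * x * Kcon.mk' (idemA j) = 0 := by
    intro i j hij x
    obtain ⟨a, rfl⟩ := hsurj x
    rw [← map_mul, ← map_mul, idemA_low i j hij, map_zero]
  refine triangular_projDim (Kcon.mk'.comp scalA) ?_
    (Kcon.mk' (idemA 0)) (Kcon.mk' (idemA 1)) (Kcon.mk' (idemA 2)) (idem 0) (idem 1) (idem 2)
    ?_ (corner 0) (corner 1) (corner 2) (low 1 0 (by decide)) (low 2 0 (by decide))
    (low 2 1 (by decide)) M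
  · intro q x
    obtain ⟨a, rfl⟩ := hsurj x
    change Kcon.mk' (scalA q) * Kcon.mk' a = Kcon.mk' a * Kcon.mk' (scalA q)
    rw [← map_mul, ← map_mul, scalA_comm]
  · rw [← map_add, ← map_add, idemA_sum, map_one]

end GorensteinPrecover
end
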